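/- Let f = (f1,f2,f21,f3): (L,d,λ) → (L′,d′,λ′) be a weak morphism of weak Lie 3-algebras over a commutative ring k in which 2 and 3 are invertible. Then the skew-symmetrization (f̄1,f̄2,f̄3) is a morphism of (semi-strict) Lie 3-algebras from (L,d,λ̄) to (L′,d′,λ̄′): f̄2 and f̄3 are skew-symmetric and equations (M1)–(M4) hold with the structure maps λ replaced by the skew-symmetrization λ̄ and λ′ replaced by λ̄′. -/

import Mathlib

namespace WL3

open Finset

/-! ## Graded multilinear maps -/

/-- Cast along an equality of degrees. -/
def gcast {M : ℤ → Type} {i j : ℤ} (h : i = j) (x : M i) : M j := h ▸ x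

/-- A degree-`r`, arity-`m` map between ℤ-graded types, given by its components on
homogeneous tuples: its component at degrees `d` maps `L (d 1) ⊗ ⋯ ⊗ L (d m)` to
`M (r + d 1 + ⋯ + d m)`. -/
abbrev MMap (L M : ℤ → Type) (m : ℕ) (r : ℤ) : Type :=
  ∀ d : Fin m → ℤ, (∀ j, L (d j)) → M (r + ∑ j, d j)

variable {L M N : ℤ → Type}

/-- Cast an `MMap` along equalities of arities and degrees. -/
def mcast {m m' : ℕ} {r r' : ℤ} (hm : m = m') (hr : r = r') (μ : MMap L M m r) :
    MMap L M m' r' := by subst hm; subst hr; exact μ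

/-- Koszul sign of the permutation `σ` acting on a tuple of homogeneous elements of
degrees `d`: `∏_{i<j, σ i > σ j} (-1)^(d i · d j)`. -/
def koszulSign {m : ℕ} (d : Fin m → ℤ) (σ : Equiv.Perm (Fin m)) : ℤ :=
  ∏ p ∈ Finset.univ.filter (fun p : Fin m × Fin m => p.1 < p.2 ∧ σ p.2 < σ p.1),
    (-1 : ℤ) ^ (d p.1 * d p.2).natAbs

/-- The action `μ ↦ μ^σ`, `μ^σ(x₁,…,x_m) = ε(σ;x)·μ(x_{σ⁻¹1},…,x_{σ⁻¹m})`. -/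
def pa [∀ i, AddCommGroup (M i)] {m : ℕ} {r : ℤ} (σ : Equiv.Perm (Fin m)) (μ : MMap L M m r) :
    MMap L M m r := fun d x =>
  koszulSign d σ •
    gcast (by rw [Equiv.sum_comp σ.symm d])
      (μ (fun j => d (σ.symm j)) (fun j => x (σ.symm j)))

/-- Degrees of the outer map in a partial composition. -/
def outDeg (m₁ m₂ n : ℕ) (s : ℤ) (d : Fin (m₁ + n + m₂) → ℤ) : Fin (m₁ + 1 + m₂) → ℤ :=
  Fin.append
    (Fin.append (fun j : Fin m₁ => d (Fin.castAdd m₂ (Fin.castAdd n j)))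
      (fun _ : Fin 1 => s + ∑ j : Fin n, d (Fin.castAdd m₂ (Fin.natAdd m₁ j))))
    (fun j : Fin m₂ => d (Fin.natAdd (m₁ + n) j))

theorem outDeg_left (m₁ m₂ n : ℕ) (s : ℤ) (d : Fin (m₁ + n + m₂) → ℤ) (j : Fin m₁) :
    outDeg m₁ m₂ n s d (Fin.castAdd m₂ (Fin.castAdd 1 j))
      = d (Fin.castAdd m₂ (Fin.castAdd n j)) := by
  simp [outDeg, Fin.append_left]

theorem outDeg_mid (m₁ m₂ n : ℕ) (s : ℤ) (d : Fin (m₁ + n + m₂) → ℤ) (j : Fin 1) :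
    outDeg m₁ m₂ n s d (Fin.castAdd m₂ (Fin.natAdd m₁ j))
      = s + ∑ j : Fin n, d (Fin.castAdd m₂ (Fin.natAdd m₁ j)) := by
  simp [outDeg, Fin.append_left, Fin.append_right]

theorem outDeg_right (m₁ m₂ n : ℕ) (s : ℤ) (d : Fin (m₁ + n + m₂) → ℤ) (j : Fin m₂) :
    outDeg m₁ m₂ n s d (Fin.natAdd (m₁ + 1) j) = d (Fin.natAdd (m₁ + n) j) := by
  simp [outDeg, Fin.append_right]

theorem outDeg_sum (m₁ m₂ n : ℕ) (r s : ℤ) (d : Fin (m₁ + n + m₂) → ℤ) :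
    r + ∑ j, outDeg m₁ m₂ n s d j = (r + s) + ∑ j, d j := by
  simp [outDeg, Fin.sum_univ_add, Fin.append_left, Fin.append_right]
  ring

/-- Partial (operadic) composition `μ ∘_{m₁+1} ν` of `μ` (of arity `m₁ + 1 + m₂`) with `ν`
inserted in the slot `m₁ + 1`, with the Koszul sign `(-1)^(|ν|·(d 1 + ⋯ + d m₁))`. -/
def pcomp [∀ i, AddCommGroup (L i)] [∀ i, AddCommGroup (M i)] (m₁ m₂ : ℕ) {n : ℕ} {r s : ℤ}
    (μ : MMap L M (m₁ + 1 + m₂) r) (ν : MMap L L n s) : MMap L M (m₁ + n + m₂) (r + s) :=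
  fun d x =>
    ((-1 : ℤ) ^ (s * ∑ j : Fin m₁, d (Fin.castAdd m₂ (Fin.castAdd n j))).natAbs) •
    gcast (outDeg_sum m₁ m₂ n r s d)
      (μ (outDeg m₁ m₂ n s d)
        (fun j => Fin.addCases (motive := fun t => L (outDeg m₁ m₂ n s d t))
          (fun j' => Fin.addCases (motive := fun t => L (outDeg m₁ m₂ n s d (Fin.castAdd m₂ t)))
            (fun j1 => gcast (outDeg_left m₁ m₂ n s d j1).symm
              (x (Fin.castAdd m₂ (Fin.castAdd n j1))))
            (fun j0 => gcast (outDeg_mid m₁ m₂ n s d j0).symm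
              (ν (fun j2 => d (Fin.castAdd m₂ (Fin.natAdd m₁ j2)))
                 (fun j2 => x (Fin.castAdd m₂ (Fin.natAdd m₁ j2)))))
            j')
          (fun j3 => gcast (outDeg_right m₁ m₂ n s d j3).symm (x (Fin.natAdd (m₁ + n) j3)))
          j))

/-- Composition `μ ∘ g` of an arity-1 map with an arity-`a` map. -/
def comp₁ {a : ℕ} {r s : ℤ} (μ : MMap M N 1 r) (g : MMap L M a s) : MMap L N a (r + s) :=
  fun d x =>
    gcast (by rw [Fin.sum_univ_one]; ring)
      (μ (fun _ : Fin 1 => s + ∑ j, d j) (fun _ => g d x))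

theorem sum2 (a b : ℕ) (r s₁ s₂ : ℤ) (d : Fin (a + b) → ℤ) :
    r + ∑ t : Fin 2, ![s₁ + ∑ j : Fin a, d (Fin.castAdd b j),
                       s₂ + ∑ j : Fin b, d (Fin.natAdd a j)] t
      = (r + (s₁ + s₂)) + ∑ j, d j := by
  simp [Fin.sum_univ_two, Fin.sum_univ_add]
  ring

/-- Full composition `μ ∘ (g₁, g₂)` with Koszul signs. -/
def comp₂ [∀ i, AddCommGroup (N i)] {a b : ℕ} {r s₁ s₂ : ℤ}
    (μ : MMap M N 2 r) (g₁ : MMap L M a s₁) (g₂ : MMap L M b s₂) :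
    MMap L N (a + b) (r + (s₁ + s₂)) :=
  fun d x =>
    ((-1 : ℤ) ^ (s₂ * ∑ j : Fin a, d (Fin.castAdd b j)).natAbs) •
    gcast (sum2 a b r s₁ s₂ d)
      (μ ![s₁ + ∑ j : Fin a, d (Fin.castAdd b j), s₂ + ∑ j : Fin b, d (Fin.natAdd a j)]
        (Fin.cons (gcast (by simp) (g₁ (fun j => d (Fin.castAdd b j)) (fun j => x (Fin.castAdd b j))))
          (fun _ : Fin 1 => gcast (by simp) (g₂ (fun j => d (Fin.natAdd a j)) (fun j => x (Fin.natAdd a j))))))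

theorem sum3 (a b c : ℕ) (r s₁ s₂ s₃ : ℤ) (d : Fin (a + b + c) → ℤ) :
    r + ∑ t : Fin 3, ![s₁ + ∑ j : Fin a, d (Fin.castAdd c (Fin.castAdd b j)),
                       s₂ + ∑ j : Fin b, d (Fin.castAdd c (Fin.natAdd a j)),
                       s₃ + ∑ j : Fin c, d (Fin.natAdd (a + b) j)] t
      = (r + (s₁ + s₂ + s₃)) + ∑ j, d j := by
  simp [Fin.sum_univ_three, Fin.sum_univ_add]
  ring

/-- Full composition `μ ∘ (g₁, g₂, g₃)` with Koszul signs. -/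
def comp₃ [∀ i, AddCommGroup (N i)] {a b c : ℕ} {r s₁ s₂ s₃ : ℤ}
    (μ : MMap M N 3 r) (g₁ : MMap L M a s₁) (g₂ : MMap L M b s₂) (g₃ : MMap L M c s₃) :
    MMap L N (a + b + c) (r + (s₁ + s₂ + s₃)) :=
  fun d x =>
    ((-1 : ℤ) ^ (s₂ * (∑ j : Fin a, d (Fin.castAdd c (Fin.castAdd b j)))
        + s₃ * ((∑ j : Fin a, d (Fin.castAdd c (Fin.castAdd b j)))
          + ∑ j : Fin b, d (Fin.castAdd c (Fin.natAdd a j)))).natAbs) •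
    gcast (sum3 a b c r s₁ s₂ s₃ d)
      (μ ![s₁ + ∑ j : Fin a, d (Fin.castAdd c (Fin.castAdd b j)),
           s₂ + ∑ j : Fin b, d (Fin.castAdd c (Fin.natAdd a j)),
           s₃ + ∑ j : Fin c, d (Fin.natAdd (a + b) j)]
        (Fin.cons (gcast (by simp)
            (g₁ (fun j => d (Fin.castAdd c (Fin.castAdd b j)))
                (fun j => x (Fin.castAdd c (Fin.castAdd b j)))))
          (Fin.cons (gcast (by simp)
              (g₂ (fun j => d (Fin.castAdd c (Fin.natAdd a j)))
                  (fun j => x (Fin.castAdd c (Fin.natAdd a j)))))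
            (fun _ : Fin 1 => gcast (by simp)
              (g₃ (fun j => d (Fin.natAdd (a + b) j))
                  (fun j => x (Fin.natAdd (a + b) j)))))))

theorem sum4 (a b c e : ℕ) (r s₁ s₂ s₃ s₄ : ℤ) (d : Fin (a + b + c + e) → ℤ) :
    r + ∑ t : Fin 4, ![s₁ + ∑ j : Fin a, d (Fin.castAdd e (Fin.castAdd c (Fin.castAdd b j))),
                       s₂ + ∑ j : Fin b, d (Fin.castAdd e (Fin.castAdd c (Fin.natAdd a j))),
                       s₃ + ∑ j : Fin c, d (Fin.castAdd e (Fin.natAdd (a + b) j)),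
                       s₄ + ∑ j : Fin e, d (Fin.natAdd (a + b + c) j)] t
      = (r + (s₁ + s₂ + s₃ + s₄)) + ∑ j, d j := by
  simp [Fin.sum_univ_four, Fin.sum_univ_add]
  ring

/-- Full composition `μ ∘ (g₁, g₂, g₃, g₄)` with Koszul signs. -/
def comp₄ [∀ i, AddCommGroup (N i)] {a b c e : ℕ} {r s₁ s₂ s₃ s₄ : ℤ}
    (μ : MMap M N 4 r) (g₁ : MMap L M a s₁) (g₂ : MMap L M b s₂) (g₃ : MMap L M c s₃)
    (g₄ : MMap L M e s₄) :
    MMap L N (a + b + c + e) (r + (s₁ + s₂ + s₃ + s₄)) :=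
  fun d x =>
    ((-1 : ℤ) ^ (s₂ * (∑ j : Fin a, d (Fin.castAdd e (Fin.castAdd c (Fin.castAdd b j))))
        + s₃ * ((∑ j : Fin a, d (Fin.castAdd e (Fin.castAdd c (Fin.castAdd b j))))
          + ∑ j : Fin b, d (Fin.castAdd e (Fin.castAdd c (Fin.natAdd a j))))
        + s₄ * ((∑ j : Fin a, d (Fin.castAdd e (Fin.castAdd c (Fin.castAdd b j))))
          + (∑ j : Fin b, d (Fin.castAdd e (Fin.castAdd c (Fin.natAdd a j))))
          + ∑ j : Fin c, d (Fin.castAdd e (Fin.natAdd (a + b) j)))).natAbs) •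
    gcast (sum4 a b c e r s₁ s₂ s₃ s₄ d)
      (μ ![s₁ + ∑ j : Fin a, d (Fin.castAdd e (Fin.castAdd c (Fin.castAdd b j))),
           s₂ + ∑ j : Fin b, d (Fin.castAdd e (Fin.castAdd c (Fin.natAdd a j))),
           s₃ + ∑ j : Fin c, d (Fin.castAdd e (Fin.natAdd (a + b) j)),
           s₄ + ∑ j : Fin e, d (Fin.natAdd (a + b + c) j)]
        (Fin.cons (gcast (by simp)
            (g₁ (fun j => d (Fin.castAdd e (Fin.castAdd c (Fin.castAdd b j))))
                (fun j => x (Fin.castAdd e (Fin.castAdd c (Fin.castAdd b j))))))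
          (Fin.cons (gcast (by simp)
              (g₂ (fun j => d (Fin.castAdd e (Fin.castAdd c (Fin.natAdd a j))))
                  (fun j => x (Fin.castAdd e (Fin.castAdd c (Fin.natAdd a j))))))
            (Fin.cons (gcast (by simp)
                (g₃ (fun j => d (Fin.castAdd e (Fin.natAdd (a + b) j)))
                    (fun j => x (Fin.castAdd e (Fin.natAdd (a + b) j)))))
              (fun _ : Fin 1 => gcast (by simp)
                (g₄ (fun j => d (Fin.natAdd (a + b + c) j))
                    (fun j => x (Fin.natAdd (a + b + c) j))))))))

/-- The differential `∂(μ) = D' ∘ μ - (-1)^{|μ|} ∑ᵢ μ ∘ᵢ D`. -/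
def bdry [∀ i, AddCommGroup (L i)] [∀ i, AddCommGroup (M i)] {m : ℕ} {r : ℤ}
    (D' : MMap M M 1 (-1)) (D : MMap L L 1 (-1)) (μ : MMap L M m r) : MMap L M m (-1 + r) :=
  comp₁ D' μ - ((-1 : ℤ) ^ r.natAbs) •
    ∑ p : Fin m, mcast (by have := p.isLt; omega) (by ring)
      (pcomp p.val (m - 1 - p.val) (mcast (by have := p.isLt; omega) rfl μ) D)

/-- The identity, as an `MMap`. -/
def idm : MMap L L 1 0 := fun d x => gcast (by rw [Fin.sum_univ_one, zero_add]) (x 0)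

/-- `μ ∘_{m₁+1} ν`, recast to a specified target degree `R`. -/
def pc [∀ i, AddCommGroup (L i)] [∀ i, AddCommGroup (M i)] (R : ℤ) (m₁ m₂ : ℕ) {n : ℕ}
    {r s : ℤ} (μ : MMap L M (m₁ + 1 + m₂) r) (ν : MMap L L n s)
    (h : r + s = R := by norm_num) : MMap L M (m₁ + n + m₂) R :=
  mcast rfl h (pcomp m₁ m₂ μ ν)

/-- `μ ∘ g`, recast to a specified target degree `R`. -/
def fc1 (R : ℤ) {a : ℕ} {r s : ℤ} (μ : MMap M N 1 r) (g : MMap L M a s)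
    (h : r + s = R := by norm_num) : MMap L N a R :=
  mcast rfl h (comp₁ μ g)

/-- `μ ∘ (g₁, g₂)`, recast to a specified target degree `R`. -/
def fc2 [∀ i, AddCommGroup (N i)] (R : ℤ) {a b : ℕ} {r s₁ s₂ : ℤ}
    (μ : MMap M N 2 r) (g₁ : MMap L M a s₁) (g₂ : MMap L M b s₂)
    (h : r + (s₁ + s₂) = R := by norm_num) : MMap L N (a + b) R :=
  mcast rfl h (comp₂ μ g₁ g₂)

/-- `μ ∘ (g₁, g₂, g₃)`, recast to a specified target degree `R`. -/
def fc3 [∀ i, AddCommGroup (N i)] (R : ℤ) {a b c : ℕ} {r s₁ s₂ s₃ : ℤ}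
    (μ : MMap M N 3 r) (g₁ : MMap L M a s₁) (g₂ : MMap L M b s₂) (g₃ : MMap L M c s₃)
    (h : r + (s₁ + s₂ + s₃) = R := by norm_num) : MMap L N (a + b + c) R :=
  mcast rfl h (comp₃ μ g₁ g₂ g₃)

/-- `μ ∘ (g₁, g₂, g₃, g₄)`, recast to a specified target degree `R`. -/
def fc4 [∀ i, AddCommGroup (N i)] (R : ℤ) {a b c e : ℕ} {r s₁ s₂ s₃ s₄ : ℤ}
    (μ : MMap M N 4 r) (g₁ : MMap L M a s₁) (g₂ : MMap L M b s₂) (g₃ : MMap L M c s₃)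
    (g₄ : MMap L M e s₄) (h : r + (s₁ + s₂ + s₃ + s₄) = R := by norm_num) :
    MMap L N (a + b + c + e) R :=
  mcast rfl h (comp₄ μ g₁ g₂ g₃ g₄)

/-- `∂(μ)`, recast to a specified target degree `R`. -/
def bd [∀ i, AddCommGroup (L i)] [∀ i, AddCommGroup (M i)] (R : ℤ) {m : ℕ} {r : ℤ}
    (D' : MMap M M 1 (-1)) (D : MMap L L 1 (-1)) (μ : MMap L M m r)
    (h : -1 + r = R := by norm_num) : MMap L M m R :=
  mcast rfl h (bdry D' D μ)

/-- Multilinearity over `k` of the components of an `MMap`. -/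
def IsMultilinear (k : Type) [CommRing k] {L M : ℤ → Type} [∀ i, AddCommGroup (L i)]
    [∀ i, AddCommGroup (M i)] [∀ i, Module k (L i)] [∀ i, Module k (M i)] {m : ℕ} {r : ℤ}
    (μ : MMap L M m r) : Prop :=
  ∀ (d : Fin m → ℤ) (x : ∀ j, L (d j)) (j : Fin m),
    (∀ a b : L (d j), μ d (Function.update x j (a + b))
        = μ d (Function.update x j a) + μ d (Function.update x j b)) ∧
    (∀ (c : k) (a : L (d j)), μ d (Function.update x j (c • a)) = c • μ d (Function.update x j a))

/-! ## Permutations (0-indexed; a cycle `(a b c)` is `swap a b * swap b c`) -/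

def P12 (m : ℕ) [NeZero m] : Equiv.Perm (Fin m) := Equiv.swap 0 1
def P13 (m : ℕ) [NeZero m] : Equiv.Perm (Fin m) := Equiv.swap 0 2
def P23 (m : ℕ) [NeZero m] : Equiv.Perm (Fin m) := Equiv.swap 1 2
def P34 (m : ℕ) [NeZero m] : Equiv.Perm (Fin m) := Equiv.swap 2 3
def P123 (m : ℕ) [NeZero m] : Equiv.Perm (Fin m) := Equiv.swap 0 1 * Equiv.swap 1 2
def P132 (m : ℕ) [NeZero m] : Equiv.Perm (Fin m) := Equiv.swap 0 2 * Equiv.swap 2 1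
def P234 (m : ℕ) [NeZero m] : Equiv.Perm (Fin m) := Equiv.swap 1 2 * Equiv.swap 2 3
def P243 (m : ℕ) [NeZero m] : Equiv.Perm (Fin m) := Equiv.swap 1 3 * Equiv.swap 3 2
def P1234 (m : ℕ) [NeZero m] : Equiv.Perm (Fin m) :=
  Equiv.swap 0 1 * Equiv.swap 1 2 * Equiv.swap 2 3
def P1432 (m : ℕ) [NeZero m] : Equiv.Perm (Fin m) :=
  Equiv.swap 0 3 * Equiv.swap 3 2 * Equiv.swap 2 1
def P1342 (m : ℕ) [NeZero m] : Equiv.Perm (Fin m) :=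
  Equiv.swap 0 2 * Equiv.swap 2 3 * Equiv.swap 3 1
def P13P24 (m : ℕ) [NeZero m] : Equiv.Perm (Fin m) := Equiv.swap 0 2 * Equiv.swap 1 3

end WL3
namespace WL3

open Finset

variable (k : Type) [CommRing k]

/-- A Leibniz 3-algebra structure: maps `l2, l3, l4` on a complex with differential `D`
satisfying the generalized Jacobi identities (L1)–(L4). -/
structure IsLeibniz3 {L : ℤ → Type} [∀ i, AddCommGroup (L i)] [∀ i, Module k (L i)]
    (D : MMap L L 1 (-1)) (l2 : MMap L L 2 0) (l3 : MMap L L 3 1) (l4 : MMap L L 4 2) :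
    Prop where
  lin2 : IsMultilinear k l2
  lin3 : IsMultilinear k l3
  lin4 : IsMultilinear k l4
  eqL1 : bd (-1) D D l2 = 0
  eqL2 : bd 0 D D l3 =
    pc 0 1 0 l2 l2 - pc 0 0 1 l2 l2 - pa (P12 3) (pc 0 1 0 l2 l2)
  eqL3 : bd 1 D D l4 =
    pc 1 0 1 l2 l3 + pc 1 1 0 l2 l3 - pa (P12 4) (pc 1 1 0 l2 l3)
      + pa (P123 4) (pc 1 1 0 l2 l3) - pc 1 0 2 l3 l2
      + pc 1 1 1 l3 l2 - pa (P12 4) (pc 1 1 1 l3 l2)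
      - pc 1 2 0 l3 l2 + pa (P23 4) (pc 1 2 0 l3 l2) - pa (P132 4) (pc 1 2 0 l3 l2)
  eqL4 : (0 : MMap L L 5 2) =
    pc 2 0 1 l2 l4 - pc 2 1 0 l2 l4 + pa (P12 5) (pc 2 1 0 l2 l4)
      - pa (P123 5) (pc 2 1 0 l2 l4) + pa (P1234 5) (pc 2 1 0 l2 l4)
      + pc 2 0 2 l3 l3 + pc 2 1 1 l3 l3 - pa (P12 5) (pc 2 1 1 l3 l3)
      + pa (P123 5) (pc 2 1 1 l3 l3) + pc 2 2 0 l3 l3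
      - pa (P23 5) (pc 2 2 0 l3 l3) + pa (P132 5) (pc 2 2 0 l3 l3)
      + pa (P234 5) (pc 2 2 0 l3 l3) - pa (P1342 5) (pc 2 2 0 l3 l3)
      + pa (P13P24 5) (pc 2 2 0 l3 l3)
      + pc 2 0 3 l4 l2 - pc 2 1 2 l4 l2 + pa (P12 5) (pc 2 1 2 l4 l2)
      + pc 2 2 1 l4 l2 - pa (P23 5) (pc 2 2 1 l4 l2) + pa (P132 5) (pc 2 2 1 l4 l2)
      - pc 2 3 0 l4 l2 + pa (P34 5) (pc 2 3 0 l4 l2) - pa (P243 5) (pc 2 3 0 l4 l2)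
      + pa (P1432 5) (pc 2 3 0 l4 l2)

/-- A weak Lie 3-algebra: a 3-term chain complex equipped with structure maps
`l2, l3, l4, l21, l211, l31, l32` satisfying (L1)–(L4) and (W1)–(W11). -/
structure WeakLie3 (L : ℤ → Type) [∀ i, AddCommGroup (L i)] [∀ i, Module k (L i)] where
  D : MMap L L 1 (-1)
  linD : IsMultilinear k D
  dd : fc1 (-2) D D = 0
  bound : ∀ i : ℤ, (i < 0 ∨ 2 < i) → ∀ x : L i, x = 0
  l2 : MMap L L 2 0
  l3 : MMap L L 3 1
  l4 : MMap L L 4 2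
  l21 : MMap L L 2 1
  l211 : MMap L L 2 2
  l31 : MMap L L 3 2
  l32 : MMap L L 3 2
  leib : IsLeibniz3 k D l2 l3 l4
  lin21 : IsMultilinear k l21
  lin211 : IsMultilinear k l211
  lin31 : IsMultilinear k l31
  lin32 : IsMultilinear k l32
  w1 : bd 0 D D l21 = l2 + pa (P12 2) l2
  w2 : bd 1 D D l211 = l21 - pa (P12 2) l21
  w3 : bd 1 D D l31 = l3 + pa (P12 3) l3 + pc 1 0 1 l2 l21
  w4 : bd 1 D D l32 = l3 + pa (P23 3) l3 - pc 1 1 0 l2 l21 + pc 1 0 1 l21 l2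
        + pa (P12 3) (pc 1 1 0 l21 l2)
  w5 : l211 + pa (P12 2) l211 = 0
  w6 : l31 - pa (P12 3) l31 = pc 2 0 1 l2 l211
  w7 : l31 - pa (P12 3) l32 + pa (P132 3) l31 - l32 + pa (P23 3) l31 - pa (P123 3) l32
        = pc 2 1 0 l21 l21 + pc 2 0 1 l21 l21 + pa (P12 3) (pc 2 1 0 l21 l21)
          + pa (P132 3) (pc 2 1 0 l211 l2)
  w8 : l32 - pa (P23 3) l32 = - pc 2 1 0 l2 l211 + pc 2 0 1 l211 l2
        + pa (P12 3) (pc 2 1 0 l211 l2)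
  w9 : l4 + pa (P12 4) l4 = pc 2 0 1 l2 l31 - pc 2 2 0 l31 l2
        + pa (P123 4) (pc 2 1 0 l2 l31) + pc 2 0 2 l3 l21
  w10 : l4 + pa (P23 4) l4 = pc 2 0 1 l2 l32 - pc 2 1 1 l3 l21 + pc 2 1 0 l2 l31
        - pc 2 0 2 l31 l2 - pa (P12 4) (pc 2 1 1 l31 l2) - pa (P132 4) (pc 2 2 0 l31 l2)
  w11 : l4 + pa (P34 4) l4 = pc 2 0 1 l21 l3 - pc 2 0 2 l32 l2 + pc 2 1 1 l32 l2
        - pa (P12 4) (pc 2 1 1 l32 l2) + pc 2 2 0 l3 l21 + pa (P23 4) (pc 2 2 0 l32 l2)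
        - pa (P132 4) (pc 2 2 0 l32 l2) + pc 2 1 0 l2 l32 - pa (P12 4) (pc 2 1 0 l2 l32)
        + pa (P123 4) (pc 2 1 0 l21 l3)

end WL3
namespace WL3

open Finset

variable (k : Type) [CommRing k]

/-- A weak morphism of weak Lie 3-algebras `(f1,f2,f21,f3) : A → B`, i.e. a solution of
equations (M1)–(M8). -/
structure IsWeakMorphism {L M : ℤ → Type} [∀ i, AddCommGroup (L i)] [∀ i, Module k (L i)]
    [∀ i, AddCommGroup (M i)] [∀ i, Module k (M i)]
    (A : WeakLie3 k L) (B : WeakLie3 k M)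
    (f1 : MMap L M 1 0) (f2 : MMap L M 2 1) (f21 : MMap L M 2 2) (f3 : MMap L M 3 2) :
    Prop where
  lin1 : IsMultilinear k f1
  lin2 : IsMultilinear k f2
  lin21 : IsMultilinear k f21
  lin3 : IsMultilinear k f3
  m1 : bd (-1) B.D A.D f1 = 0
  m2 : bd 0 B.D A.D f2 = fc1 0 f1 A.l2 - fc2 0 B.l2 f1 f1
  m3 : bd 1 B.D A.D f3 = fc1 1 f1 A.l3 - pc 1 1 0 f2 A.l2 + pc 1 0 1 f2 A.l2
        + pa (P12 3) (pc 1 1 0 f2 A.l2) - fc3 1 B.l3 f1 f1 f1 - fc2 1 B.l2 f1 f2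
        + fc2 1 B.l2 f2 f1 + pa (P12 3) (fc2 1 B.l2 f1 f2)
  m4 : fc1 2 f1 A.l4 - fc4 2 B.l4 f1 f1 f1 f1 =
        pc 2 0 1 f2 A.l3 + pc 2 1 0 f2 A.l3 - pa (P12 4) (pc 2 1 0 f2 A.l3)
        + pa (P123 4) (pc 2 1 0 f2 A.l3) - pc 2 0 2 f3 A.l2 + pc 2 1 1 f3 A.l2
        - pa (P12 4) (pc 2 1 1 f3 A.l2) - pc 2 2 0 f3 A.l2 + pa (P23 4) (pc 2 2 0 f3 A.l2)
        - pa (P132 4) (pc 2 2 0 f3 A.l2) + fc2 2 B.l2 f3 f1 + fc2 2 B.l2 f1 f3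
        - pa (P12 4) (fc2 2 B.l2 f1 f3) + pa (P123 4) (fc2 2 B.l2 f1 f3)
        - fc2 2 B.l2 f2 f2 + pa (P23 4) (fc2 2 B.l2 f2 f2) - pa (P132 4) (fc2 2 B.l2 f2 f2)
        + fc3 2 B.l3 f2 f1 f1 - fc3 2 B.l3 f1 f2 f1 + pa (P12 4) (fc3 2 B.l3 f1 f2 f1)
        + fc3 2 B.l3 f1 f1 f2 - pa (P23 4) (fc3 2 B.l3 f1 f1 f2)
        + pa (P132 4) (fc3 2 B.l3 f1 f1 f2)
  m5 : bd 1 B.D A.D f21 = - f2 - pa (P12 2) f2 + fc1 1 f1 A.l21 - fc2 1 B.l21 f1 f1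
  m6 : fc1 2 f1 A.l211 - fc2 2 B.l211 f1 f1 = f21 - pa (P12 2) f21
  m7 : fc1 2 f1 A.l31 - fc3 2 B.l31 f1 f1 f1 =
        f3 + pa (P12 3) f3 + pc 2 0 1 f2 A.l21 + fc2 2 B.l2 f21 f1
  m8 : fc1 2 f1 A.l32 - fc3 2 B.l32 f1 f1 f1 =
        f3 + pa (P23 3) f3 - pc 2 1 0 f2 A.l21 + pc 2 0 1 f21 A.l2
        + pa (P12 3) (pc 2 1 0 f21 A.l2) - fc2 2 B.l2 f1 f21 - fc2 2 B.l21 f2 f1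
        - pa (P12 3) (fc2 2 B.l21 f1 f2)

/-- A morphism of (semi-strict) Lie 3-algebras / Leibniz 3-algebras: equations (M1)–(M4)
for structure maps `(a2,a3,a4)` on the source and `(b2,b3,b4)` on the target. -/
structure IsLeibMorphism {L M : ℤ → Type} [∀ i, AddCommGroup (L i)] [∀ i, Module k (L i)]
    [∀ i, AddCommGroup (M i)] [∀ i, Module k (M i)]
    (DL : MMap L L 1 (-1)) (DM : MMap M M 1 (-1))
    (a2 : MMap L L 2 0) (a3 : MMap L L 3 1) (a4 : MMap L L 4 2)
    (b2 : MMap M M 2 0) (b3 : MMap M M 3 1) (b4 : MMap M M 4 2)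
    (f1 : MMap L M 1 0) (f2 : MMap L M 2 1) (f3 : MMap L M 3 2) : Prop where
  lin1 : IsMultilinear k f1
  lin2 : IsMultilinear k f2
  lin3 : IsMultilinear k f3
  m1 : bd (-1) DM DL f1 = 0
  m2 : bd 0 DM DL f2 = fc1 0 f1 a2 - fc2 0 b2 f1 f1
  m3 : bd 1 DM DL f3 = fc1 1 f1 a3 - pc 1 1 0 f2 a2 + pc 1 0 1 f2 a2
        + pa (P12 3) (pc 1 1 0 f2 a2) - fc3 1 b3 f1 f1 f1 - fc2 1 b2 f1 f2
        + fc2 1 b2 f2 f1 + pa (P12 3) (fc2 1 b2 f1 f2)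
  m4 : fc1 2 f1 a4 - fc4 2 b4 f1 f1 f1 f1 =
        pc 2 0 1 f2 a3 + pc 2 1 0 f2 a3 - pa (P12 4) (pc 2 1 0 f2 a3)
        + pa (P123 4) (pc 2 1 0 f2 a3) - pc 2 0 2 f3 a2 + pc 2 1 1 f3 a2
        - pa (P12 4) (pc 2 1 1 f3 a2) - pc 2 2 0 f3 a2 + pa (P23 4) (pc 2 2 0 f3 a2)
        - pa (P132 4) (pc 2 2 0 f3 a2) + fc2 2 b2 f3 f1 + fc2 2 b2 f1 f3
        - pa (P12 4) (fc2 2 b2 f1 f3) + pa (P123 4) (fc2 2 b2 f1 f3)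
        - fc2 2 b2 f2 f2 + pa (P23 4) (fc2 2 b2 f2 f2) - pa (P132 4) (fc2 2 b2 f2 f2)
        + fc3 2 b3 f2 f1 f1 - fc3 2 b3 f1 f2 f1 + pa (P12 4) (fc3 2 b3 f1 f2 f1)
        + fc3 2 b3 f1 f1 f2 - pa (P23 4) (fc3 2 b3 f1 f1 f2)
        + pa (P132 4) (fc3 2 b3 f1 f1 f2)

/-- A deformation retract `(p, i, h)` of `(L, D)` onto `(L', D')`:
`p`, `i` are chain maps, `id - i∘p = D∘h + h∘D` and `p∘i = id`. -/
structure IsDefRetract {L L' : ℤ → Type} [∀ i, AddCommGroup (L i)] [∀ i, Module k (L i)]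
    [∀ i, AddCommGroup (L' i)] [∀ i, Module k (L' i)]
    (D : MMap L L 1 (-1)) (D' : MMap L' L' 1 (-1))
    (p : MMap L L' 1 0) (i : MMap L' L 1 0) (h : MMap L L 1 1) : Prop where
  linp : IsMultilinear k p
  lini : IsMultilinear k i
  linh : IsMultilinear k h
  chainp : bd (-1) D' D p = 0
  chaini : bd (-1) D D' i = 0
  homotopy : idm - fc1 0 i p = fc1 0 D h + fc1 0 h D
  retract : fc1 0 p i = idm

/-- A weak Lie 2-algebra in the sense of Roytenberg (a 2-term truncation of a weak
Lie 3-algebra). -/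
structure WeakLie2 (L : ℤ → Type) [∀ i, AddCommGroup (L i)] [∀ i, Module k (L i)] where
  D : MMap L L 1 (-1)
  linD : IsMultilinear k D
  dd : fc1 (-2) D D = 0
  bound : ∀ i : ℤ, (i < 0 ∨ 1 < i) → ∀ x : L i, x = 0
  l2 : MMap L L 2 0
  l3 : MMap L L 3 1
  l21 : MMap L L 2 1
  lin2 : IsMultilinear k l2
  lin3 : IsMultilinear k l3
  lin21 : IsMultilinear k l21
  e1 : bd (-1) D D l2 = 0
  e2 : bd 0 D D l3 = pc 0 1 0 l2 l2 - pc 0 0 1 l2 l2 - pa (P12 3) (pc 0 1 0 l2 l2)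
  e3 : (0 : MMap L L 4 1) =
    pc 1 0 1 l2 l3 + pc 1 1 0 l2 l3 - pa (P12 4) (pc 1 1 0 l2 l3)
      + pa (P123 4) (pc 1 1 0 l2 l3) - pc 1 0 2 l3 l2
      + pc 1 1 1 l3 l2 - pa (P12 4) (pc 1 1 1 l3 l2)
      - pc 1 2 0 l3 l2 + pa (P23 4) (pc 1 2 0 l3 l2) - pa (P132 4) (pc 1 2 0 l3 l2)
  e4 : bd 0 D D l21 = l2 + pa (P12 2) l2
  e5 : (0 : MMap L L 2 1) = l21 - pa (P12 2) l21
  e6 : (0 : MMap L L 3 1) = l3 + pa (P12 3) l3 + pc 1 0 1 l2 l21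
  e7 : (0 : MMap L L 3 1) = l3 + pa (P23 3) l3 - pc 1 1 0 l2 l21 + pc 1 0 1 l21 l2
        + pa (P12 3) (pc 1 1 0 l21 l2)

end WL3
namespace WL3

open Finset

section Transfer

variable {k : Type} [CommRing k] {L L' : ℤ → Type}
  [∀ i, AddCommGroup (L i)] [∀ i, Module k (L i)]
  [∀ i, AddCommGroup (L' i)] [∀ i, Module k (L' i)]
variable (A : WeakLie3 k L) (p : MMap L L' 1 0) (i : MMap L' L 1 0) (h : MMap L L 1 1)

/-- `h ∘ λ2` -/
def hl2 : MMap L L 2 1 := fc1 1 h A.l2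
/-- `h ∘ λ3` -/
def hl3 : MMap L L 3 2 := fc1 2 h A.l3
/-- `h ∘ λ21` -/
def hl21 : MMap L L 2 2 := fc1 2 h A.l21

/-- Transferred `λ2' = p ∘ λ2 ∘ (i,i)`. -/
def tl2 : MMap L' L' 2 0 := fc1 0 p (fc2 0 A.l2 i i)

/-- Transferred `λ3'`. -/
def tl3 : MMap L' L' 3 1 :=
  fc1 1 p (fc3 1 A.l3 i i i)
  + fc1 1 p (fc3 1 (pc 1 0 1 A.l2 (hl2 A h)
      - (pc 1 1 0 A.l2 (hl2 A h) - pa (P12 3) (pc 1 1 0 A.l2 (hl2 A h)))) i i i)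

/-- Transferred `λ4'`. -/
def tl4 : MMap L' L' 4 2 :=
  fc1 2 p (fc4 2 A.l4 i i i i)
  - fc1 2 p (fc4 2
      (pc 2 0 1 A.l2 (hl3 A h)
        + (pc 2 1 0 A.l2 (hl3 A h) - pa (P12 4) (pc 2 1 0 A.l2 (hl3 A h))
            + pa (P123 4) (pc 2 1 0 A.l2 (hl3 A h)))
        + pc 2 0 2 A.l3 (hl2 A h)
        - (pc 2 1 1 A.l3 (hl2 A h) - pa (P12 4) (pc 2 1 1 A.l3 (hl2 A h)))
        + (pc 2 2 0 A.l3 (hl2 A h) - pa (P23 4) (pc 2 2 0 A.l3 (hl2 A h))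
            + pa (P132 4) (pc 2 2 0 A.l3 (hl2 A h)))) i i i i)
  - fc1 2 p (fc4 2
      (pc 2 0 2 (pc 1 0 1 A.l2 (hl2 A h)) (hl2 A h)
        - (pc 2 1 1 (pc 1 0 1 A.l2 (hl2 A h)) (hl2 A h)
            - pa (P12 4) (pc 2 1 1 (pc 1 0 1 A.l2 (hl2 A h)) (hl2 A h)))
        + (fc2 2 A.l2 (hl2 A h) (hl2 A h) - pa (P23 4) (fc2 2 A.l2 (hl2 A h) (hl2 A h))
            + pa (P132 4) (fc2 2 A.l2 (hl2 A h) (hl2 A h)))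
        + (pc 2 1 1 (pc 1 1 0 A.l2 (hl2 A h)) (hl2 A h)
            - pa (P12 4) (pc 2 1 1 (pc 1 1 0 A.l2 (hl2 A h)) (hl2 A h))
            + pa (P123 4) (pc 2 1 1 (pc 1 1 0 A.l2 (hl2 A h)) (hl2 A h)))
        - (pc 2 2 0 (pc 1 1 0 A.l2 (hl2 A h)) (hl2 A h)
            - pa (P12 4) (pc 2 2 0 (pc 1 1 0 A.l2 (hl2 A h)) (hl2 A h))
            + pa (P123 4) (pc 2 2 0 (pc 1 1 0 A.l2 (hl2 A h)) (hl2 A h))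
            - pa (P23 4) (pc 2 2 0 (pc 1 1 0 A.l2 (hl2 A h)) (hl2 A h))
            + pa (P132 4) (pc 2 2 0 (pc 1 1 0 A.l2 (hl2 A h)) (hl2 A h))
            - pa (P13 4) (pc 2 2 0 (pc 1 1 0 A.l2 (hl2 A h)) (hl2 A h)))) i i i i)

/-- Transferred `λ21' = p ∘ λ21 ∘ (i,i)`. -/
def tl21 : MMap L' L' 2 1 := fc1 1 p (fc2 1 A.l21 i i)

/-- Transferred `λ211' = p ∘ λ211 ∘ (i,i)`. -/
def tl211 : MMap L' L' 2 2 := fc1 2 p (fc2 2 A.l211 i i)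

/-- Transferred `λ31'`. -/
def tl31 : MMap L' L' 3 2 :=
  fc1 2 p (fc3 2 A.l31 i i i) - fc1 2 p (fc3 2 (pc 2 0 1 A.l2 (hl21 A h)) i i i)

/-- Transferred `λ32'`. -/
def tl32 : MMap L' L' 3 2 :=
  fc1 2 p (fc3 2 A.l32 i i i)
  + fc1 2 p (fc3 2 (pc 2 0 1 A.l21 (hl2 A h) + pc 2 1 0 A.l2 (hl21 A h)
      + pa (P12 3) (pc 2 1 0 A.l21 (hl2 A h))) i i i)

/-- Extension of `i`: `i₂ = -h ∘ λ2 ∘ (i,i)`. -/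
def ti2 : MMap L' L 2 1 := - fc1 1 h (fc2 0 A.l2 i i)

/-- Extension of `i`: `i₂₁ = -h ∘ λ21 ∘ (i,i)`. -/
def ti21 : MMap L' L 2 2 := - fc1 2 h (fc2 1 A.l21 i i)

/-- Extension of `i`: `i₃`. -/
def ti3 : MMap L' L 3 2 :=
  - fc1 2 h (fc3 1 A.l3 i i i)
  - fc1 2 h (fc3 1 (pc 1 0 1 A.l2 (hl2 A h)
      - (pc 1 1 0 A.l2 (hl2 A h) - pa (P12 3) (pc 1 1 0 A.l2 (hl2 A h)))) i i i)

end Transfer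

section Skew

variable (k : Type) [CommRing k] [Invertible (2 : k)] [Invertible (3 : k)]
variable {L M : ℤ → Type} [∀ i, AddCommGroup (L i)] [∀ i, Module k (L i)]
  [∀ i, AddCommGroup (M i)] [∀ i, Module k (M i)]

/-- Skew-symmetrization `λ̄2` of a weak Lie 3-algebra. -/
def skew2 (A : WeakLie3 k L) : MMap L L 2 0 :=
  (⅟ (2 : k)) • ∑ σ : Equiv.Perm (Fin 2), (Equiv.Perm.sign σ : ℤ) • pa σ A.l2

/-- Skew-symmetrization `λ̄3` of a weak Lie 3-algebra. -/
def skew3 (A : WeakLie3 k L) : MMap L L 3 1 :=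
  (⅟ (2 : k) * ⅟ (3 : k)) • ∑ σ : Equiv.Perm (Fin 3), (Equiv.Perm.sign σ : ℤ) • pa σ A.l3
  - (⅟ (2 : k) * ⅟ (2 : k) * ⅟ (2 : k) * ⅟ (3 : k)) •
      ∑ σ : Equiv.Perm (Fin 3), (Equiv.Perm.sign σ : ℤ) •
        pa σ (pc 1 0 1 A.l21 A.l2 + pc 1 1 0 A.l21 A.l2)

/-- Skew-symmetrization `λ̄4` of a weak Lie 3-algebra. -/
def skew4 (A : WeakLie3 k L) : MMap L L 4 2 :=
  (⅟ (2 : k) * ⅟ (2 : k) * ⅟ (2 : k) * ⅟ (3 : k)) •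
      ∑ σ : Equiv.Perm (Fin 4), (Equiv.Perm.sign σ : ℤ) • pa σ A.l4
  + (⅟ (2 : k) * ⅟ (2 : k) * ⅟ (2 : k) * ⅟ (2 : k) * ⅟ (3 : k)) •
      ∑ σ : Equiv.Perm (Fin 4), (Equiv.Perm.sign σ : ℤ) •
        pa σ (pc 2 0 1 A.l21 A.l3 - pc 2 0 2 A.l31 A.l2 + pc 2 1 1 A.l32 A.l2
          - pc 2 1 0 A.l21 A.l3 - pc 2 1 1 A.l31 A.l2 + pc 2 2 0 A.l32 A.l2)

/-- Skew-symmetrization `f̄2` of the second component of a weak morphism. -/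
def skewMor2 (f2 : MMap L M 2 1) : MMap L M 2 1 :=
  (⅟ (2 : k)) • ∑ σ : Equiv.Perm (Fin 2), (Equiv.Perm.sign σ : ℤ) • pa σ f2

/-- Skew-symmetrization `f̄3` of the third component of a weak morphism `A → B`. -/
def skewMor3 (A : WeakLie3 k L) (B : WeakLie3 k M) (f1 : MMap L M 1 0) (f2 : MMap L M 2 1)
    (f21 : MMap L M 2 2) (f3 : MMap L M 3 2) : MMap L M 3 2 :=
  (⅟ (2 : k) * ⅟ (3 : k)) • ∑ σ : Equiv.Perm (Fin 3), (Equiv.Perm.sign σ : ℤ) • pa σ f3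
  - (⅟ (2 : k) * ⅟ (2 : k) * ⅟ (2 : k) * ⅟ (3 : k)) •
      ∑ σ : Equiv.Perm (Fin 3), (Equiv.Perm.sign σ : ℤ) •
        pa σ (pc 2 0 1 f21 A.l2 + pc 2 1 0 f21 A.l2
          - fc2 2 B.l21 f2 f1 - fc2 2 B.l21 f1 f2)

end Skew

section Comp

variable {k : Type} [CommRing k] {L M N : ℤ → Type}
  [∀ i, AddCommGroup (L i)] [∀ i, Module k (L i)]
  [∀ i, AddCommGroup (M i)] [∀ i, Module k (M i)]
  [∀ i, AddCommGroup (N i)] [∀ i, Module k (N i)]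

/-- First component of the composition of weak morphisms. -/
def cmp1 (f1' : MMap M N 1 0) (f1 : MMap L M 1 0) : MMap L N 1 0 := fc1 0 f1' f1

/-- Second component of the composition of weak morphisms. -/
def cmp2 (f1' : MMap M N 1 0) (f2' : MMap M N 2 1) (f1 : MMap L M 1 0) (f2 : MMap L M 2 1) :
    MMap L N 2 1 := fc2 1 f2' f1 f1 + fc1 1 f1' f2

/-- `(f'∘f)21` component of the composition of weak morphisms. -/
def cmp21 (f1' : MMap M N 1 0) (f21' : MMap M N 2 2) (f1 : MMap L M 1 0)
    (f21 : MMap L M 2 2) : MMap L N 2 2 := fc2 2 f21' f1 f1 + fc1 2 f1' f21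

/-- Third component of the composition of weak morphisms. -/
def cmp3 (f1' : MMap M N 1 0) (f2' : MMap M N 2 1) (f3' : MMap M N 3 2)
    (f1 : MMap L M 1 0) (f2 : MMap L M 2 1) (f3 : MMap L M 3 2) : MMap L N 3 2 :=
  fc3 2 f3' f1 f1 f1 - fc2 2 f2' f2 f1 + fc2 2 f2' f1 f2 - pa (P12 3) (fc2 2 f2' f1 f2)
    + fc1 2 f1' f3

end Comp

end WL3
namespace WL3

/-! ## Graded maps as operations on the total module -/

/-- The total module of a graded module. -/
abbrev Tot (L : ℤ → Type) : Type := ∀ i, L i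

section Hat

set_option linter.unusedSectionVars false

variable {L M N : ℤ → Type} [∀ i, AddCommGroup (L i)] [∀ i, AddCommGroup (M i)]
  [∀ i, AddCommGroup (N i)]

/-- Homogeneous elements of degree `i` of the total module. -/
def IsH (i : ℤ) (x : Tot L) : Prop := ∀ j, j ≠ i → x j = 0

/-- The sign `(-1)^n`. -/
def sgn (n : ℤ) : ℤ := (-1) ^ n.natAbs

/-- The component of `μ` at degrees `d`, as an operation on total modules. -/
noncomputable def ev {m : ℕ} {r : ℤ} (μ : MMap L M m r) (d : Fin m → ℤ) (v : Fin m → Tot L) :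
    Tot M := Pi.single (r + ∑ j, d j) (μ d (fun j => v j (d j)))

/-- The operation on total modules induced by the components of `μ` in degrees `0, 1, 2`. -/
noncomputable def hat {m : ℕ} {r : ℤ} (μ : MMap L M m r) (v : Fin m → Tot L) : Tot M :=
  ∑ e : Fin m → Fin 3, ev μ (fun j => ((e j : ℕ) : ℤ)) v

/-- `μ` vanishes as soon as one of its arguments does. -/
def ZeroOn {m : ℕ} {r : ℤ} (μ : MMap L M m r) : Prop :=
  ∀ (d : Fin m → ℤ) (x : ∀ j, L (d j)) (j : Fin m), x j = 0 → μ d x = 0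

/-- The graded module is concentrated in degrees `0, 1, 2`. -/
def Bounded (L : ℤ → Type) [∀ i, AddCommGroup (L i)] : Prop :=
  ∀ i : ℤ, (i < 0 ∨ 2 < i) → ∀ x : L i, x = 0

theorem gcast_apply {i j : ℤ} (h : i = j) (v : Tot L) : gcast h (v i) = v j := by
  subst h; rfl

theorem gcast_eq_single {i j : ℤ} (h : i = j) (x : L i) :
    gcast h x = (Pi.single i x : Tot L) j := by
  subst h; simp [gcast]

theorem single_gcast {i j : ℤ} (h : i = j) (x : L i) :
    (Pi.single j (gcast h x) : Tot L) = Pi.single i x := by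
  subst h; rfl

theorem isH_single (i : ℤ) (x : L i) : IsH i (Pi.single i x : Tot L) := fun _ hj => by
  simp [Pi.single_eq_of_ne hj]

theorem isH_ev {m : ℕ} {r : ℤ} (μ : MMap L M m r) (d : Fin m → ℤ) (v : Fin m → Tot L) :
    IsH (r + ∑ j, d j) (ev μ d v) := isH_single _ _

theorem IsH.eq_zero (hL : Bounded L) {i : ℤ} {x : Tot L} (hx : IsH i x) (hi : i < 0 ∨ 2 < i) :
    x = 0 := by
  funext j
  by_cases h : j = i
  · subst h; exact hL _ hi _
  · exact hx j h

theorem ZeroOn.ev {m : ℕ} {r : ℤ} {μ : MMap L M m r} (hμ : ZeroOn μ) (d : Fin m → ℤ)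
    (v : Fin m → Tot L) (j : Fin m) (h : v j (d j) = 0) : ev μ d v = 0 := by
  simp [WL3.ev, hμ d (fun j => v j (d j)) j h]

theorem ev_eq_hat (hL : Bounded L) {m : ℕ} {r : ℤ} {μ : MMap L M m r} (hμ : ZeroOn μ)
    {d : Fin m → ℤ} {v : Fin m → Tot L} (hv : ∀ j, IsH (d j) (v j)) :
    ev μ d v = hat μ v := by
  by_cases hd : ∀ j, 0 ≤ d j ∧ d j < 3
  · let e : Fin m → Fin 3 := fun j => ⟨(d j).toNat, by have := hd j; omega⟩
    have he : (fun j => ((e j : ℕ) : ℤ)) = d := by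
      funext j; simp [e, (hd j).1]
    unfold hat
    rw [Finset.sum_eq_single e]
    · rw [he]
    · intro e' _ hne
      obtain ⟨j, hj⟩ := Function.ne_iff.1 hne
      refine hμ.ev _ _ j (hv j _ ?_)
      intro h
      apply hj
      ext
      have := congrFun he j
      lia
    · simp
  · push Not at hd
    obtain ⟨j, hj⟩ := hd
    have h0 : v j = 0 := (hv j).eq_zero hL (by by_contra h; have := hj (by omega); omega)
    rw [hμ.ev d v j (by simp [h0]), hat, Finset.sum_eq_zero]
    intro e _
    exact hμ.ev _ _ j (by simp [h0])

theorem isH_hat (hL : Bounded L) {m : ℕ} {r : ℤ} {μ : MMap L M m r} (hμ : ZeroOn μ)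
    {d : Fin m → ℤ} {v : Fin m → Tot L} (hv : ∀ j, IsH (d j) (v j)) :
    IsH (r + ∑ j, d j) (hat μ v) := by
  rw [← ev_eq_hat hL hμ hv]; exact isH_ev _ _ _

/-! ### Additivity of `ev` -/

theorem ev_add {m : ℕ} {r : ℤ} (μ ν : MMap L M m r) (d : Fin m → ℤ) (v : Fin m → Tot L) :
    ev (μ + ν) d v = ev μ d v + ev ν d v := by simp [ev, Pi.single_add]

theorem ev_sub {m : ℕ} {r : ℤ} (μ ν : MMap L M m r) (d : Fin m → ℤ) (v : Fin m → Tot L) :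
    ev (μ - ν) d v = ev μ d v - ev ν d v := by simp [ev, Pi.single_sub]

theorem ev_neg {m : ℕ} {r : ℤ} (μ : MMap L M m r) (d : Fin m → ℤ) (v : Fin m → Tot L) :
    ev (-μ) d v = - ev μ d v := by simp [ev, Pi.single_neg]

theorem ev_zero {m : ℕ} {r : ℤ} (d : Fin m → ℤ) (v : Fin m → Tot L) :
    ev (0 : MMap L M m r) d v = 0 := by simp [ev]

theorem ev_sum {m : ℕ} {r : ℤ} {ι : Type} (s : Finset ι) (μ : ι → MMap L M m r)
    (d : Fin m → ℤ) (v : Fin m → Tot L) :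
    ev (∑ i ∈ s, μ i) d v = ∑ i ∈ s, ev (μ i) d v := by
  classical
  induction s using Finset.induction_on with
  | empty => simp [ev_zero]
  | insert a s ha ih => rw [Finset.sum_insert ha, Finset.sum_insert ha, ev_add, ih]

theorem ev_zsmul {m : ℕ} {r : ℤ} (c : ℤ) (μ : MMap L M m r) (d : Fin m → ℤ)
    (v : Fin m → Tot L) : ev (c • μ) d v = c • ev μ d v := by
  simp only [ev, Pi.smul_apply]
  exact (map_zsmul (AddMonoidHom.single M _) c _)

theorem ev_smul {k : Type} [CommRing k] [∀ i, Module k (M i)] {m : ℕ} {r : ℤ} (c : k)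
    (μ : MMap L M m r) (d : Fin m → ℤ) (v : Fin m → Tot L) :
    ev (c • μ) d v = c • ev μ d v := by
  simp only [ev, Pi.smul_apply]
  exact (map_smul (LinearMap.single k M _) c _)

theorem ev_mcast {m : ℕ} {r r' : ℤ} (h : r = r') (μ : MMap L M m r) (d : Fin m → ℤ)
    (v : Fin m → Tot L) : ev (mcast rfl h μ) d v = ev μ d v := by
  subst h; rfl

theorem single_zsmul' (i : ℤ) (c : ℤ) (x : L i) :
    (Pi.single i (c • x) : Tot L) = c • Pi.single i x :=
  map_zsmul (AddMonoidHom.single L i) c x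

theorem ev_pa {m : ℕ} {r : ℤ} (σ : Equiv.Perm (Fin m)) (μ : MMap L M m r) (d : Fin m → ℤ)
    (v : Fin m → Tot L) :
    ev (pa σ μ) d v = koszulSign d σ • ev μ (fun j => d (σ.symm j)) (fun j => v (σ.symm j)) := by
  simp only [ev, pa, single_zsmul', single_gcast]

/-- The arguments of the outer map in a partial composition. -/
def outVec (m₁ m₂ n : ℕ) (v : Fin (m₁ + n + m₂) → Tot L) (y : Tot L) :
    Fin (m₁ + 1 + m₂) → Tot L :=
  Fin.append
    (Fin.append (fun j : Fin m₁ => v (Fin.castAdd m₂ (Fin.castAdd n j))) (fun _ : Fin 1 => y))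
    (fun j : Fin m₂ => v (Fin.natAdd (m₁ + n) j))

theorem ev_pcomp (m₁ m₂ : ℕ) {n : ℕ} {r s : ℤ} (μ : MMap L M (m₁ + 1 + m₂) r)
    (ν : MMap L L n s) (d : Fin (m₁ + n + m₂) → ℤ) (v : Fin (m₁ + n + m₂) → Tot L) :
    ev (pcomp m₁ m₂ μ ν) d v
      = sgn (s * ∑ j : Fin m₁, d (Fin.castAdd m₂ (Fin.castAdd n j))) •
        ev μ (outDeg m₁ m₂ n s d) (outVec m₁ m₂ n v
          (ev ν (fun j => d (Fin.castAdd m₂ (Fin.natAdd m₁ j)))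
            (fun j => v (Fin.castAdd m₂ (Fin.natAdd m₁ j))))) := by
  simp only [ev, pcomp, single_zsmul', single_gcast, sgn]
  congr 3
  funext j
  refine Fin.addCases (fun j' => ?_) (fun j3 => ?_) j
  · refine Fin.addCases (fun j1 => ?_) (fun j0 => ?_) j'
    · simp only [Fin.addCases_left, outVec, Fin.append_left]
      exact gcast_apply _ _
    · simp only [Fin.addCases_left, Fin.addCases_right, outVec, Fin.append_left,
        Fin.append_right]
      exact gcast_eq_single _ _
  · simp only [Fin.addCases_right, outVec, Fin.append_right]
    exact gcast_apply _ _

theorem ev_pc_hat (hL : Bounded L) (R : ℤ) (m₁ m₂ : ℕ) {n : ℕ} {r s : ℤ}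
    {μ : MMap L M (m₁ + 1 + m₂) r} {ν : MMap L L n s} (h : r + s = R)
    (hμ : ZeroOn μ) (hν : ZeroOn ν)
    {d : Fin (m₁ + n + m₂) → ℤ} {v : Fin (m₁ + n + m₂) → Tot L} (hv : ∀ j, IsH (d j) (v j)) :
    ev (pc R m₁ m₂ μ ν h) d v
      = sgn (s * ∑ j : Fin m₁, d (Fin.castAdd m₂ (Fin.castAdd n j))) •
        hat μ (outVec m₁ m₂ n v (hat ν (fun j => v (Fin.castAdd m₂ (Fin.natAdd m₁ j))))) := by
  rw [pc, ev_mcast, ev_pcomp, ev_eq_hat hL hν (fun j => hv _), ev_eq_hat hL hμ]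
  intro j
  refine Fin.addCases (fun j' => ?_) (fun j3 => ?_) j
  · refine Fin.addCases (fun j1 => ?_) (fun j0 => ?_) j'
    · simp only [outVec, outDeg, Fin.append_left]; exact hv _
    · simp only [outVec, outDeg, Fin.append_left, Fin.append_right]
      exact isH_hat hL hν (fun j => hv _)
  · simp only [outVec, outDeg, Fin.append_right]; exact hv _

theorem ev_fc1 (hM : Bounded M) (R : ℤ) {a : ℕ} {r s : ℤ} {μ : MMap M N 1 r} {g : MMap L M a s}
    (h : r + s = R) (hμ : ZeroOn μ) (d : Fin a → ℤ) (v : Fin a → Tot L) :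
    ev (fc1 R μ g h) d v = hat μ ![ev g d v] := by
  rw [fc1, ev_mcast]
  rw [← ev_eq_hat hM hμ (d := fun _ => s + ∑ j, d j)
    (by intro j; fin_cases j; exact isH_ev _ _ _)]
  simp only [ev, comp₁, single_gcast]
  congr 2
  funext j
  fin_cases j
  simp

theorem ev_fc2 (hM : Bounded M) (R : ℤ) {a b : ℕ} {r s₁ s₂ : ℤ} {μ : MMap M N 2 r}
    {g₁ : MMap L M a s₁} {g₂ : MMap L M b s₂} (h : r + (s₁ + s₂) = R) (hμ : ZeroOn μ)
    (d : Fin (a + b) → ℤ) (v : Fin (a + b) → Tot L) :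
    ev (fc2 R μ g₁ g₂ h) d v = sgn (s₂ * ∑ j : Fin a, d (Fin.castAdd b j)) •
      hat μ ![ev g₁ (fun j => d (Fin.castAdd b j)) (fun j => v (Fin.castAdd b j)),
        ev g₂ (fun j => d (Fin.natAdd a j)) (fun j => v (Fin.natAdd a j))] := by
  rw [fc2, ev_mcast]
  rw [← ev_eq_hat hM hμ (d := ![s₁ + ∑ j : Fin a, d (Fin.castAdd b j),
      s₂ + ∑ j : Fin b, d (Fin.natAdd a j)])
    (by intro j; fin_cases j <;> exact isH_ev _ _ _)]
  simp only [ev, comp₂, single_zsmul', single_gcast, sgn]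
  congr 3
  funext j
  fin_cases j
  · exact gcast_eq_single rfl _
  · exact gcast_eq_single rfl _

theorem ev_fc3 (hM : Bounded M) (R : ℤ) {a b c : ℕ} {r s₁ s₂ s₃ : ℤ} {μ : MMap M N 3 r}
    {g₁ : MMap L M a s₁} {g₂ : MMap L M b s₂} {g₃ : MMap L M c s₃}
    (h : r + (s₁ + s₂ + s₃) = R) (hμ : ZeroOn μ)
    (d : Fin (a + b + c) → ℤ) (v : Fin (a + b + c) → Tot L) :
    ev (fc3 R μ g₁ g₂ g₃ h) d v
      = sgn (s₂ * (∑ j : Fin a, d (Fin.castAdd c (Fin.castAdd b j)))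
        + s₃ * ((∑ j : Fin a, d (Fin.castAdd c (Fin.castAdd b j)))
          + ∑ j : Fin b, d (Fin.castAdd c (Fin.natAdd a j)))) •
      hat μ ![ev g₁ (fun j => d (Fin.castAdd c (Fin.castAdd b j)))
          (fun j => v (Fin.castAdd c (Fin.castAdd b j))),
        ev g₂ (fun j => d (Fin.castAdd c (Fin.natAdd a j)))
          (fun j => v (Fin.castAdd c (Fin.natAdd a j))),
        ev g₃ (fun j => d (Fin.natAdd (a + b) j)) (fun j => v (Fin.natAdd (a + b) j))] := by
  rw [fc3, ev_mcast]
  rw [← ev_eq_hat hM hμ (d := ![s₁ + ∑ j : Fin a, d (Fin.castAdd c (Fin.castAdd b j)),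
                       s₂ + ∑ j : Fin b, d (Fin.castAdd c (Fin.natAdd a j)),
                       s₃ + ∑ j : Fin c, d (Fin.natAdd (a + b) j)])
    (by intro j; fin_cases j <;> exact isH_ev _ _ _)]
  simp only [ev, comp₃, single_zsmul', single_gcast, sgn]
  congr 3
  funext j
  fin_cases j
  · exact gcast_eq_single rfl _
  · exact gcast_eq_single rfl _
  · exact gcast_eq_single rfl _

theorem ev_fc4 (hM : Bounded M) (R : ℤ) {a b c e : ℕ} {r s₁ s₂ s₃ s₄ : ℤ} {μ : MMap M N 4 r}
    {g₁ : MMap L M a s₁} {g₂ : MMap L M b s₂} {g₃ : MMap L M c s₃} {g₄ : MMap L M e s₄}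
    (h : r + (s₁ + s₂ + s₃ + s₄) = R) (hμ : ZeroOn μ)
    (d : Fin (a + b + c + e) → ℤ) (v : Fin (a + b + c + e) → Tot L) :
    ev (fc4 R μ g₁ g₂ g₃ g₄ h) d v
      = sgn (s₂ * (∑ j : Fin a, d (Fin.castAdd e (Fin.castAdd c (Fin.castAdd b j))))
        + s₃ * ((∑ j : Fin a, d (Fin.castAdd e (Fin.castAdd c (Fin.castAdd b j))))
          + ∑ j : Fin b, d (Fin.castAdd e (Fin.castAdd c (Fin.natAdd a j))))
        + s₄ * ((∑ j : Fin a, d (Fin.castAdd e (Fin.castAdd c (Fin.castAdd b j))))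
          + (∑ j : Fin b, d (Fin.castAdd e (Fin.castAdd c (Fin.natAdd a j))))
          + ∑ j : Fin c, d (Fin.castAdd e (Fin.natAdd (a + b) j)))) •
      hat μ ![ev g₁ (fun j => d (Fin.castAdd e (Fin.castAdd c (Fin.castAdd b j))))
          (fun j => v (Fin.castAdd e (Fin.castAdd c (Fin.castAdd b j)))),
        ev g₂ (fun j => d (Fin.castAdd e (Fin.castAdd c (Fin.natAdd a j))))
          (fun j => v (Fin.castAdd e (Fin.castAdd c (Fin.natAdd a j)))),
        ev g₃ (fun j => d (Fin.castAdd e (Fin.natAdd (a + b) j)))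
          (fun j => v (Fin.castAdd e (Fin.natAdd (a + b) j))),
        ev g₄ (fun j => d (Fin.natAdd (a + b + c) j))
          (fun j => v (Fin.natAdd (a + b + c) j))] := by
  rw [fc4, ev_mcast]
  rw [← ev_eq_hat hM hμ
    (d := ![s₁ + ∑ j : Fin a, d (Fin.castAdd e (Fin.castAdd c (Fin.castAdd b j))),
      s₂ + ∑ j : Fin b, d (Fin.castAdd e (Fin.castAdd c (Fin.natAdd a j))),
      s₃ + ∑ j : Fin c, d (Fin.castAdd e (Fin.natAdd (a + b) j)),
      s₄ + ∑ j : Fin e, d (Fin.natAdd (a + b + c) j)])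
    (by intro j; fin_cases j <;> exact isH_ev _ _ _)]
  simp only [ev, comp₄, single_zsmul', single_gcast, sgn]
  congr 3
  funext j
  fin_cases j
  · exact gcast_eq_single rfl _
  · exact gcast_eq_single rfl _
  · exact gcast_eq_single rfl _
  · exact gcast_eq_single rfl _

/-! ### The differential -/

theorem bd_one (R : ℤ) {r : ℤ} (D' : MMap M M 1 (-1)) (D : MMap L L 1 (-1)) (μ : MMap L M 1 r)
    (h : -1 + r = R) :
    bd R D' D μ h = fc1 R D' μ h - sgn r • pc R 0 0 μ D (by omega) := by
  subst h
  change bdry D' D μ = _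
  rw [bdry, Fin.sum_univ_one]
  rfl

theorem bd_two (R : ℤ) {r : ℤ} (D' : MMap M M 1 (-1)) (D : MMap L L 1 (-1)) (μ : MMap L M 2 r)
    (h : -1 + r = R) :
    bd R D' D μ h = fc1 R D' μ h
      - sgn r • ((pc R 0 1 μ D (by omega) : MMap L M 2 R) + pc R 1 0 μ D (by omega)) := by
  subst h
  change bdry D' D μ = _
  rw [bdry, Fin.sum_univ_two]
  rfl

theorem bd_three (R : ℤ) {r : ℤ} (D' : MMap M M 1 (-1)) (D : MMap L L 1 (-1))
    (μ : MMap L M 3 r) (h : -1 + r = R) :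
    bd R D' D μ h = fc1 R D' μ h
      - sgn r • ((pc R 0 2 μ D (by omega) : MMap L M 3 R) + pc R 1 1 μ D (by omega)
        + pc R 2 0 μ D (by omega)) := by
  subst h
  change bdry D' D μ = _
  rw [bdry, Fin.sum_univ_three]
  rfl

end Hat

section Shapes

set_option linter.unusedSectionVars false

variable {L M N : ℤ → Type} [∀ i, AddCommGroup (L i)] [∀ i, AddCommGroup (M i)]
  [∀ i, AddCommGroup (N i)]

theorem eta1 {α : Type*} (v : Fin 1 → α) : v = ![v 0] := by funext j; fin_cases j; rfl
theorem eta2 {α : Type*} (v : Fin 2 → α) : v = ![v 0, v 1] := by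
  funext j; fin_cases j <;> rfl
theorem eta3 {α : Type*} (v : Fin 3 → α) : v = ![v 0, v 1, v 2] := by
  funext j; fin_cases j <;> rfl
theorem eta4 {α : Type*} (v : Fin 4 → α) : v = ![v 0, v 1, v 2, v 3] := by
  funext j; fin_cases j <;> rfl

/-- Curried form of `hat`. -/
noncomputable def H1 {r : ℤ} (μ : MMap L M 1 r) (a : Tot L) : Tot M := hat μ ![a]
/-- Curried form of `hat`. -/
noncomputable def H2 {r : ℤ} (μ : MMap L M 2 r) (a b : Tot L) : Tot M := hat μ ![a, b]
/-- Curried form of `hat`. -/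
noncomputable def H3 {r : ℤ} (μ : MMap L M 3 r) (a b c : Tot L) : Tot M := hat μ ![a, b, c]
/-- Curried form of `hat`. -/
noncomputable def H4 {r : ℤ} (μ : MMap L M 4 r) (a b c e : Tot L) : Tot M :=
  hat μ ![a, b, c, e]

theorem hat_one {r : ℤ} (μ : MMap L M 1 r) (v : Fin 1 → Tot L) : hat μ v = H1 μ (v 0) := by
  rw [H1, ← eta1 v]
theorem hat_two {r : ℤ} (μ : MMap L M 2 r) (v : Fin 2 → Tot L) :
    hat μ v = H2 μ (v 0) (v 1) := by
  rw [H2, ← eta2 v]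
theorem hat_three {r : ℤ} (μ : MMap L M 3 r) (v : Fin 3 → Tot L) :
    hat μ v = H3 μ (v 0) (v 1) (v 2) := by
  rw [H3, ← eta3 v]
theorem hat_four {r : ℤ} (μ : MMap L M 4 r) (v : Fin 4 → Tot L) :
    hat μ v = H4 μ (v 0) (v 1) (v 2) (v 3) := by
  rw [H4, ← eta4 v]

variable {r s s₁ s₂ s₃ s₄ : ℤ}

theorem ev_pc_0_0_1 (hL : Bounded L) {R : ℤ} {μ : MMap L M 1 r} {ν : MMap L L 1 s}
    {h : r + s = R} (hμ : ZeroOn μ) (hν : ZeroOn ν) {i₀ : ℤ} {x₀ : Tot L}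
    (h₀ : IsH i₀ x₀) :
    ev (m := 1) (pc R 0 0 μ ν h) ![i₀] ![x₀]
      = H1 μ (H1 ν x₀) := by
  refine (ev_pc_hat hL R 0 0 h hμ hν (d := ![i₀]) (v := ![x₀])
    (fun j => by fin_cases j; assumption)).trans ?_
  rw [hat_one ν]
  erw [hat_one μ]
  simp only [Finset.univ_eq_empty, Finset.sum_empty, mul_zero, sgn, Int.natAbs_zero, pow_zero,
    one_zsmul]
  rfl

theorem ev_pc_0_1_1 (hL : Bounded L) {R : ℤ} {μ : MMap L M 2 r} {ν : MMap L L 1 s}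
    {h : r + s = R} (hμ : ZeroOn μ) (hν : ZeroOn ν) {i₀ : ℤ} {x₀ : Tot L} {i₁ : ℤ} {x₁ : Tot L}
    (h₀ : IsH i₀ x₀) (h₁ : IsH i₁ x₁) :
    ev (m := 2) (pc R 0 1 μ ν h) ![i₀, i₁] ![x₀, x₁]
      = H2 μ (H1 ν x₀) x₁ := by
  refine (ev_pc_hat hL R 0 1 h hμ hν (d := ![i₀, i₁]) (v := ![x₀, x₁])
    (fun j => by fin_cases j <;> assumption)).trans ?_
  rw [hat_one ν]
  erw [hat_two μ]
  simp only [Finset.univ_eq_empty, Finset.sum_empty, mul_zero, sgn, Int.natAbs_zero, pow_zero,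
    one_zsmul]
  rfl

theorem ev_pc_1_0_1 (hL : Bounded L) {R : ℤ} {μ : MMap L M 2 r} {ν : MMap L L 1 s}
    {h : r + s = R} (hμ : ZeroOn μ) (hν : ZeroOn ν) {i₀ : ℤ} {x₀ : Tot L} {i₁ : ℤ} {x₁ : Tot L}
    (h₀ : IsH i₀ x₀) (h₁ : IsH i₁ x₁) :
    ev (m := 2) (pc R 1 0 μ ν h) ![i₀, i₁] ![x₀, x₁]
      = sgn (s * i₀) • H2 μ x₀ (H1 ν x₁) := by
  refine (ev_pc_hat hL R 1 0 h hμ hν (d := ![i₀, i₁]) (v := ![x₀, x₁])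
    (fun j => by fin_cases j <;> assumption)).trans ?_
  rw [hat_one ν]
  erw [hat_two μ]
  simp only [Fin.sum_univ_one]
  rfl

theorem ev_pc_0_2_1 (hL : Bounded L) {R : ℤ} {μ : MMap L M 3 r} {ν : MMap L L 1 s}
    {h : r + s = R} (hμ : ZeroOn μ) (hν : ZeroOn ν) {i₀ : ℤ} {x₀ : Tot L} {i₁ : ℤ} {x₁ : Tot L}
    {i₂ : ℤ} {x₂ : Tot L}
    (h₀ : IsH i₀ x₀) (h₁ : IsH i₁ x₁) (h₂ : IsH i₂ x₂) :
    ev (m := 3) (pc R 0 2 μ ν h) ![i₀, i₁, i₂] ![x₀, x₁, x₂]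
      = H3 μ (H1 ν x₀) x₁ x₂ := by
  refine (ev_pc_hat hL R 0 2 h hμ hν (d := ![i₀, i₁, i₂]) (v := ![x₀, x₁, x₂])
    (fun j => by fin_cases j <;> assumption)).trans ?_
  rw [hat_one ν]
  erw [hat_three μ]
  simp only [Finset.univ_eq_empty, Finset.sum_empty, mul_zero, sgn, Int.natAbs_zero, pow_zero,
    one_zsmul]
  rfl

theorem ev_pc_1_1_1 (hL : Bounded L) {R : ℤ} {μ : MMap L M 3 r} {ν : MMap L L 1 s}
    {h : r + s = R} (hμ : ZeroOn μ) (hν : ZeroOn ν) {i₀ : ℤ} {x₀ : Tot L} {i₁ : ℤ} {x₁ : Tot L}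
    {i₂ : ℤ} {x₂ : Tot L}
    (h₀ : IsH i₀ x₀) (h₁ : IsH i₁ x₁) (h₂ : IsH i₂ x₂) :
    ev (m := 3) (pc R 1 1 μ ν h) ![i₀, i₁, i₂] ![x₀, x₁, x₂]
      = sgn (s * i₀) • H3 μ x₀ (H1 ν x₁) x₂ := by
  refine (ev_pc_hat hL R 1 1 h hμ hν (d := ![i₀, i₁, i₂]) (v := ![x₀, x₁, x₂])
    (fun j => by fin_cases j <;> assumption)).trans ?_
  rw [hat_one ν]
  erw [hat_three μ]
  simp only [Fin.sum_univ_one]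
  rfl

theorem ev_pc_2_0_1 (hL : Bounded L) {R : ℤ} {μ : MMap L M 3 r} {ν : MMap L L 1 s}
    {h : r + s = R} (hμ : ZeroOn μ) (hν : ZeroOn ν) {i₀ : ℤ} {x₀ : Tot L} {i₁ : ℤ} {x₁ : Tot L}
    {i₂ : ℤ} {x₂ : Tot L}
    (h₀ : IsH i₀ x₀) (h₁ : IsH i₁ x₁) (h₂ : IsH i₂ x₂) :
    ev (m := 3) (pc R 2 0 μ ν h) ![i₀, i₁, i₂] ![x₀, x₁, x₂]
      = sgn (s * (i₀ + i₁)) • H3 μ x₀ x₁ (H1 ν x₂) := by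
  refine (ev_pc_hat hL R 2 0 h hμ hν (d := ![i₀, i₁, i₂]) (v := ![x₀, x₁, x₂])
    (fun j => by fin_cases j <;> assumption)).trans ?_
  rw [hat_one ν]
  erw [hat_three μ]
  simp only [Fin.sum_univ_two]
  rfl

theorem ev_pc_0_1_2 (hL : Bounded L) {R : ℤ} {μ : MMap L M 2 r} {ν : MMap L L 2 s}
    {h : r + s = R} (hμ : ZeroOn μ) (hν : ZeroOn ν) {i₀ : ℤ} {x₀ : Tot L} {i₁ : ℤ} {x₁ : Tot L}
    {i₂ : ℤ} {x₂ : Tot L}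
    (h₀ : IsH i₀ x₀) (h₁ : IsH i₁ x₁) (h₂ : IsH i₂ x₂) :
    ev (m := 3) (pc R 0 1 μ ν h) ![i₀, i₁, i₂] ![x₀, x₁, x₂]
      = H2 μ (H2 ν x₀ x₁) x₂ := by
  refine (ev_pc_hat hL R 0 1 h hμ hν (d := ![i₀, i₁, i₂]) (v := ![x₀, x₁, x₂])
    (fun j => by fin_cases j <;> assumption)).trans ?_
  rw [hat_two ν]
  erw [hat_two μ]
  simp only [Finset.univ_eq_empty, Finset.sum_empty, mul_zero, sgn, Int.natAbs_zero, pow_zero,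
    one_zsmul]
  rfl

theorem ev_pc_1_0_2 (hL : Bounded L) {R : ℤ} {μ : MMap L M 2 r} {ν : MMap L L 2 s}
    {h : r + s = R} (hμ : ZeroOn μ) (hν : ZeroOn ν) {i₀ : ℤ} {x₀ : Tot L} {i₁ : ℤ} {x₁ : Tot L}
    {i₂ : ℤ} {x₂ : Tot L}
    (h₀ : IsH i₀ x₀) (h₁ : IsH i₁ x₁) (h₂ : IsH i₂ x₂) :
    ev (m := 3) (pc R 1 0 μ ν h) ![i₀, i₁, i₂] ![x₀, x₁, x₂]
      = sgn (s * i₀) • H2 μ x₀ (H2 ν x₁ x₂) := by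
  refine (ev_pc_hat hL R 1 0 h hμ hν (d := ![i₀, i₁, i₂]) (v := ![x₀, x₁, x₂])
    (fun j => by fin_cases j <;> assumption)).trans ?_
  rw [hat_two ν]
  erw [hat_two μ]
  simp only [Fin.sum_univ_one]
  rfl

theorem ev_pc_0_1_3 (hL : Bounded L) {R : ℤ} {μ : MMap L M 2 r} {ν : MMap L L 3 s}
    {h : r + s = R} (hμ : ZeroOn μ) (hν : ZeroOn ν) {i₀ : ℤ} {x₀ : Tot L} {i₁ : ℤ} {x₁ : Tot L}
    {i₂ : ℤ} {x₂ : Tot L} {i₃ : ℤ} {x₃ : Tot L}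
    (h₀ : IsH i₀ x₀) (h₁ : IsH i₁ x₁) (h₂ : IsH i₂ x₂) (h₃ : IsH i₃ x₃) :
    ev (m := 4) (pc R 0 1 μ ν h) ![i₀, i₁, i₂, i₃] ![x₀, x₁, x₂, x₃]
      = H2 μ (H3 ν x₀ x₁ x₂) x₃ := by
  refine (ev_pc_hat hL R 0 1 h hμ hν (d := ![i₀, i₁, i₂, i₃]) (v := ![x₀, x₁, x₂, x₃])
    (fun j => by fin_cases j <;> assumption)).trans ?_
  rw [hat_three ν]
  erw [hat_two μ]
  simp only [Finset.univ_eq_empty, Finset.sum_empty, mul_zero, sgn, Int.natAbs_zero, pow_zero,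
    one_zsmul]
  rfl

theorem ev_pc_1_0_3 (hL : Bounded L) {R : ℤ} {μ : MMap L M 2 r} {ν : MMap L L 3 s}
    {h : r + s = R} (hμ : ZeroOn μ) (hν : ZeroOn ν) {i₀ : ℤ} {x₀ : Tot L} {i₁ : ℤ} {x₁ : Tot L}
    {i₂ : ℤ} {x₂ : Tot L} {i₃ : ℤ} {x₃ : Tot L}
    (h₀ : IsH i₀ x₀) (h₁ : IsH i₁ x₁) (h₂ : IsH i₂ x₂) (h₃ : IsH i₃ x₃) :
    ev (m := 4) (pc R 1 0 μ ν h) ![i₀, i₁, i₂, i₃] ![x₀, x₁, x₂, x₃]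
      = sgn (s * i₀) • H2 μ x₀ (H3 ν x₁ x₂ x₃) := by
  refine (ev_pc_hat hL R 1 0 h hμ hν (d := ![i₀, i₁, i₂, i₃]) (v := ![x₀, x₁, x₂, x₃])
    (fun j => by fin_cases j <;> assumption)).trans ?_
  rw [hat_three ν]
  erw [hat_two μ]
  simp only [Fin.sum_univ_one]
  rfl

theorem ev_pc_0_2_2 (hL : Bounded L) {R : ℤ} {μ : MMap L M 3 r} {ν : MMap L L 2 s}
    {h : r + s = R} (hμ : ZeroOn μ) (hν : ZeroOn ν) {i₀ : ℤ} {x₀ : Tot L} {i₁ : ℤ} {x₁ : Tot L}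
    {i₂ : ℤ} {x₂ : Tot L} {i₃ : ℤ} {x₃ : Tot L}
    (h₀ : IsH i₀ x₀) (h₁ : IsH i₁ x₁) (h₂ : IsH i₂ x₂) (h₃ : IsH i₃ x₃) :
    ev (m := 4) (pc R 0 2 μ ν h) ![i₀, i₁, i₂, i₃] ![x₀, x₁, x₂, x₃]
      = H3 μ (H2 ν x₀ x₁) x₂ x₃ := by
  refine (ev_pc_hat hL R 0 2 h hμ hν (d := ![i₀, i₁, i₂, i₃]) (v := ![x₀, x₁, x₂, x₃])
    (fun j => by fin_cases j <;> assumption)).trans ?_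
  rw [hat_two ν]
  erw [hat_three μ]
  simp only [Finset.univ_eq_empty, Finset.sum_empty, mul_zero, sgn, Int.natAbs_zero, pow_zero,
    one_zsmul]
  rfl

theorem ev_pc_1_1_2 (hL : Bounded L) {R : ℤ} {μ : MMap L M 3 r} {ν : MMap L L 2 s}
    {h : r + s = R} (hμ : ZeroOn μ) (hν : ZeroOn ν) {i₀ : ℤ} {x₀ : Tot L} {i₁ : ℤ} {x₁ : Tot L}
    {i₂ : ℤ} {x₂ : Tot L} {i₃ : ℤ} {x₃ : Tot L}
    (h₀ : IsH i₀ x₀) (h₁ : IsH i₁ x₁) (h₂ : IsH i₂ x₂) (h₃ : IsH i₃ x₃) :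
    ev (m := 4) (pc R 1 1 μ ν h) ![i₀, i₁, i₂, i₃] ![x₀, x₁, x₂, x₃]
      = sgn (s * i₀) • H3 μ x₀ (H2 ν x₁ x₂) x₃ := by
  refine (ev_pc_hat hL R 1 1 h hμ hν (d := ![i₀, i₁, i₂, i₃]) (v := ![x₀, x₁, x₂, x₃])
    (fun j => by fin_cases j <;> assumption)).trans ?_
  rw [hat_two ν]
  erw [hat_three μ]
  simp only [Fin.sum_univ_one]
  rfl

theorem ev_pc_2_0_2 (hL : Bounded L) {R : ℤ} {μ : MMap L M 3 r} {ν : MMap L L 2 s}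
    {h : r + s = R} (hμ : ZeroOn μ) (hν : ZeroOn ν) {i₀ : ℤ} {x₀ : Tot L} {i₁ : ℤ} {x₁ : Tot L}
    {i₂ : ℤ} {x₂ : Tot L} {i₃ : ℤ} {x₃ : Tot L}
    (h₀ : IsH i₀ x₀) (h₁ : IsH i₁ x₁) (h₂ : IsH i₂ x₂) (h₃ : IsH i₃ x₃) :
    ev (m := 4) (pc R 2 0 μ ν h) ![i₀, i₁, i₂, i₃] ![x₀, x₁, x₂, x₃]
      = sgn (s * (i₀ + i₁)) • H3 μ x₀ x₁ (H2 ν x₂ x₃) := by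
  refine (ev_pc_hat hL R 2 0 h hμ hν (d := ![i₀, i₁, i₂, i₃]) (v := ![x₀, x₁, x₂, x₃])
    (fun j => by fin_cases j <;> assumption)).trans ?_
  rw [hat_two ν]
  erw [hat_three μ]
  simp only [Fin.sum_univ_two]
  rfl

theorem ev_fc_1 (hL : Bounded L) (hM : Bounded M) {R : ℤ} {μ : MMap M N 1 r}
    {g₁ : MMap L M 1 s₁}
    {h : r + s₁ = R} (hμ : ZeroOn μ) (hg₁ : ZeroOn g₁)
    {i₀ : ℤ} {x₀ : Tot L}
    (h₀ : IsH i₀ x₀) :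
    ev (m := 1) (fc1 R μ g₁ h) ![i₀] ![x₀]
      = H1 μ (H1 g₁ x₀) := by
  refine (ev_fc1 (a := 1) hM R h hμ ![i₀] ![x₀]).trans ?_
  rw [ev_eq_hat hL hg₁ (fun j => by fin_cases j; assumption)]
  simp only [hat_one]
  rfl

theorem ev_fc_2 (hL : Bounded L) (hM : Bounded M) {R : ℤ} {μ : MMap M N 1 r}
    {g₁ : MMap L M 2 s₁}
    {h : r + s₁ = R} (hμ : ZeroOn μ) (hg₁ : ZeroOn g₁)
    {i₀ : ℤ} {x₀ : Tot L} {i₁ : ℤ} {x₁ : Tot L}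
    (h₀ : IsH i₀ x₀) (h₁ : IsH i₁ x₁) :
    ev (m := 2) (fc1 R μ g₁ h) ![i₀, i₁] ![x₀, x₁]
      = H1 μ (H2 g₁ x₀ x₁) := by
  refine (ev_fc1 (a := 2) hM R h hμ ![i₀, i₁] ![x₀, x₁]).trans ?_
  rw [ev_eq_hat hL hg₁ (fun j => by fin_cases j <;> assumption)]
  simp only [hat_one, hat_two]
  rfl

theorem ev_fc_3 (hL : Bounded L) (hM : Bounded M) {R : ℤ} {μ : MMap M N 1 r}
    {g₁ : MMap L M 3 s₁}
    {h : r + s₁ = R} (hμ : ZeroOn μ) (hg₁ : ZeroOn g₁)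
    {i₀ : ℤ} {x₀ : Tot L} {i₁ : ℤ} {x₁ : Tot L} {i₂ : ℤ} {x₂ : Tot L}
    (h₀ : IsH i₀ x₀) (h₁ : IsH i₁ x₁) (h₂ : IsH i₂ x₂) :
    ev (m := 3) (fc1 R μ g₁ h) ![i₀, i₁, i₂] ![x₀, x₁, x₂]
      = H1 μ (H3 g₁ x₀ x₁ x₂) := by
  refine (ev_fc1 (a := 3) hM R h hμ ![i₀, i₁, i₂] ![x₀, x₁, x₂]).trans ?_
  rw [ev_eq_hat hL hg₁ (fun j => by fin_cases j <;> assumption)]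
  simp only [hat_one, hat_three]
  rfl

theorem ev_fc_4 (hL : Bounded L) (hM : Bounded M) {R : ℤ} {μ : MMap M N 1 r}
    {g₁ : MMap L M 4 s₁}
    {h : r + s₁ = R} (hμ : ZeroOn μ) (hg₁ : ZeroOn g₁)
    {i₀ : ℤ} {x₀ : Tot L} {i₁ : ℤ} {x₁ : Tot L} {i₂ : ℤ} {x₂ : Tot L} {i₃ : ℤ} {x₃ : Tot L}
    (h₀ : IsH i₀ x₀) (h₁ : IsH i₁ x₁) (h₂ : IsH i₂ x₂) (h₃ : IsH i₃ x₃) :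
    ev (m := 4) (fc1 R μ g₁ h) ![i₀, i₁, i₂, i₃] ![x₀, x₁, x₂, x₃]
      = H1 μ (H4 g₁ x₀ x₁ x₂ x₃) := by
  refine (ev_fc1 (a := 4) hM R h hμ ![i₀, i₁, i₂, i₃] ![x₀, x₁, x₂, x₃]).trans ?_
  rw [ev_eq_hat hL hg₁ (fun j => by fin_cases j <;> assumption)]
  simp only [hat_one, hat_four]
  rfl

theorem ev_fc_1_1 (hL : Bounded L) (hM : Bounded M) {R : ℤ} {μ : MMap M N 2 r}
    {g₁ : MMap L M 1 s₁} {g₂ : MMap L M 1 s₂}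
    {h : r + (s₁ + s₂) = R} (hμ : ZeroOn μ) (hg₁ : ZeroOn g₁) (hg₂ : ZeroOn g₂)
    {i₀ : ℤ} {x₀ : Tot L} {i₁ : ℤ} {x₁ : Tot L}
    (h₀ : IsH i₀ x₀) (h₁ : IsH i₁ x₁) :
    ev (m := 2) (fc2 R μ g₁ g₂ h) ![i₀, i₁] ![x₀, x₁]
      = sgn (s₂ * i₀) • H2 μ (H1 g₁ x₀) (H1 g₂ x₁) := by
  refine (ev_fc2 (a := 1) (b := 1) hM R h hμ ![i₀, i₁] ![x₀, x₁]).trans ?_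
  rw [ev_eq_hat hL hg₁ (fun j => by fin_cases j; assumption),
    ev_eq_hat hL hg₂ (fun j => by fin_cases j; assumption)]
  simp only [Fin.sum_univ_one, hat_one, hat_two]
  rfl

theorem ev_fc_2_1 (hL : Bounded L) (hM : Bounded M) {R : ℤ} {μ : MMap M N 2 r}
    {g₁ : MMap L M 2 s₁} {g₂ : MMap L M 1 s₂}
    {h : r + (s₁ + s₂) = R} (hμ : ZeroOn μ) (hg₁ : ZeroOn g₁) (hg₂ : ZeroOn g₂)
    {i₀ : ℤ} {x₀ : Tot L} {i₁ : ℤ} {x₁ : Tot L} {i₂ : ℤ} {x₂ : Tot L}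
    (h₀ : IsH i₀ x₀) (h₁ : IsH i₁ x₁) (h₂ : IsH i₂ x₂) :
    ev (m := 3) (fc2 R μ g₁ g₂ h) ![i₀, i₁, i₂] ![x₀, x₁, x₂]
      = sgn (s₂ * (i₀ + i₁)) • H2 μ (H2 g₁ x₀ x₁) (H1 g₂ x₂) := by
  refine (ev_fc2 (a := 2) (b := 1) hM R h hμ ![i₀, i₁, i₂] ![x₀, x₁, x₂]).trans ?_
  rw [ev_eq_hat hL hg₁ (fun j => by fin_cases j <;> assumption),
    ev_eq_hat hL hg₂ (fun j => by fin_cases j; assumption)]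
  simp only [Fin.sum_univ_two, hat_one, hat_two]
  rfl

theorem ev_fc_1_2 (hL : Bounded L) (hM : Bounded M) {R : ℤ} {μ : MMap M N 2 r}
    {g₁ : MMap L M 1 s₁} {g₂ : MMap L M 2 s₂}
    {h : r + (s₁ + s₂) = R} (hμ : ZeroOn μ) (hg₁ : ZeroOn g₁) (hg₂ : ZeroOn g₂)
    {i₀ : ℤ} {x₀ : Tot L} {i₁ : ℤ} {x₁ : Tot L} {i₂ : ℤ} {x₂ : Tot L}
    (h₀ : IsH i₀ x₀) (h₁ : IsH i₁ x₁) (h₂ : IsH i₂ x₂) :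
    ev (m := 3) (fc2 R μ g₁ g₂ h) ![i₀, i₁, i₂] ![x₀, x₁, x₂]
      = sgn (s₂ * i₀) • H2 μ (H1 g₁ x₀) (H2 g₂ x₁ x₂) := by
  refine (ev_fc2 (a := 1) (b := 2) hM R h hμ ![i₀, i₁, i₂] ![x₀, x₁, x₂]).trans ?_
  rw [ev_eq_hat hL hg₁ (fun j => by fin_cases j; assumption),
    ev_eq_hat hL hg₂ (fun j => by fin_cases j <;> assumption)]
  simp only [Fin.sum_univ_one, hat_one, hat_two]
  rfl

theorem ev_fc_3_1 (hL : Bounded L) (hM : Bounded M) {R : ℤ} {μ : MMap M N 2 r}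
    {g₁ : MMap L M 3 s₁} {g₂ : MMap L M 1 s₂}
    {h : r + (s₁ + s₂) = R} (hμ : ZeroOn μ) (hg₁ : ZeroOn g₁) (hg₂ : ZeroOn g₂)
    {i₀ : ℤ} {x₀ : Tot L} {i₁ : ℤ} {x₁ : Tot L} {i₂ : ℤ} {x₂ : Tot L} {i₃ : ℤ} {x₃ : Tot L}
    (h₀ : IsH i₀ x₀) (h₁ : IsH i₁ x₁) (h₂ : IsH i₂ x₂) (h₃ : IsH i₃ x₃) :
    ev (m := 4) (fc2 R μ g₁ g₂ h) ![i₀, i₁, i₂, i₃] ![x₀, x₁, x₂, x₃]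
      = sgn (s₂ * (i₀ + i₁ + i₂)) • H2 μ (H3 g₁ x₀ x₁ x₂) (H1 g₂ x₃) := by
  refine (ev_fc2 (a := 3) (b := 1) hM R h hμ ![i₀, i₁, i₂, i₃] ![x₀, x₁, x₂, x₃]).trans ?_
  rw [ev_eq_hat hL hg₁ (fun j => by fin_cases j <;> assumption),
    ev_eq_hat hL hg₂ (fun j => by fin_cases j; assumption)]
  simp only [Fin.sum_univ_three, hat_one, hat_two, hat_three]
  rfl

theorem ev_fc_1_3 (hL : Bounded L) (hM : Bounded M) {R : ℤ} {μ : MMap M N 2 r}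
    {g₁ : MMap L M 1 s₁} {g₂ : MMap L M 3 s₂}
    {h : r + (s₁ + s₂) = R} (hμ : ZeroOn μ) (hg₁ : ZeroOn g₁) (hg₂ : ZeroOn g₂)
    {i₀ : ℤ} {x₀ : Tot L} {i₁ : ℤ} {x₁ : Tot L} {i₂ : ℤ} {x₂ : Tot L} {i₃ : ℤ} {x₃ : Tot L}
    (h₀ : IsH i₀ x₀) (h₁ : IsH i₁ x₁) (h₂ : IsH i₂ x₂) (h₃ : IsH i₃ x₃) :
    ev (m := 4) (fc2 R μ g₁ g₂ h) ![i₀, i₁, i₂, i₃] ![x₀, x₁, x₂, x₃]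
      = sgn (s₂ * i₀) • H2 μ (H1 g₁ x₀) (H3 g₂ x₁ x₂ x₃) := by
  refine (ev_fc2 (a := 1) (b := 3) hM R h hμ ![i₀, i₁, i₂, i₃] ![x₀, x₁, x₂, x₃]).trans ?_
  rw [ev_eq_hat hL hg₁ (fun j => by fin_cases j; assumption),
    ev_eq_hat hL hg₂ (fun j => by fin_cases j <;> assumption)]
  simp only [Fin.sum_univ_one, hat_one, hat_two, hat_three]
  rfl

theorem ev_fc_2_2 (hL : Bounded L) (hM : Bounded M) {R : ℤ} {μ : MMap M N 2 r}
    {g₁ : MMap L M 2 s₁} {g₂ : MMap L M 2 s₂}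
    {h : r + (s₁ + s₂) = R} (hμ : ZeroOn μ) (hg₁ : ZeroOn g₁) (hg₂ : ZeroOn g₂)
    {i₀ : ℤ} {x₀ : Tot L} {i₁ : ℤ} {x₁ : Tot L} {i₂ : ℤ} {x₂ : Tot L} {i₃ : ℤ} {x₃ : Tot L}
    (h₀ : IsH i₀ x₀) (h₁ : IsH i₁ x₁) (h₂ : IsH i₂ x₂) (h₃ : IsH i₃ x₃) :
    ev (m := 4) (fc2 R μ g₁ g₂ h) ![i₀, i₁, i₂, i₃] ![x₀, x₁, x₂, x₃]
      = sgn (s₂ * (i₀ + i₁)) • H2 μ (H2 g₁ x₀ x₁) (H2 g₂ x₂ x₃) := by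
  refine (ev_fc2 (a := 2) (b := 2) hM R h hμ ![i₀, i₁, i₂, i₃] ![x₀, x₁, x₂, x₃]).trans ?_
  rw [ev_eq_hat hL hg₁ (fun j => by fin_cases j <;> assumption),
    ev_eq_hat hL hg₂ (fun j => by fin_cases j <;> assumption)]
  simp only [Fin.sum_univ_two, hat_two]
  rfl

theorem ev_fc_1_1_1 (hL : Bounded L) (hM : Bounded M) {R : ℤ} {μ : MMap M N 3 r}
    {g₁ : MMap L M 1 s₁} {g₂ : MMap L M 1 s₂} {g₃ : MMap L M 1 s₃}
    {h : r + (s₁ + s₂ + s₃) = R} (hμ : ZeroOn μ) (hg₁ : ZeroOn g₁) (hg₂ : ZeroOn g₂)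
    (hg₃ : ZeroOn g₃)
    {i₀ : ℤ} {x₀ : Tot L} {i₁ : ℤ} {x₁ : Tot L} {i₂ : ℤ} {x₂ : Tot L}
    (h₀ : IsH i₀ x₀) (h₁ : IsH i₁ x₁) (h₂ : IsH i₂ x₂) :
    ev (m := 3) (fc3 R μ g₁ g₂ g₃ h) ![i₀, i₁, i₂] ![x₀, x₁, x₂]
      = sgn (s₂ * i₀ + s₃ * (i₀ + i₁)) • H3 μ (H1 g₁ x₀) (H1 g₂ x₁) (H1 g₃ x₂) := by
  refine (ev_fc3 (a := 1) (b := 1) (c := 1) hM R h hμ ![i₀, i₁, i₂] ![x₀, x₁, x₂]).trans ?_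
  rw [ev_eq_hat hL hg₁ (fun j => by fin_cases j; assumption),
    ev_eq_hat hL hg₂ (fun j => by fin_cases j; assumption),
    ev_eq_hat hL hg₃ (fun j => by fin_cases j; assumption)]
  simp only [Fin.sum_univ_one, hat_one, hat_three]
  rfl

theorem ev_fc_2_1_1 (hL : Bounded L) (hM : Bounded M) {R : ℤ} {μ : MMap M N 3 r}
    {g₁ : MMap L M 2 s₁} {g₂ : MMap L M 1 s₂} {g₃ : MMap L M 1 s₃}
    {h : r + (s₁ + s₂ + s₃) = R} (hμ : ZeroOn μ) (hg₁ : ZeroOn g₁) (hg₂ : ZeroOn g₂)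
    (hg₃ : ZeroOn g₃)
    {i₀ : ℤ} {x₀ : Tot L} {i₁ : ℤ} {x₁ : Tot L} {i₂ : ℤ} {x₂ : Tot L} {i₃ : ℤ} {x₃ : Tot L}
    (h₀ : IsH i₀ x₀) (h₁ : IsH i₁ x₁) (h₂ : IsH i₂ x₂) (h₃ : IsH i₃ x₃) :
    ev (m := 4) (fc3 R μ g₁ g₂ g₃ h) ![i₀, i₁, i₂, i₃] ![x₀, x₁, x₂, x₃]
      = sgn (s₂ * (i₀ + i₁) + s₃ * ((i₀ + i₁) + i₂))
        • H3 μ (H2 g₁ x₀ x₁) (H1 g₂ x₂) (H1 g₃ x₃) := by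
  refine (ev_fc3 (a := 2) (b := 1) (c := 1) hM R h hμ ![i₀, i₁, i₂, i₃] ![x₀, x₁, x₂, x₃]).trans ?_
  rw [ev_eq_hat hL hg₁ (fun j => by fin_cases j <;> assumption),
    ev_eq_hat hL hg₂ (fun j => by fin_cases j; assumption),
    ev_eq_hat hL hg₃ (fun j => by fin_cases j; assumption)]
  simp only [Fin.sum_univ_one, Fin.sum_univ_two, hat_one, hat_two, hat_three]
  rfl

theorem ev_fc_1_2_1 (hL : Bounded L) (hM : Bounded M) {R : ℤ} {μ : MMap M N 3 r}
    {g₁ : MMap L M 1 s₁} {g₂ : MMap L M 2 s₂} {g₃ : MMap L M 1 s₃}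
    {h : r + (s₁ + s₂ + s₃) = R} (hμ : ZeroOn μ) (hg₁ : ZeroOn g₁) (hg₂ : ZeroOn g₂)
    (hg₃ : ZeroOn g₃)
    {i₀ : ℤ} {x₀ : Tot L} {i₁ : ℤ} {x₁ : Tot L} {i₂ : ℤ} {x₂ : Tot L} {i₃ : ℤ} {x₃ : Tot L}
    (h₀ : IsH i₀ x₀) (h₁ : IsH i₁ x₁) (h₂ : IsH i₂ x₂) (h₃ : IsH i₃ x₃) :
    ev (m := 4) (fc3 R μ g₁ g₂ g₃ h) ![i₀, i₁, i₂, i₃] ![x₀, x₁, x₂, x₃]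
      = sgn (s₂ * i₀ + s₃ * (i₀ + (i₁ + i₂))) • H3 μ (H1 g₁ x₀) (H2 g₂ x₁ x₂) (H1 g₃ x₃) := by
  refine (ev_fc3 (a := 1) (b := 2) (c := 1) hM R h hμ ![i₀, i₁, i₂, i₃] ![x₀, x₁, x₂, x₃]).trans ?_
  rw [ev_eq_hat hL hg₁ (fun j => by fin_cases j; assumption),
    ev_eq_hat hL hg₂ (fun j => by fin_cases j <;> assumption),
    ev_eq_hat hL hg₃ (fun j => by fin_cases j; assumption)]
  simp only [Fin.sum_univ_one, Fin.sum_univ_two, hat_one, hat_two, hat_three]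
  rfl

theorem ev_fc_1_1_2 (hL : Bounded L) (hM : Bounded M) {R : ℤ} {μ : MMap M N 3 r}
    {g₁ : MMap L M 1 s₁} {g₂ : MMap L M 1 s₂} {g₃ : MMap L M 2 s₃}
    {h : r + (s₁ + s₂ + s₃) = R} (hμ : ZeroOn μ) (hg₁ : ZeroOn g₁) (hg₂ : ZeroOn g₂)
    (hg₃ : ZeroOn g₃)
    {i₀ : ℤ} {x₀ : Tot L} {i₁ : ℤ} {x₁ : Tot L} {i₂ : ℤ} {x₂ : Tot L} {i₃ : ℤ} {x₃ : Tot L}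
    (h₀ : IsH i₀ x₀) (h₁ : IsH i₁ x₁) (h₂ : IsH i₂ x₂) (h₃ : IsH i₃ x₃) :
    ev (m := 4) (fc3 R μ g₁ g₂ g₃ h) ![i₀, i₁, i₂, i₃] ![x₀, x₁, x₂, x₃]
      = sgn (s₂ * i₀ + s₃ * (i₀ + i₁)) • H3 μ (H1 g₁ x₀) (H1 g₂ x₁) (H2 g₃ x₂ x₃) := by
  refine (ev_fc3 (a := 1) (b := 1) (c := 2) hM R h hμ ![i₀, i₁, i₂, i₃] ![x₀, x₁, x₂, x₃]).trans ?_
  rw [ev_eq_hat hL hg₁ (fun j => by fin_cases j; assumption),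
    ev_eq_hat hL hg₂ (fun j => by fin_cases j; assumption),
    ev_eq_hat hL hg₃ (fun j => by fin_cases j <;> assumption)]
  simp only [Fin.sum_univ_one, hat_one, hat_two, hat_three]
  rfl

theorem ev_fc_1_1_1_1 (hL : Bounded L) (hM : Bounded M) {R : ℤ} {μ : MMap M N 4 r}
    {g₁ : MMap L M 1 s₁} {g₂ : MMap L M 1 s₂} {g₃ : MMap L M 1 s₃} {g₄ : MMap L M 1 s₄}
    {h : r + (s₁ + s₂ + s₃ + s₄) = R} (hμ : ZeroOn μ) (hg₁ : ZeroOn g₁) (hg₂ : ZeroOn g₂)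
    (hg₃ : ZeroOn g₃) (hg₄ : ZeroOn g₄)
    {i₀ : ℤ} {x₀ : Tot L} {i₁ : ℤ} {x₁ : Tot L} {i₂ : ℤ} {x₂ : Tot L} {i₃ : ℤ} {x₃ : Tot L}
    (h₀ : IsH i₀ x₀) (h₁ : IsH i₁ x₁) (h₂ : IsH i₂ x₂) (h₃ : IsH i₃ x₃) :
    ev (m := 4) (fc4 R μ g₁ g₂ g₃ g₄ h) ![i₀, i₁, i₂, i₃] ![x₀, x₁, x₂, x₃]
      = sgn (s₂ * i₀ + s₃ * (i₀ + i₁) + s₄ * (i₀ + i₁ + i₂))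
        • H4 μ (H1 g₁ x₀) (H1 g₂ x₁) (H1 g₃ x₂) (H1 g₄ x₃) := by
  refine (ev_fc4 (a := 1) (b := 1) (c := 1) (e := 1) hM R h hμ ![i₀, i₁, i₂, i₃]
    ![x₀, x₁, x₂, x₃]).trans ?_
  rw [ev_eq_hat hL hg₁ (fun j => by fin_cases j; assumption),
    ev_eq_hat hL hg₂ (fun j => by fin_cases j; assumption),
    ev_eq_hat hL hg₃ (fun j => by fin_cases j; assumption),
    ev_eq_hat hL hg₄ (fun j => by fin_cases j; assumption)]
  simp only [Fin.sum_univ_one, hat_one, hat_four]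
  rfl

end Shapes

section Multilinearity

set_option linter.unusedSectionVars false

variable {k : Type} [CommRing k] {L M N : ℤ → Type}
  [∀ i, AddCommGroup (L i)] [∀ i, Module k (L i)]
  [∀ i, AddCommGroup (M i)] [∀ i, Module k (M i)]
  [∀ i, AddCommGroup (N i)] [∀ i, Module k (N i)]

theorem IsMultilinear.zeroOn {m : ℕ} {r : ℤ} {μ : MMap L M m r} (hμ : IsMultilinear k μ) :
    ZeroOn μ := by
  intro d x j hx
  have h := (hμ d x j).2 0 0
  rw [zero_smul, zero_smul, ← hx, Function.update_eq_self] at h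
  exact h

theorem ev_update_add {m : ℕ} {r : ℤ} {μ : MMap L M m r} (hμ : IsMultilinear k μ)
    (d : Fin m → ℤ) (v : Fin m → Tot L) (j : Fin m) (a b : Tot L) :
    ev μ d (Function.update v j (a + b))
      = ev μ d (Function.update v j a) + ev μ d (Function.update v j b) := by
  have key : ∀ y : Tot L, (fun i => Function.update v j y i (d i))
      = Function.update (fun i => v i (d i)) j (y (d j)) := fun y => funext fun i =>
    Function.apply_update (fun i (z : Tot L) => z (d i)) v j y i
  simp only [ev, key, Pi.add_apply, (hμ d _ j).1, Pi.single_add]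

theorem ev_update_smul {m : ℕ} {r : ℤ} {μ : MMap L M m r} (hμ : IsMultilinear k μ)
    (d : Fin m → ℤ) (v : Fin m → Tot L) (j : Fin m) (c : k) (a : Tot L) :
    ev μ d (Function.update v j (c • a)) = c • ev μ d (Function.update v j a) := by
  have key : ∀ y : Tot L, (fun i => Function.update v j y i (d i))
      = Function.update (fun i => v i (d i)) j (y (d j)) := fun y => funext fun i =>
    Function.apply_update (fun i (z : Tot L) => z (d i)) v j y i
  simp only [ev, key, Pi.smul_apply, (hμ d _ j).2]
  exact map_smul (LinearMap.single k M _) c _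

theorem hat_update_add {m : ℕ} {r : ℤ} {μ : MMap L M m r} (hμ : IsMultilinear k μ)
    (v : Fin m → Tot L) (j : Fin m) (a b : Tot L) :
    hat μ (Function.update v j (a + b))
      = hat μ (Function.update v j a) + hat μ (Function.update v j b) := by
  simp only [hat, ev_update_add hμ, Finset.sum_add_distrib]

theorem hat_update_smul {m : ℕ} {r : ℤ} {μ : MMap L M m r} (hμ : IsMultilinear k μ)
    (v : Fin m → Tot L) (j : Fin m) (c : k) (a : Tot L) :
    hat μ (Function.update v j (c • a)) = c • hat μ (Function.update v j a) := by
  simp only [hat, ev_update_smul hμ, Finset.smul_sum]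

/-- The linear map underlying a multilinear map of arity one. -/
noncomputable def toLin1 {r : ℤ} {μ : MMap L M 1 r} (hμ : IsMultilinear k μ) :
    Tot L →ₗ[k] Tot M where
  toFun := H1 μ
  map_add' a b := by
    have h := hat_update_add hμ ![a] 0 a b
    simpa only [hat_one, Function.update_self] using h
  map_smul' c a := by
    have h := hat_update_smul hμ ![a] 0 c a
    simpa only [hat_one, Function.update_self, RingHom.id_apply] using h

/-- The bilinear map underlying a multilinear map of arity two. -/
noncomputable def toLin2 {r : ℤ} {μ : MMap L M 2 r} (hμ : IsMultilinear k μ) :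
    Tot L →ₗ[k] Tot L →ₗ[k] Tot M :=
  LinearMap.mk₂ k (H2 μ)
    (fun a a' b => by
      have h := hat_update_add hμ ![a, b] 0 a a'
      simpa [hat_two] using h)
    (fun c a b => by
      have h := hat_update_smul hμ ![a, b] 0 c a
      simpa [hat_two] using h)
    (fun a b b' => by
      have h := hat_update_add hμ ![a, b] 1 b b'
      simpa [hat_two] using h)
    (fun c a b => by
      have h := hat_update_smul hμ ![a, b] 1 c b
      simpa [hat_two] using h)

/-- The trilinear map underlying a multilinear map of arity three. -/
noncomputable def toLin3 {r : ℤ} {μ : MMap L M 3 r} (hμ : IsMultilinear k μ) :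
    Tot L →ₗ[k] Tot L →ₗ[k] Tot L →ₗ[k] Tot M :=
  LinearMap.mk₂ k
    (fun a b =>
      { toFun := H3 μ a b
        map_add' := fun c c' => by
          have h := hat_update_add hμ ![a, b, c] 2 c c'
          simpa [hat_three] using h
        map_smul' := fun t c => by
          have h := hat_update_smul hμ ![a, b, c] 2 t c
          simpa [hat_three] using h })
    (fun a a' b => by
      ext1 c
      have h := hat_update_add hμ ![a, b, c] 0 a a'
      simpa [hat_three] using h)
    (fun t a b => by
      ext1 c
      have h := hat_update_smul hμ ![a, b, c] 0 t a
      simpa [hat_three] using h)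
    (fun a b b' => by
      ext1 c
      have h := hat_update_add hμ ![a, b, c] 1 b b'
      simpa [hat_three] using h)
    (fun t a b => by
      ext1 c
      have h := hat_update_smul hμ ![a, b, c] 1 t b
      simpa [hat_three] using h)

theorem toLin1_apply {r : ℤ} {μ : MMap L M 1 r} (hμ : IsMultilinear k μ) (a : Tot L) :
    toLin1 hμ a = H1 μ a := rfl

theorem toLin2_apply {r : ℤ} {μ : MMap L M 2 r} (hμ : IsMultilinear k μ) (a b : Tot L) :
    toLin2 hμ a b = H2 μ a b := rfl

theorem toLin3_apply {r : ℤ} {μ : MMap L M 3 r} (hμ : IsMultilinear k μ) (a b c : Tot L) :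
    toLin3 hμ a b c = H3 μ a b c := rfl

/-! ### Closure properties -/

theorem IsMultilinear.add {m : ℕ} {r : ℤ} {μ ν : MMap L M m r} (hμ : IsMultilinear k μ)
    (hν : IsMultilinear k ν) : IsMultilinear k (μ + ν) := fun d x j =>
  ⟨fun a b => by simp only [Pi.add_apply, (hμ d x j).1, (hν d x j).1]; abel,
   fun c a => by simp only [Pi.add_apply, (hμ d x j).2, (hν d x j).2, smul_add]⟩

theorem IsMultilinear.smul {m : ℕ} {r : ℤ} {μ : MMap L M m r} (hμ : IsMultilinear k μ) (t : k) :
    IsMultilinear k (t • μ) := fun d x j =>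
  ⟨fun a b => by simp only [Pi.smul_apply, (hμ d x j).1, smul_add],
   fun c a => by simp only [Pi.smul_apply, (hμ d x j).2, smul_comm t c]⟩

theorem IsMultilinear.zsmul {m : ℕ} {r : ℤ} {μ : MMap L M m r} (hμ : IsMultilinear k μ)
    (t : ℤ) : IsMultilinear k (t • μ) := fun d x j =>
  ⟨fun a b => by simp only [Pi.smul_apply, (hμ d x j).1, smul_add],
   fun c a => by simp only [Pi.smul_apply, (hμ d x j).2, smul_comm t c]⟩

theorem IsMultilinear.neg {m : ℕ} {r : ℤ} {μ : MMap L M m r} (hμ : IsMultilinear k μ) :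
    IsMultilinear k (-μ) := by
  simpa using hμ.zsmul (-1)

theorem IsMultilinear.sub {m : ℕ} {r : ℤ} {μ ν : MMap L M m r} (hμ : IsMultilinear k μ)
    (hν : IsMultilinear k ν) : IsMultilinear k (μ - ν) := by
  rw [sub_eq_add_neg]; exact hμ.add hν.neg

theorem IsMultilinear.sum {ι : Type} (s : Finset ι) {m : ℕ} {r : ℤ} {μ : ι → MMap L M m r}
    (hμ : ∀ i, IsMultilinear k (μ i)) : IsMultilinear k (∑ i ∈ s, μ i) := by
  classical
  induction s using Finset.induction_on with
  | empty => intro d x j; simp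
  | insert a s ha ih => rw [Finset.sum_insert ha]; exact (hμ a).add ih

/-- An operation on tuples of elements of the total module that is linear in each slot. -/
def SlotLinear (k : Type) [CommRing k] {L M : ℤ → Type} [∀ i, AddCommGroup (L i)]
    [∀ i, AddCommGroup (M i)] [∀ i, Module k (L i)] [∀ i, Module k (M i)] {m : ℕ}
    (F : (Fin m → Tot L) → Tot M) : Prop :=
  ∀ v j, (∀ a b, F (Function.update v j (a + b))
      = F (Function.update v j a) + F (Function.update v j b)) ∧
    ∀ (c : k) a, F (Function.update v j (c • a)) = c • F (Function.update v j a)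

theorem isMultilinear_of_ev {m : ℕ} {r : ℤ} {μ : MMap L M m r}
    (h : ∀ d, ∃ F : (Fin m → Tot L) → Tot M, SlotLinear k F ∧
      ∀ v, (∀ j, IsH (d j) (v j)) → ev μ d v = F v) : IsMultilinear k μ := by
  intro d x j
  obtain ⟨F, hF, hev⟩ := h d
  have key : ∀ y : L (d j), Pi.single (r + ∑ j, d j) (μ d (Function.update x j y))
      = F (Function.update (fun i => Pi.single (d i) (x i)) j (Pi.single (d j) y)) := by
    intro y
    have hu : Function.update (fun i => (Pi.single (d i) (x i) : Tot L)) j (Pi.single (d j) y)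
        = fun i => Pi.single (d i) (Function.update x j y i) := by
      funext i
      exact (Function.apply_update (fun i (z : L (d i)) => (Pi.single (d i) z : Tot L)) x j y
        i).symm
    rw [hu, ← hev _ (fun i => isH_single _ _)]
    simp [ev]
  constructor
  · intro a b
    apply Pi.single_injective (M := M) (r + ∑ j, d j)
    rw [Pi.single_add, key, key, key, Pi.single_add, (hF _ _).1]
  · intro c a
    apply Pi.single_injective (M := M) (r + ∑ j, d j)
    have h1 := map_smul (LinearMap.single k L (d j)) c a
    have h2 := map_smul (LinearMap.single k M (r + ∑ j, d j)) c (μ d (Function.update x j a))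
    simp only [LinearMap.coe_single] at h1 h2
    rw [h2, key, key, h1, (hF _ _).2]

theorem IsMultilinear.pa (hL : Bounded L) {m : ℕ} {r : ℤ} {μ : MMap L M m r}
    (hμ : IsMultilinear k μ) (σ : Equiv.Perm (Fin m)) : IsMultilinear k (pa σ μ) := by
  refine isMultilinear_of_ev fun d => ⟨fun v => koszulSign d σ • hat μ (v ∘ σ.symm), ?_, ?_⟩
  · intro v j
    simp only [Function.update_comp_equiv, hat_update_add hμ, hat_update_smul hμ, smul_add,
      Equiv.symm_symm, true_and, implies_true]
    exact fun c a => smul_comm _ _ _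
  · intro v hv
    rw [ev_pa, ev_eq_hat hL hμ.zeroOn (fun j => hv _)]
    rfl
end Multilinearity

/-! ### Alternating sums of functions of three and four variables -/

section Alternation

variable {X W : Type} [AddCommGroup W]

/-- Alternating sum over the permutations of three arguments. -/
def alt3 (g : X → X → X → W) (a b c : X) : W :=
  g a b c - g b a c - g a c b + g b c a + g c a b - g c b a

/-- Alternating sum over the permutations of four arguments. -/
def alt4 (g : X → X → X → X → W) (a b c e : X) : W :=
  alt3 (g a) b c e - alt3 (g b) a c e + alt3 (g c) a b e - alt3 (g e) a b c

variable (g g' : X → X → X → X → W) (a b c e : X)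

theorem alt4_congr (P : X → Prop) (h : ∀ a b c e, P a → P b → P c → P e → g a b c e = g' a b c e)
    (ha : P a) (hb : P b) (hc : P c) (he : P e) : alt4 g a b c e = alt4 g' a b c e := by
  simp only [alt4, alt3, h, ha, hb, hc, he]

theorem alt4_add : alt4 (fun a b c e => g a b c e + g' a b c e) a b c e
    = alt4 g a b c e + alt4 g' a b c e := by
  simp only [alt4, alt3]; abel

theorem alt4_sub : alt4 (fun a b c e => g a b c e - g' a b c e) a b c e
    = alt4 g a b c e - alt4 g' a b c e := by
  simp only [alt4, alt3]; abel

theorem alt4_zsmul (n : ℤ) : alt4 (fun a b c e => n • g a b c e) a b c e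
    = n • alt4 g a b c e := by
  simp only [alt4, alt3, smul_sub, smul_add]

theorem alt4_bace : alt4 (fun a b c e => g b a c e) a b c e = - alt4 g a b c e := by
  simp only [alt4, alt3]; abel

theorem alt4_acbe : alt4 (fun a b c e => g a c b e) a b c e = - alt4 g a b c e := by
  simp only [alt4, alt3]; abel

theorem alt4_bcae : alt4 (fun a b c e => g b c a e) a b c e = alt4 g a b c e := by
  simp only [alt4, alt3]; abel

theorem alt4_cabe : alt4 (fun a b c e => g c a b e) a b c e = alt4 g a b c e := by
  simp only [alt4, alt3]; abel

theorem alt4_eabc : alt4 (fun a b c e => g e a b c) a b c e = - alt4 g a b c e := by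
  simp only [alt4, alt3]; abel

theorem alt4_bcea : alt4 (fun a b c e => g b c e a) a b c e = - alt4 g a b c e := by
  simp only [alt4, alt3]; abel

theorem alt4_aebc : alt4 (fun a b c e => g a e b c) a b c e = alt4 g a b c e := by
  simp only [alt4, alt3]; abel

theorem alt4_aceb : alt4 (fun a b c e => g a c e b) a b c e = alt4 g a b c e := by
  simp only [alt4, alt3]; abel

end Alternation

section Shuffle

variable {k : Type} [CommRing k] {X U W : Type} [AddCommGroup U] [Module k U] [AddCommGroup W]
  [Module k W]

/-- Antisymmetrization of a function of two variables. -/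
def alt2 (g : X → X → W) (a b : X) : W := g a b - g b a

theorem map_alt3 (T : U →ₗ[k] W) (q : X → X → X → U) (a b c : X) :
    T (alt3 q a b c) = alt3 (fun a b c => T (q a b c)) a b c := by
  simp only [alt3, map_sub, map_add]

theorem map_alt4 (T : U →ₗ[k] W) (q : X → X → X → X → U) (a b c e : X) :
    T (alt4 q a b c e) = alt4 (fun a b c e => T (q a b c e)) a b c e := by
  simp only [alt4, map_sub, map_add, map_alt3]

/-- The signed sum over `(3,1)`-shuffles of alternating sums is an alternating sum. -/
theorem shuffle_three_one (T : U →ₗ[k] U →ₗ[k] W) (ι : X → U) (q : X → X → X → U)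
    (a b c e : X) :
    alt2 (fun x y => T x y) (alt3 q a b c) (ι e) + alt2 (fun x y => T x y) (ι a) (alt3 q b c e)
      - alt2 (fun x y => T x y) (ι b) (alt3 q a c e)
      + alt2 (fun x y => T x y) (ι c) (alt3 q a b e)
    = alt4 (fun a b c e => T (q a b c) (ι e)) a b c e
      + alt4 (fun a b c e => T (ι a) (q b c e)) a b c e := by
  simp only [alt4, alt3, alt2, map_sub, map_add, LinearMap.sub_apply, LinearMap.add_apply]
  abel

/-- The signed sum over `(2,2)`-shuffles of a symmetrized product of antisymmetric factors. -/
theorem shuffle_two_two (T : U →ₗ[k] U →ₗ[k] W) (q : X → X → U) (a b c e : X) :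
    (T (alt2 q a b) (alt2 q c e) + T (alt2 q c e) (alt2 q a b))
      - (T (alt2 q a c) (alt2 q b e) + T (alt2 q b e) (alt2 q a c))
      + (T (alt2 q b c) (alt2 q a e) + T (alt2 q a e) (alt2 q b c))
    = alt4 (fun a b c e => T (q a b) (q c e)) a b c e := by
  simp only [alt4, alt3, alt2, map_sub, LinearMap.sub_apply]
  abel

/-- The signed sum over `(2,1,1)`-shuffles of alternating sums is an alternating sum. -/
theorem shuffle_two_one_one (T : U → U → U → W)
    (h₁ : ∀ x x' y z, T (x - x') y z = T x y z - T x' y z)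
    (h₂ : ∀ x y y' z, T x (y - y') z = T x y z - T x y' z)
    (h₃ : ∀ x y z z', T x y (z - z') = T x y z - T x y z')
    (ι : X → U) (q : X → X → U) (a b c e : X) :
    alt3 T (alt2 q a b) (ι c) (ι e) - alt3 T (ι a) (alt2 q b c) (ι e)
      + alt3 T (ι b) (alt2 q a c) (ι e) + alt3 T (ι a) (ι b) (alt2 q c e)
      - alt3 T (ι a) (ι c) (alt2 q b e) + alt3 T (ι b) (ι c) (alt2 q a e)
    = alt4 (fun a b c e => T (q a b) (ι c) (ι e)) a b c e
      - alt4 (fun a b c e => T (ι a) (q b c) (ι e)) a b c e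
      + alt4 (fun a b c e => T (ι a) (ι b) (q c e)) a b c e := by
  simp only [alt4, alt3, alt2, h₁, h₂, h₃]
  abel

end Shuffle

section Pre

variable {U W : Type} [AddCommGroup U] [AddCommGroup W]

/-- The function whose alternating sum is `24` times the skew-symmetrized ternary map. -/
def pre3 (l₂ : U → U → U) (l₃ : U → U → U → U) (l₂₁ : U → U → U) (x y z : U) : U :=
  (4 : ℤ) • l₃ x y z - l₂₁ (l₂ x y) z - l₂₁ x (l₂ y z)

/-- The function whose alternating sum is `48` times the skew-symmetrized quaternary map. -/
def pre4 (l₂ : U → U → U) (l₃ : U → U → U → U) (l₄ : U → U → U → U → U) (l₂₁ : U → U → U)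
    (l₃₁ l₃₂ : U → U → U → U) (x y z w : U) : U :=
  (2 : ℤ) • l₄ x y z w + l₂₁ (l₃ x y z) w - l₃₁ (l₂ x y) z w + l₃₂ x (l₂ y z) w
    - l₂₁ x (l₃ y z w) - l₃₁ x (l₂ y z) w + l₃₂ x y (l₂ z w)

end Pre

/-! ### The quaternary relation for morphisms, on elements of degree zero -/

section Quaternary

variable {k : Type} [CommRing k] {V W : Type} [AddCommGroup V] [Module k V] [AddCommGroup W]
  [Module k W]

/-- The function whose alternating sum is `24` times the skew-symmetrized third component of a
weak morphism. -/
def preMor3 (l₂ : V → V → V) (f₁ : V → W) (f₂ f₂₁ : V → V → W) (f₃ : V → V → V → W)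
    (b₂₁ : W → W → W) (x y z : V) : W :=
  (4 : ℤ) • f₃ x y z - f₂₁ (l₂ x y) z - f₂₁ x (l₂ y z) + b₂₁ (f₂ x y) (f₁ z)
    + b₂₁ (f₁ x) (f₂ y z)

theorem quaternary_relation (P : V → Prop) (F1 : V →ₗ[k] W) (F2 F21 : V →ₗ[k] V →ₗ[k] W)
    (F3 : V →ₗ[k] V →ₗ[k] V →ₗ[k] W) (L2 L21 : V →ₗ[k] V →ₗ[k] V)
    (L3 L31 L32 : V →ₗ[k] V →ₗ[k] V →ₗ[k] V) (L4 : V → V → V → V → V)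
    (B2 B21 : W →ₗ[k] W →ₗ[k] W) (B3 B31 B32 : W →ₗ[k] W →ₗ[k] W →ₗ[k] W)
    (B4 : W → W → W → W → W)
    (l2 : V → V → V) (hl2 : l2 = alt2 fun x y => L2 x y)
    (l3 : V → V → V → V)
    (hl3 : l3 = alt3 (pre3 (fun x y => L2 x y) (fun x y z => L3 x y z) fun x y => L21 x y))
    (l4 : V → V → V → V → V)
    (hl4 : l4 = alt4 (pre4 (fun x y => L2 x y) (fun x y z => L3 x y z) L4 (fun x y => L21 x y)
      (fun x y z => L31 x y z) fun x y z => L32 x y z))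
    (b2 : W → W → W) (hb2 : b2 = alt2 fun x y => B2 x y)
    (b3 : W → W → W → W)
    (hb3 : b3 = alt3 (pre3 (fun x y => B2 x y) (fun x y z => B3 x y z) fun x y => B21 x y))
    (b4 : W → W → W → W → W)
    (hb4 : b4 = alt4 (pre4 (fun x y => B2 x y) (fun x y z => B3 x y z) B4 (fun x y => B21 x y)
      (fun x y z => B31 x y z) fun x y z => B32 x y z))
    (f2 : V → V → W) (hf2 : f2 = alt2 fun x y => F2 x y)
    (f3 : V → V → V → W)
    (hf3 : f3 = alt3 (preMor3 (fun x y => L2 x y) F1 (fun x y => F2 x y) (fun x y => F21 x y)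
      (fun x y z => F3 x y z) fun x y => B21 x y))
    (h : ∀ a b c e, P a → P b → P c → P e → F1 (L4 a b c e) + F2 b (L3 a c e) + F3 (L2 a b) c e
      + F3 b (L2 a c) e + F3 a b (L2 c e) + F3 b c (L2 a e) + B2 (F1 b) (F3 a c e) + B2 (F2 a b)
      (F2 c e) + B2 (F2 b c) (F2 a e) + B3 (F1 a) (F2 b c) (F1 e) + B3 (F1 a) (F1 c) (F2 b e) = B4
      (F1 a) (F1 b) (F1 c) (F1 e) + F2 (L3 a b c) e + F2 a (L3 b c e) + F2 c (L3 a b e) + F3 a (L2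
      b c) e + F3 a c (L2 b e) + B2 (F3 a b c) (F1 e) + B2 (F1 a) (F3 b c e) + B2 (F1 c) (F3 a b
      e) + B2 (F2 a c) (F2 b e) + B3 (F2 a b) (F1 c) (F1 e) + B3 (F1 b) (F2 a c) (F1 e) + B3 (F1
      a) (F1 b) (F2 c e) + B3 (F1 b) (F1 c) (F2 a e))
    (h₅₁ : ∀ a b c e, P a → P b → P c → P e → F21 (L2 a (L2 b c)) e + F1 (L21 (L3 a b c) e) =
      F21 (L2 (L2 a b) c) e + F21 (L2 b (L2 a c)) e + F2 (L3 a b c) e + F2 e (L3 a b c) + B21 (F1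
      (L3 a b c)) (F1 e))
    (h₅₂ : ∀ a b c e, P a → P b → P c → P e → F21 a (L2 b (L2 c e)) + F1 (L21 a (L3 b c e)) =
      F21 a (L2 (L2 b c) e) + F21 a (L2 c (L2 b e)) + F2 (L3 b c e) a + F2 a (L3 b c e) + B21 (F1
      a) (F1 (L3 b c e)))
    (h₇₁ : ∀ a b c e, P a → P b → P c → P e → F1 (L31 (L2 a b) c e) = B31 (F1 (L2 a b)) (F1 c)
      (F1 e) + F3 (L2 a b) c e + F3 c (L2 a b) e + F2 (L21 (L2 a b) c) e + B2 (F21 (L2 a b) c) (F1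
      e))
    (h₇₂ : ∀ a b c e, P a → P b → P c → P e → F1 (L31 a (L2 b c) e) = B31 (F1 a) (F1 (L2 b c))
      (F1 e) + F3 a (L2 b c) e + F3 (L2 b c) a e + F2 (L21 a (L2 b c)) e + B2 (F21 a (L2 b c)) (F1
      e))
    (h₈₁ : ∀ a b c e, P a → P b → P c → P e → F1 (L32 a (L2 b c) e) + F2 a (L21 (L2 b c) e) + B2
      (F1 a) (F21 (L2 b c) e) + B21 (F2 a (L2 b c)) (F1 e) + B21 (F1 (L2 b c)) (F2 a e) = B32 (F1
      a) (F1 (L2 b c)) (F1 e) + F3 a (L2 b c) e + F3 a e (L2 b c) + F21 (L2 a (L2 b c)) e + F21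
      (L2 b c) (L2 a e))
    (h₈₂ : ∀ a b c e, P a → P b → P c → P e → F1 (L32 a b (L2 c e)) + F2 a (L21 b (L2 c e)) + B2
      (F1 a) (F21 b (L2 c e)) + B21 (F2 a b) (F1 (L2 c e)) + B21 (F1 b) (F2 a (L2 c e)) = B32 (F1
      a) (F1 b) (F1 (L2 c e)) + F3 a b (L2 c e) + F3 a (L2 c e) b + F21 (L2 a b) (L2 c e) + F21 b
      (L2 a (L2 c e)))
    (k₁₁ : ∀ a b c e, P a → P b → P c → P e → B21 (F1 (L3 a b c)) (F1 e) + B21 (F2 (L2 a b) c)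
      (F1 e) + B21 (F2 b (L2 a c)) (F1 e) + B21 (B2 (F2 a b) (F1 c)) (F1 e) + B21 (B2 (F1 b) (F2 a
      c)) (F1 e) = B21 (F2 a (L2 b c)) (F1 e) + B21 (B3 (F1 a) (F1 b) (F1 c)) (F1 e) + B21 (B2 (F1
      a) (F2 b c)) (F1 e) + B2 (F3 a b c) (F1 e) + B2 (F1 e) (F3 a b c))
    (k₁₂ : ∀ a b c e, P a → P b → P c → P e → B21 (F1 a) (F1 (L3 b c e)) + B21 (F1 a) (F2 (L2 b
      c) e) + B21 (F1 a) (F2 c (L2 b e)) + B21 (F1 a) (B2 (F2 b c) (F1 e)) + B21 (F1 a) (B2 (F1 c)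
      (F2 b e)) = B21 (F1 a) (F2 b (L2 c e)) + B21 (F1 a) (B3 (F1 b) (F1 c) (F1 e)) + B21 (F1 a)
      (B2 (F1 b) (F2 c e)) + B2 (F3 b c e) (F1 a) + B2 (F1 a) (F3 b c e))
    (k₃₁ : ∀ a b c e, P a → P b → P c → P e → B31 (F1 (L2 a b)) (F1 c) (F1 e) + B3 (F2 a b) (F1
      c) (F1 e) + B3 (F1 c) (F2 a b) (F1 e) + B2 (B21 (F2 a b) (F1 c)) (F1 e) = B31 (B2 (F1 a) (F1
      b)) (F1 c) (F1 e))
    (k₃₂ : ∀ a b c e, P a → P b → P c → P e → B31 (F1 a) (F1 (L2 b c)) (F1 e) + B3 (F2 b c) (F1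
      a) (F1 e) + B3 (F1 a) (F2 b c) (F1 e) + B2 (B21 (F1 a) (F2 b c)) (F1 e) = B31 (F1 a) (B2 (F1
      b) (F1 c)) (F1 e))
    (k₄₁ : ∀ a b c e, P a → P b → P c → P e → B32 (F1 a) (F1 (L2 b c)) (F1 e) + B3 (F1 a) (F2 b
      c) (F1 e) + B3 (F1 a) (F1 e) (F2 b c) + B21 (B2 (F1 a) (F2 b c)) (F1 e) + B21 (F2 b c) (B2
      (F1 a) (F1 e)) = B32 (F1 a) (B2 (F1 b) (F1 c)) (F1 e) + B2 (F1 a) (B21 (F2 b c) (F1 e)))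
    (k₄₂ : ∀ a b c e, P a → P b → P c → P e → B32 (F1 a) (F1 b) (F1 (L2 c e)) + B3 (F1 a) (F2 c
      e) (F1 b) + B3 (F1 a) (F1 b) (F2 c e) + B21 (B2 (F1 a) (F1 b)) (F2 c e) + B21 (F1 b) (B2 (F1
      a) (F2 c e)) = B32 (F1 a) (F1 b) (B2 (F1 c) (F1 e)) + B2 (F1 a) (B21 (F1 b) (F2 c e)))
    {a b c e : V} (ha : P a) (hb : P b) (hc : P c) (he : P e) :
    F1 (l4 a b c e) - b4 (F1 a) (F1 b) (F1 c) (F1 e)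
      = (f2 (l3 a b c) e + f2 a (l3 b c e) - f2 b (l3 a c e) + f2 c (l3 a b e))
        - (f3 (l2 a b) c e - f3 a (l2 b c) e + f3 b (l2 a c) e + f3 a b (l2 c e)
          - f3 a c (l2 b e) + f3 b c (l2 a e))
        + (b2 (f3 a b c) (F1 e) + b2 (F1 a) (f3 b c e) - b2 (F1 b) (f3 a c e)
          + b2 (F1 c) (f3 a b e))
        - (6 : ℤ) • ((B2 (f2 a b) (f2 c e) + B2 (f2 c e) (f2 a b))
          - (B2 (f2 a c) (f2 b e) + B2 (f2 b e) (f2 a c))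
          + (B2 (f2 b c) (f2 a e) + B2 (f2 a e) (f2 b c)))
        + (b3 (f2 a b) (F1 c) (F1 e) - b3 (F1 a) (f2 b c) (F1 e) + b3 (F1 b) (f2 a c) (F1 e)
          + b3 (F1 a) (F1 b) (f2 c e) - b3 (F1 a) (F1 c) (f2 b e)
          + b3 (F1 b) (F1 c) (f2 a e)) := by
  have h' := alt4_congr _ _ a b c e P h ha hb hc he
  simp only [alt4_add,
    alt4_bace fun a b c e => F2 a (L3 b c e),
    alt4_cabe fun a b c e => F2 a (L3 b c e),
    alt4_bace fun a b c e => F3 a (L2 b c) e,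
    alt4_acbe fun a b c e => F3 a b (L2 c e),
    alt4_bcae fun a b c e => F3 a b (L2 c e),
    alt4_bace fun a b c e => B2 (F1 a) (F3 b c e),
    alt4_cabe fun a b c e => B2 (F1 a) (F3 b c e),
    alt4_acbe fun a b c e => B2 (F2 a b) (F2 c e),
    alt4_bcae fun a b c e => B2 (F2 a b) (F2 c e),
    alt4_bace fun a b c e => B3 (F1 a) (F2 b c) (F1 e),
    alt4_acbe fun a b c e => B3 (F1 a) (F1 b) (F2 c e),
    alt4_bcae fun a b c e => B3 (F1 a) (F1 b) (F2 c e)] at h'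
  have h₅₁' := alt4_congr _ _ a b c e P h₅₁ ha hb hc he
  simp only [alt4_add,
    alt4_bace fun a b c e => F21 (L2 a (L2 b c)) e,
    alt4_eabc fun a b c e => F2 a (L3 b c e)] at h₅₁'
  have h₅₂' := alt4_congr _ _ a b c e P h₅₂ ha hb hc he
  simp only [alt4_add,
    alt4_acbe fun a b c e => F21 a (L2 b (L2 c e)),
    alt4_bcea fun a b c e => F2 (L3 a b c) e] at h₅₂'
  have h₇₁' := alt4_congr _ _ a b c e P h₇₁ ha hb hc he
  simp only [alt4_add, alt4_cabe fun a b c e => F3 a (L2 b c) e] at h₇₁'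
  have h₇₂' := alt4_congr _ _ a b c e P h₇₂ ha hb hc he
  simp only [alt4_add, alt4_bcae fun a b c e => F3 (L2 a b) c e] at h₇₂'
  have h₈₁' := alt4_congr _ _ a b c e P h₈₁ ha hb hc he
  simp only [alt4_add,
    alt4_aebc fun a b c e => F3 a b (L2 c e),
    alt4_bcae fun a b c e => F21 (L2 a b) (L2 c e),
    alt4_bcae fun a b c e => B21 (F1 (L2 a b)) (F2 c e)] at h₈₁'
  have h₈₂' := alt4_congr _ _ a b c e P h₈₂ ha hb hc he
  simp only [alt4_add,
    alt4_aceb fun a b c e => F3 a (L2 b c) e,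
    alt4_bace fun a b c e => F21 a (L2 b (L2 c e)),
    alt4_bace fun a b c e => B21 (F1 a) (F2 b (L2 c e))] at h₈₂'
  have k₁₁' := alt4_congr _ _ a b c e P k₁₁ ha hb hc he
  simp only [alt4_add,
    alt4_bace fun a b c e => B21 (F2 a (L2 b c)) (F1 e),
    alt4_bace fun a b c e => B21 (B2 (F1 a) (F2 b c)) (F1 e),
    alt4_eabc fun a b c e => B2 (F1 a) (F3 b c e)] at k₁₁'
  have k₁₂' := alt4_congr _ _ a b c e P k₁₂ ha hb hc he
  simp only [alt4_add,
    alt4_acbe fun a b c e => B21 (F1 a) (F2 b (L2 c e)),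
    alt4_acbe fun a b c e => B21 (F1 a) (B2 (F1 b) (F2 c e)),
    alt4_bcea fun a b c e => B2 (F3 a b c) (F1 e)] at k₁₂'
  have k₃₁' := alt4_congr _ _ a b c e P k₃₁ ha hb hc he
  simp only [alt4_add, alt4_cabe fun a b c e => B3 (F1 a) (F2 b c) (F1 e)] at k₃₁'
  have k₃₂' := alt4_congr _ _ a b c e P k₃₂ ha hb hc he
  simp only [alt4_add, alt4_bcae fun a b c e => B3 (F2 a b) (F1 c) (F1 e)] at k₃₂'
  have k₄₁' := alt4_congr _ _ a b c e P k₄₁ ha hb hc he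
  simp only [alt4_add,
    alt4_aebc fun a b c e => B3 (F1 a) (F1 b) (F2 c e),
    alt4_bcae fun a b c e => B21 (F2 a b) (B2 (F1 c) (F1 e))] at k₄₁'
  have k₄₂' := alt4_congr _ _ a b c e P k₄₂ ha hb hc he
  simp only [alt4_add,
    alt4_aceb fun a b c e => B3 (F1 a) (F2 b c) (F1 e),
    alt4_bace fun a b c e => B21 (F1 a) (B2 (F1 b) (F2 c e))] at k₄₂'
  subst hl2 hl3 hl4 hb2 hb3 hb4 hf2 hf3
  have s₁ := shuffle_three_one F2 (fun x => x)
    (pre3 (fun x y => L2 x y) (fun x y z => L3 x y z) fun x y => L21 x y) a b c e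
  have s₂ := shuffle_two_one_one (preMor3 (fun x y => L2 x y) F1 (fun x y => F2 x y)
    (fun x y => F21 x y) (fun x y z => F3 x y z) fun x y => B21 x y)
    (by intros; simp only [preMor3, map_sub, LinearMap.sub_apply]; module)
    (by intros; simp only [preMor3, map_sub, LinearMap.sub_apply]; module)
    (by intros; simp only [preMor3, map_sub]; module)
    (fun x => x) (fun x y => L2 x y) a b c e
  have s₃ := shuffle_three_one B2 F1 (preMor3 (fun x y => L2 x y) F1 (fun x y => F2 x y)
    (fun x y => F21 x y) (fun x y z => F3 x y z) fun x y => B21 x y) a b c e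
  have s₄ := shuffle_two_two B2 (fun x y => F2 x y) a b c e
  have s₅ := shuffle_two_one_one
    (pre3 (fun x y => B2 x y) (fun x y z => B3 x y z) fun x y => B21 x y)
    (by intros; simp only [pre3, map_sub, LinearMap.sub_apply]; module)
    (by intros; simp only [pre3, map_sub, LinearMap.sub_apply]; module)
    (by intros; simp only [pre3, map_sub]; module)
    F1 (fun x y => F2 x y) a b c e
  have s₆ : alt4 (pre4 (fun x y => B2 x y) (fun x y z => B3 x y z) B4 (fun x y => B21 x y)
      (fun x y z => B31 x y z) fun x y z => B32 x y z) (F1 a) (F1 b) (F1 c) (F1 e)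
      = alt4 (fun a b c e => pre4 (fun x y => B2 x y) (fun x y z => B3 x y z) B4
        (fun x y => B21 x y) (fun x y z => B31 x y z) (fun x y z => B32 x y z)
        (F1 a) (F1 b) (F1 c) (F1 e)) a b c e := rfl
  rw [s₆, s₁, s₂, s₃, s₄, s₅, map_alt4]
  clear s₁ s₂ s₃ s₄ s₅ s₆
  simp only [pre3, pre4, preMor3, map_add, map_sub, map_zsmul, LinearMap.add_apply,
    LinearMap.sub_apply, LinearMap.smul_apply, alt4_add, alt4_sub, alt4_zsmul]
  linear_combination (norm := module) 2 • h' + h₅₁' + h₈₁' + h₈₂' + k₁₁' + k₄₁' + k₄₂' - h₅₂' - h₇₁'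
    - h₇₂'
    - k₁₂' - k₃₁' - k₃₂'

end Quaternary

/-! ### The ternary relation for morphisms, in total degree at most one -/

section Ternary

variable {k : Type} [CommRing k] {V W : Type} [AddCommGroup V] [Module k V] [AddCommGroup W]
  [Module k W]

theorem alt3_congr {X : Type} (g g' : X → X → X → W) (a b c : X) (P : X → X → X → Prop)
    (h : ∀ a b c, P a b c → g a b c = g' a b c) (h₁₂ : ∀ a b c, P a b c → P b a c)
    (h₂₃ : ∀ a b c, P a b c → P a c b) (hP : P a b c) : alt3 g a b c = alt3 g' a b c := by
  simp only [alt3]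
  rw [h a b c hP, h b a c (h₁₂ _ _ _ hP), h a c b (h₂₃ _ _ _ hP),
    h b c a (h₂₃ _ _ _ (h₁₂ _ _ _ hP)), h c a b (h₁₂ _ _ _ (h₂₃ _ _ _ hP)),
    h c b a (h₁₂ _ _ _ (h₂₃ _ _ _ (h₁₂ _ _ _ hP)))]

set_option maxHeartbeats 4000000 in
/-- Here `E` is the operator `x ↦ (-1)^|x| x` and `P` is the class of triples of nonnegative
degrees with sum at most one. -/
theorem ternary_relation (P : V → V → V → Prop) (DV E : V →ₗ[k] V) (DW : W →ₗ[k] W)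
    (F1 : V →ₗ[k] W) (F2 F21 : V →ₗ[k] V →ₗ[k] W)
    (F3 : V →ₗ[k] V →ₗ[k] V →ₗ[k] W) (L2 L21 : V →ₗ[k] V →ₗ[k] V)
    (L3 : V →ₗ[k] V →ₗ[k] V →ₗ[k] V)
    (B2 B21 : W →ₗ[k] W →ₗ[k] W) (B3 : W →ₗ[k] W →ₗ[k] W →ₗ[k] W)
    (l2 : V → V → V) (hl2 : l2 = alt2 fun x y => L2 x y)
    (l3 : V → V → V → V)
    (hl3 : l3 = alt3 (pre3 (fun x y => L2 x y) (fun x y z => L3 x y z) fun x y => L21 x y))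
    (b3 : W → W → W → W)
    (hb3 : b3 = alt3 (pre3 (fun x y => B2 x y) (fun x y z => B3 x y z) fun x y => B21 x y))
    (f2 : V → V → W) (hf2 : f2 = alt2 fun x y => F2 x y)
    (f3 : V → V → V → W)
    (hf3 : f3 = alt3 (preMor3 (fun x y => L2 x y) F1 (fun x y => F2 x y) (fun x y => F21 x y)
      (fun x y z => F3 x y z) fun x y => B21 x y))
    (f3' : V → V → V → W)
    (hf3' : f3' = alt3 fun x y z => (4 : ℤ) • F3 x y z - F21 (L2 x y) z - F21 x (L2 y z)
      + B21 (F2 x y) (F1 z) + B21 (F1 (E x)) (F2 y z))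
    (h₁₂ : ∀ a b c, P a b c → P b a c) (h₂₃ : ∀ a b c, P a b c → P a c b)
    (h₃ : ∀ a b c, P a b c → DW (F3 a b c) - F3 (DV a) b c - F3 a (DV b) c - F3 a b (DV c)
      = F1 (L3 a b c) - F2 a (L2 b c) + F2 (L2 a b) c + F2 b (L2 a c)
        - B3 (F1 a) (F1 b) (F1 c) - B2 (F1 (E a)) (F2 b c) + B2 (F2 a b) (F1 c)
        + B2 (F1 (E b)) (F2 a c))
    (h₅₁ : ∀ a b c, P a b c → DW (F21 (L2 a b) c) - F21 (L2 (DV a) b) c - F21 (L2 a (DV b)) c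
        - F21 (L2 a b) (DV c)
      = F1 (L21 (L2 a b) c) - F2 (L2 a b) c - F2 c (L2 a b) - B21 (F1 (L2 a b)) (F1 c))
    (h₅₂ : ∀ a b c, P a b c → DW (F21 a (L2 b c)) - F21 (DV a) (L2 b c) - F21 a (L2 (DV b) c)
        - F21 a (L2 b (DV c))
      = F1 (L21 a (L2 b c)) - F2 a (L2 b c) - F2 (L2 b c) a - B21 (F1 a) (F1 (L2 b c)))
    (k₁₁ : ∀ a b c, P a b c → DW (B21 (F2 a b) (F1 c)) + B21 (F1 (L2 a b)) (F1 c)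
        - B21 (B2 (F1 a) (F1 b)) (F1 c) - B21 (F2 (DV a) b) (F1 c) - B21 (F2 a (DV b)) (F1 c)
        - B21 (F2 a b) (F1 (DV c))
      = B2 (F2 a b) (F1 c) + B2 (F1 (E c)) (F2 a b))
    (k₁₂ : ∀ a b c, P a b c → DW (B21 (F1 (E a)) (F2 b c)) + B21 (F1 a) (F1 (L2 b c))
        - B21 (F1 a) (B2 (F1 b) (F1 c)) - B21 (F1 (DV a)) (F2 b c) - B21 (F1 a) (F2 (DV b) c)
        - B21 (F1 a) (F2 b (DV c))
      = B2 (F1 (E a)) (F2 b c) + B2 (F2 b c) (F1 a))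
    {a b c : V} (hP : P a b c) :
    DW (f3' a b c) - (f3 (DV a) b c + f3 a (DV b) c + f3 a b (DV c))
      = F1 (l3 a b c) - (6 : ℤ) • (f2 a (l2 b c) - f2 (l2 a b) c - f2 b (l2 a c))
        - b3 (F1 a) (F1 b) (F1 c)
        - (6 : ℤ) • ((B2 (F1 (E a)) (f2 b c) - B2 (f2 b c) (F1 a))
          - (B2 (f2 a b) (F1 c) - B2 (F1 (E c)) (f2 a b))
          - (B2 (F1 (E b)) (f2 a c) - B2 (f2 a c) (F1 b))) := by
  subst hl2 hl3 hb3 hf2 hf3 hf3'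
  have h₃' := alt3_congr _ _ a b c P h₃ h₁₂ h₂₃ hP
  have h₅₁' := alt3_congr _ _ a b c P h₅₁ h₁₂ h₂₃ hP
  have h₅₂' := alt3_congr _ _ a b c P h₅₂ h₁₂ h₂₃ hP
  have k₁₁' := alt3_congr _ _ a b c P k₁₁ h₁₂ h₂₃ hP
  have k₁₂' := alt3_congr _ _ a b c P k₁₂ h₁₂ h₂₃ hP
  simp only [alt3, alt2, pre3, preMor3, map_add, map_sub, map_zsmul,
    LinearMap.sub_apply] at h₃' h₅₁' h₅₂' k₁₁' k₁₂' ⊢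
  linear_combination (norm := module) 4 • h₃' - h₅₁' - h₅₂' + k₁₁' + k₁₂'

end Ternary

section CompositionLinearity

set_option linter.unusedSectionVars false

variable {k : Type} [CommRing k] {L M N : ℤ → Type}
  [∀ i, AddCommGroup (L i)] [∀ i, Module k (L i)]
  [∀ i, AddCommGroup (M i)] [∀ i, Module k (M i)]
  [∀ i, AddCommGroup (N i)] [∀ i, Module k (N i)]

theorem outVec_eq (m₁ m₂ n : ℕ) (v : Fin (m₁ + n + m₂) → Tot L) (y : Tot L)
    (w : Fin (m₁ + 1 + m₂) → Tot L)
    (h₁ : ∀ j, v (Fin.castAdd m₂ (Fin.castAdd n j)) = w (Fin.castAdd m₂ (Fin.castAdd 1 j)))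
    (h₂ : y = w (Fin.castAdd m₂ (Fin.natAdd m₁ 0)))
    (h₃ : ∀ j, v (Fin.natAdd (m₁ + n) j) = w (Fin.natAdd (m₁ + 1) j)) :
    outVec m₁ m₂ n v y = w := by
  funext j
  refine Fin.addCases (fun j => ?_) (fun j => ?_) j
  · refine Fin.addCases (fun j => ?_) (fun j => ?_) j
    · simp [outVec, h₁]
    · obtain rfl := Subsingleton.elim j 0
      simp [outVec, h₂]
  · simp [outVec, h₃]

theorem IsMultilinear.pc (hL : Bounded L) (R : ℤ) (m₁ m₂ : ℕ) {n : ℕ} {r s : ℤ}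
    {μ : MMap L M (m₁ + 1 + m₂) r} {ν : MMap L L n s} (h : r + s = R)
    (hμ : IsMultilinear k μ) (hν : IsMultilinear k ν) : IsMultilinear k (pc R m₁ m₂ μ ν h) := by
  refine isMultilinear_of_ev fun d => ⟨fun v =>
    sgn (s * ∑ j : Fin m₁, d (Fin.castAdd m₂ (Fin.castAdd n j))) •
      hat μ (outVec m₁ m₂ n v (hat ν fun j => v (Fin.castAdd m₂ (Fin.natAdd m₁ j)))), ?_,
    fun v hv => ev_pc_hat hL R m₁ m₂ h hμ.zeroOn hν.zeroOn hv⟩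
  intro v j
  set y := hat ν fun j => v (Fin.castAdd m₂ (Fin.natAdd m₁ j)) with hy
  set w := outVec m₁ m₂ n v y with hw
  have inner : ∀ (j : Fin (m₁ + n + m₂)) (z : Tot L),
      (∀ i, Fin.castAdd m₂ (Fin.natAdd m₁ i) ≠ j) →
      (hat ν fun i => Function.update v j z (Fin.castAdd m₂ (Fin.natAdd m₁ i))) = y := by
    intro j z hj
    simp only [Function.update_of_ne (hj _), hy]
  have key : (∃ j', ∀ z, outVec m₁ m₂ n (Function.update v j z)
        (hat ν fun i => Function.update v j z (Fin.castAdd m₂ (Fin.natAdd m₁ i)))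
        = Function.update w j' z) ∨
      ∃ j' u l, ∀ z, outVec m₁ m₂ n (Function.update v j z)
        (hat ν fun i => Function.update v j z (Fin.castAdd m₂ (Fin.natAdd m₁ i)))
        = Function.update w j' (hat ν (Function.update u l z)) := by
    refine Fin.addCases (fun j => ?_) (fun j => ?_) j
    · refine Fin.addCases (fun j => ?_) (fun j => ?_) j
      · refine Or.inl ⟨Fin.castAdd m₂ (Fin.castAdd 1 j), fun z => ?_⟩
        rw [inner _ _ (fun i hi => by simp [Fin.ext_iff] at hi; lia), hw]
        exact outVec_eq _ _ _ _ _ _ (fun i => by simp [Function.update_apply, outVec])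
          (by rw [Function.update_of_ne (by simp [Fin.ext_iff]; lia)]; simp [outVec])
          (fun i => by
            rw [Function.update_of_ne (by simp [Fin.ext_iff]; lia),
              Function.update_of_ne (by simp [Fin.ext_iff]; lia)]
            simp [outVec])
      · refine Or.inr ⟨Fin.castAdd m₂ (Fin.natAdd m₁ 0),
          fun i => v (Fin.castAdd m₂ (Fin.natAdd m₁ i)), j, fun z => ?_⟩
        rw [hw]
        exact outVec_eq _ _ _ _ _ _
          (fun i => by
            rw [Function.update_of_ne (by simp [Fin.ext_iff]; lia),
              Function.update_of_ne (by simp [Fin.ext_iff]; lia)]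
            simp [outVec])
          (by
            rw [Function.update_self]
            congr 1
            funext i
            simp [Function.update_apply])
          (fun i => by
            rw [Function.update_of_ne (by simp [Fin.ext_iff]; lia),
              Function.update_of_ne (by simp [Fin.ext_iff]; lia)]
            simp [outVec])
    · refine Or.inl ⟨Fin.natAdd (m₁ + 1) j, fun z => ?_⟩
      rw [inner _ _ (fun i hi => by simp [Fin.ext_iff] at hi; lia), hw]
      exact outVec_eq _ _ _ _ _ _
        (fun i => by
          rw [Function.update_of_ne (by simp [Fin.ext_iff]; lia),
            Function.update_of_ne (by simp [Fin.ext_iff]; lia)]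
          simp [outVec])
        (by rw [Function.update_of_ne (by simp [Fin.ext_iff]; lia)]; simp [outVec])
        (fun i => by simp [Function.update_apply, outVec])
  rcases key with ⟨j', h⟩ | ⟨j', u, l, h⟩ <;>
    simp only [h, hat_update_add hμ, hat_update_smul hμ, hat_update_add hν, hat_update_smul hν,
      smul_add, true_and, implies_true]
  · exact fun c a => smul_comm _ _ _
  · exact fun c a => smul_comm _ _ _

theorem IsMultilinear.fc2 (hM : Bounded M) (R : ℤ) {a b : ℕ} {r s₁ s₂ : ℤ} {μ : MMap M N 2 r}
    {g₁ : MMap L M a s₁} {g₂ : MMap L M b s₂} (h : r + (s₁ + s₂) = R) (hμ : IsMultilinear k μ)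
    (hg₁ : IsMultilinear k g₁) (hg₂ : IsMultilinear k g₂) :
    IsMultilinear k (fc2 R μ g₁ g₂ h) := by
  refine isMultilinear_of_ev fun d => ⟨fun v => sgn (s₂ * ∑ j : Fin a, d (Fin.castAdd b j)) •
    toLin2 hμ (ev g₁ (fun j => d (Fin.castAdd b j)) (fun j => v (Fin.castAdd b j)))
      (ev g₂ (fun j => d (Fin.natAdd a j)) (fun j => v (Fin.natAdd a j))), ?_,
    fun v hv => ev_fc2 hM R h hμ.zeroOn d v⟩
  intro v j
  refine Fin.addCases (fun j => ?_) (fun j => ?_) j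
  · have e₁ : ∀ z, (fun i => Function.update v (Fin.castAdd b j) z (Fin.castAdd b i))
        = Function.update (fun i => v (Fin.castAdd b i)) j z := fun z => by
      funext i; simp only [Function.update_apply, Fin.castAdd_inj]
    have e₂ : ∀ z, (fun i => Function.update v (Fin.castAdd b j) z (Fin.natAdd a i))
        = fun i => v (Fin.natAdd a i) := fun z => by
      funext i; simp [Function.update_apply, Fin.ext_iff]; lia
    simp only [e₁, e₂, ev_update_add hg₁, ev_update_smul hg₁, map_add, map_smul,
      LinearMap.add_apply, LinearMap.smul_apply, smul_add, true_and, implies_true]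
    exact fun c a => smul_comm _ _ _
  · have e₁ : ∀ z, (fun i => Function.update v (Fin.natAdd a j) z (Fin.natAdd a i))
        = Function.update (fun i => v (Fin.natAdd a i)) j z := fun z => by
      funext i; simp only [Function.update_apply, Fin.natAdd_inj]
    have e₂ : ∀ z, (fun i => Function.update v (Fin.natAdd a j) z (Fin.castAdd b i))
        = fun i => v (Fin.castAdd b i) := fun z => by
      funext i; simp [Function.update_apply, Fin.ext_iff]; lia
    simp only [e₁, e₂, ev_update_add hg₂, ev_update_smul hg₂, map_add, map_smul,
      smul_add, true_and, implies_true]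
    exact fun c a => smul_comm _ _ _

end CompositionLinearity

/-! ### Signed sums over permutations -/

section PermSums

open Equiv

variable {X W : Type} [AddCommGroup W]

/-- Expansion of a signed sum over permutations of `n + 1` letters along the first entry. -/
theorem sum_sign_succ {n : ℕ} (G : (Fin (n + 1) → X) → W) (v : Fin (n + 1) → X) :
    ∑ σ : Perm (Fin (n + 1)), (Perm.sign σ : ℤ) • G (v ∘ σ)
      = ∑ p : Fin (n + 1), (if p = 0 then (1 : ℤ) else -1) •
        ∑ e : Perm (Fin n), (Perm.sign e : ℤ) •
          G (Matrix.vecCons (v p) ((fun i : Fin n => v (swap 0 p i.succ)) ∘ e)) := by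
  rw [← Perm.decomposeFin.symm.sum_comp, Fintype.sum_prod_type]
  refine Finset.sum_congr rfl fun p _ => ?_
  rw [Finset.smul_sum]
  refine Finset.sum_congr rfl fun e _ => ?_
  rw [smul_smul, Perm.decomposeFin.symm_sign]
  congr 1
  · split_ifs <;> simp
  · congr 1
    funext j
    refine Fin.cases ?_ (fun i => ?_) j <;> simp

theorem sum_sign_two (G : (Fin 2 → X) → W) (a b : X) :
    ∑ σ : Perm (Fin 2), (Perm.sign σ : ℤ) • G (![a, b] ∘ σ)
      = alt2 (fun a b => G ![a, b]) a b := by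
  have e : ∀ f : Fin 1 → X, ∀ σ : Perm (Fin 1), f ∘ σ = ![f 0] := fun f σ => by
    funext i; fin_cases i; exact congrArg f (Subsingleton.elim _ _)
  rw [sum_sign_succ]
  simp [Fin.sum_univ_two, e, alt2, sub_eq_add_neg]

theorem sum_sign_three (G : (Fin 3 → X) → W) (a b c : X) :
    ∑ σ : Perm (Fin 3), (Perm.sign σ : ℤ) • G (![a, b, c] ∘ σ)
      = alt3 (fun a b c => G ![a, b, c]) a b c := by
  have e : ∀ p : Fin 3, (fun i : Fin 2 => ![a, b, c] (swap 0 p i.succ))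
      = ![![a, b, c] (swap 0 p 1), ![a, b, c] (swap 0 p 2)] := fun p => by
    funext i; fin_cases i <;> rfl
  have s : ∀ t x y : X, ∑ σ : Perm (Fin 2), (Perm.sign σ : ℤ) • G (Matrix.vecCons t (![x, y] ∘ σ))
      = alt2 (fun x y => G ![t, x, y]) x y := fun t => sum_sign_two fun w => G (Matrix.vecCons t w)
  rw [sum_sign_succ]
  simp only [e, s]
  simp [Fin.sum_univ_three, alt2, alt3, swap_apply_def]
  abel

theorem sum_sign_four (G : (Fin 4 → X) → W) (a b c d : X) :
    ∑ σ : Perm (Fin 4), (Perm.sign σ : ℤ) • G (![a, b, c, d] ∘ σ)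
      = alt4 (fun a b c d => G ![a, b, c, d]) a b c d := by
  have e : ∀ p : Fin 4, (fun i : Fin 3 => ![a, b, c, d] (swap 0 p i.succ))
      = ![![a, b, c, d] (swap 0 p 1), ![a, b, c, d] (swap 0 p 2),
        ![a, b, c, d] (swap 0 p 3)] := fun p => by
    funext i; fin_cases i <;> rfl
  have s : ∀ t x y z : X,
      ∑ σ : Perm (Fin 3), (Perm.sign σ : ℤ) • G (Matrix.vecCons t (![x, y, z] ∘ σ))
        = alt3 (fun x y z => G ![t, x, y, z]) x y z :=
    fun t => sum_sign_three fun w => G (Matrix.vecCons t w)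
  rw [sum_sign_succ]
  simp only [e, s]
  simp [Fin.sum_univ_four, alt4, alt3, swap_apply_def]
  abel

end PermSums

section Thin

open Equiv

variable {L M : ℤ → Type} [∀ i, AddCommGroup (L i)] [∀ i, AddCommGroup (M i)]

/-- A tuple of degrees all of whose Koszul signs are trivial. -/
def Thin {m : ℕ} (d : Fin m → ℤ) : Prop := ∀ p q, p ≠ q → d p * d q = 0

theorem Thin.koszulSign {m : ℕ} {d : Fin m → ℤ} (hd : Thin d) (σ : Perm (Fin m)) :
    koszulSign d σ = 1 := by
  refine Finset.prod_eq_one fun p hp => ?_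
  rw [hd _ _ (Finset.mem_filter.1 hp).2.1.ne]
  rfl

theorem Thin.comp {m : ℕ} {d : Fin m → ℤ} (hd : Thin d) (σ : Perm (Fin m)) :
    Thin fun j => d (σ j) :=
  fun _ _ h => hd _ _ fun e => h (σ.injective e)

/-- Evaluation of a signed sum over permutations on a tuple with trivial Koszul signs. -/
theorem Thin.ev_sum_sign {m : ℕ} {r : ℤ} {μ : MMap L M m r} (G : (Fin m → Tot L) → Tot M)
    {d : Fin m → ℤ} (hd : Thin d) {v : Fin m → Tot L} (hv : ∀ j, IsH (d j) (v j))
    (h : ∀ d' v', Thin d' → (∀ j, IsH (d' j) (v' j)) → ev μ d' v' = G v') :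
    ev (∑ σ : Perm (Fin m), (Perm.sign σ : ℤ) • pa σ μ) d v
      = ∑ σ : Perm (Fin m), (Perm.sign σ : ℤ) • G (v ∘ σ) := by
  rw [ev_sum]
  refine Fintype.sum_equiv (Equiv.inv (Perm (Fin m))) _ _ fun σ => ?_
  rw [ev_zsmul, ev_pa, hd.koszulSign, one_smul, Equiv.inv_apply, Perm.sign_inv,
    h _ _ (hd.comp _) fun j => hv _]
  rfl

/-- A signed sum over permutations of the arguments is skew-symmetric. -/
theorem sum_sign_comp {X W : Type} [AddCommGroup W] {m : ℕ} (G : (Fin m → X) → W)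
    (v : Fin m → X) (τ : Perm (Fin m)) :
    ∑ σ : Perm (Fin m), (Perm.sign σ : ℤ) • G ((fun j => v (τ j)) ∘ σ)
      = (Perm.sign τ : ℤ) • ∑ σ : Perm (Fin m), (Perm.sign σ : ℤ) • G (v ∘ σ) := by
  rw [Finset.smul_sum]
  refine Fintype.sum_equiv (Equiv.mulLeft τ) _ _ fun σ => ?_
  rw [smul_smul, Equiv.coe_mulLeft, Perm.sign_mul, Units.val_mul, ← mul_assoc, ← Units.val_mul,
    Int.units_mul_self, Units.val_one, one_mul]
  rfl

theorem eq_of_ev {m : ℕ} {r : ℤ} {μ ν : MMap L M m r}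
    (h : ∀ d v, (∀ j, IsH (d j) (v j)) → ev μ d v = ev ν d v) : μ = ν := by
  funext d x
  have := h d (fun j => Pi.single (d j) (x j)) (fun j => isH_single _ _)
  simpa [ev] using Pi.single_injective (M := M) _ this

end Thin

/-! ### Evaluation of the structure equations -/

section Signs

theorem sgn_zero : sgn 0 = 1 := rfl
theorem sgn_one : sgn 1 = -1 := rfl
theorem sgn_neg_one : sgn (-1) = -1 := rfl
theorem sgn_two : sgn 2 = 1 := rfl

theorem thin_three {i j l : ℤ} (h₁ : i * j = 0) (h₂ : i * l = 0) (h₃ : j * l = 0) :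
    Thin ![i, j, l] := by
  intro p q hpq
  fin_cases p <;> fin_cases q <;> simp_all [mul_comm]

theorem thin_zero_four : Thin ![0, 0, 0, 0] := by
  intro p q hpq
  fin_cases p <;> simp

end Signs

section Evaluation

variable {L M : ℤ → Type} [∀ i, AddCommGroup (L i)] [∀ i, AddCommGroup (M i)]

theorem ev_one (hL : Bounded L) {r : ℤ} {μ : MMap L M 1 r} (hμ : ZeroOn μ) {i : ℤ}
    {a : Tot L} (ha : IsH i a) : ev μ ![i] ![a] = H1 μ a :=
  ev_eq_hat hL hμ fun j => by fin_cases j; exact ha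

theorem ev_two (hL : Bounded L) {r : ℤ} {μ : MMap L M 2 r} (hμ : ZeroOn μ) {i j : ℤ}
    {a b : Tot L} (ha : IsH i a) (hb : IsH j b) : ev μ ![i, j] ![a, b] = H2 μ a b :=
  ev_eq_hat hL hμ fun j => by fin_cases j <;> assumption

theorem ev_three (hL : Bounded L) {r : ℤ} {μ : MMap L M 3 r} (hμ : ZeroOn μ) {i j l : ℤ}
    {a b c : Tot L} (ha : IsH i a) (hb : IsH j b) (hc : IsH l c) :
    ev μ ![i, j, l] ![a, b, c] = H3 μ a b c :=
  ev_eq_hat hL hμ fun j => by fin_cases j <;> assumption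

theorem ev_four (hL : Bounded L) {r : ℤ} {μ : MMap L M 4 r} (hμ : ZeroOn μ) {i j l m : ℤ}
    {a b c e : Tot L} (ha : IsH i a) (hb : IsH j b) (hc : IsH l c) (he : IsH m e) :
    ev μ ![i, j, l, m] ![a, b, c, e] = H4 μ a b c e :=
  ev_eq_hat hL hμ fun j => by fin_cases j <;> assumption

theorem isH_one (hL : Bounded L) {r : ℤ} {μ : MMap L M 1 r} (hμ : ZeroOn μ) {i : ℤ}
    {a : Tot L} (ha : IsH i a) : IsH (r + i) (H1 μ a) := by
  rw [← ev_one hL hμ ha]; simpa using isH_ev μ ![i] ![a]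

theorem isH_two (hL : Bounded L) {r : ℤ} {μ : MMap L M 2 r} (hμ : ZeroOn μ) {i j : ℤ}
    {a b : Tot L} (ha : IsH i a) (hb : IsH j b) : IsH (r + (i + j)) (H2 μ a b) := by
  rw [← ev_two hL hμ ha hb]; simpa [Fin.sum_univ_two] using isH_ev μ ![i, j] ![a, b]

theorem isH_three (hL : Bounded L) {r : ℤ} {μ : MMap L M 3 r} (hμ : ZeroOn μ) {i j l : ℤ}
    {a b c : Tot L} (ha : IsH i a) (hb : IsH j b) (hc : IsH l c) :
    IsH (r + (i + j + l)) (H3 μ a b c) := by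
  rw [← ev_three hL hμ ha hb hc]
  simpa [Fin.sum_univ_three] using isH_ev μ ![i, j, l] ![a, b, c]

theorem koszulSign_P12_two (i j : ℤ) : koszulSign ![i, j] (P12 2) = sgn (i * j) := by
  have : (Finset.univ.filter fun p : Fin 2 × Fin 2 => p.1 < p.2 ∧ P12 2 p.2 < P12 2 p.1)
      = {(0, 1)} := by decide
  rw [koszulSign, this]
  simp [sgn]

theorem ev_pa_P12_two {r : ℤ} (μ : MMap L M 2 r) (i j : ℤ) (a b : Tot L) :
    ev (pa (P12 2) μ) ![i, j] ![a, b] = sgn (i * j) • ev μ ![j, i] ![b, a] := by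
  rw [ev_pa, koszulSign_P12_two]
  congr 2 <;> (funext t; fin_cases t <;> rfl)

theorem ev_pa_of_thin {m : ℕ} {r : ℤ} (μ : MMap L M m r) {d : Fin m → ℤ} (hd : Thin d)
    (σ : Equiv.Perm (Fin m)) (v : Fin m → Tot L) :
    ev (pa σ μ) d v = ev μ (fun j => d (σ.symm j)) (fun j => v (σ.symm j)) := by
  rw [ev_pa, hd.koszulSign, one_smul]

theorem ev_pa_P12_three {r : ℤ} (μ : MMap L M 3 r) {i j l : ℤ} (hd : Thin ![i, j, l])
    (a b c : Tot L) :
    ev (pa (P12 3) μ) ![i, j, l] ![a, b, c] = ev μ ![j, i, l] ![b, a, c] := by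
  rw [ev_pa_of_thin μ hd]
  congr 1 <;> (funext t; fin_cases t <;> rfl)

theorem ev_pa_P23_three {r : ℤ} (μ : MMap L M 3 r) {i j l : ℤ} (hd : Thin ![i, j, l])
    (a b c : Tot L) :
    ev (pa (P23 3) μ) ![i, j, l] ![a, b, c] = ev μ ![i, l, j] ![a, c, b] := by
  rw [ev_pa_of_thin μ hd]
  congr 1 <;> (funext t; fin_cases t <;> rfl)

section Quaternary

variable {r : ℤ} (μ : MMap L M 4 r) {i j l m : ℤ} (hd : Thin ![i, j, l, m]) (a b c e : Tot L)
include hd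

theorem ev_pa_P12_four :
    ev (pa (P12 4) μ) ![i, j, l, m] ![a, b, c, e] = ev μ ![j, i, l, m] ![b, a, c, e] := by
  rw [ev_pa_of_thin μ hd]
  congr 1 <;> (funext t; fin_cases t <;> rfl)

theorem ev_pa_P23_four :
    ev (pa (P23 4) μ) ![i, j, l, m] ![a, b, c, e] = ev μ ![i, l, j, m] ![a, c, b, e] := by
  rw [ev_pa_of_thin μ hd]
  congr 1 <;> (funext t; fin_cases t <;> rfl)

theorem ev_pa_P123_four :
    ev (pa (P123 4) μ) ![i, j, l, m] ![a, b, c, e] = ev μ ![l, i, j, m] ![c, a, b, e] := by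
  rw [ev_pa_of_thin μ hd]
  congr 1 <;> (funext t; fin_cases t <;> rfl)

theorem ev_pa_P132_four :
    ev (pa (P132 4) μ) ![i, j, l, m] ![a, b, c, e] = ev μ ![j, l, i, m] ![b, c, a, e] := by
  rw [ev_pa_of_thin μ hd]
  congr 1 <;> (funext t; fin_cases t <;> rfl)

end Quaternary

theorem ev_bd_one (hL : Bounded L) (hM : Bounded M) {R r : ℤ} {D' : MMap M M 1 (-1)}
    {D : MMap L L 1 (-1)} {μ : MMap L M 1 r} {h : -1 + r = R} (hD' : ZeroOn D')
    (hD : ZeroOn D) (hμ : ZeroOn μ) {i : ℤ} {a : Tot L} (ha : IsH i a) :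
    ev (bd R D' D μ h) ![i] ![a] = H1 D' (H1 μ a) - sgn r • H1 μ (H1 D a) := by
  rw [bd_one, ev_sub, ev_zsmul, ev_fc_1 hL hM hD' hμ ha, ev_pc_0_0_1 hL hμ hD ha]

theorem ev_bd_two (hL : Bounded L) (hM : Bounded M) {R r : ℤ} {D' : MMap M M 1 (-1)}
    {D : MMap L L 1 (-1)} {μ : MMap L M 2 r} {h : -1 + r = R} (hD' : ZeroOn D')
    (hD : ZeroOn D) (hμ : ZeroOn μ) {i j : ℤ} {a b : Tot L} (ha : IsH i a) (hb : IsH j b) :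
    ev (bd R D' D μ h) ![i, j] ![a, b] = H1 D' (H2 μ a b)
      - sgn r • (H2 μ (H1 D a) b + sgn (-1 * i) • H2 μ a (H1 D b)) := by
  rw [bd_two, ev_sub, ev_zsmul, ev_add, ev_fc_2 hL hM hD' hμ ha hb,
    ev_pc_0_1_1 hL hμ hD ha hb, ev_pc_1_0_1 hL hμ hD ha hb]

theorem ev_bd_three (hL : Bounded L) (hM : Bounded M) {R r : ℤ} {D' : MMap M M 1 (-1)}
    {D : MMap L L 1 (-1)} {μ : MMap L M 3 r} {h : -1 + r = R} (hD' : ZeroOn D')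
    (hD : ZeroOn D) (hμ : ZeroOn μ) {i j l : ℤ} {a b c : Tot L} (ha : IsH i a)
    (hb : IsH j b) (hc : IsH l c) :
    ev (bd R D' D μ h) ![i, j, l] ![a, b, c] = H1 D' (H3 μ a b c)
      - sgn r • (H3 μ (H1 D a) b c + sgn (-1 * i) • H3 μ a (H1 D b) c
        + sgn (-1 * (i + j)) • H3 μ a b (H1 D c)) := by
  rw [bd_three, ev_sub, ev_zsmul, ev_add, ev_add, ev_fc_3 hL hM hD' hμ ha hb hc,
    ev_pc_0_2_1 hL hμ hD ha hb hc, ev_pc_1_1_1 hL hμ hD ha hb hc,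
    ev_pc_2_0_1 hL hμ hD ha hb hc]

/-- The right-hand side of the ternary morphism equation. -/
theorem ev_morphism_three (hL : Bounded L) (hM : Bounded M) {l₂ : MMap L L 2 0}
    {l₃ : MMap L L 3 1} {b₂ : MMap M M 2 0} {b₃ : MMap M M 3 1} {f₁ : MMap L M 1 0}
    {f₂ : MMap L M 2 1} (hl₂ : ZeroOn l₂) (hl₃ : ZeroOn l₃) (hb₂ : ZeroOn b₂)
    (hb₃ : ZeroOn b₃) (hf₁ : ZeroOn f₁) (hf₂ : ZeroOn f₂) {i j l : ℤ} {a b c : Tot L}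
    (hd : Thin ![i, j, l]) (ha : IsH i a) (hb : IsH j b) (hc : IsH l c) :
    ev (m := 3) (fc1 1 f₁ l₃ - pc 1 1 0 f₂ l₂ + pc 1 0 1 f₂ l₂
        + pa (P12 3) (pc 1 1 0 f₂ l₂) - fc3 1 b₃ f₁ f₁ f₁ - fc2 1 b₂ f₁ f₂
        + fc2 1 b₂ f₂ f₁ + pa (P12 3) (fc2 1 b₂ f₁ f₂)) ![i, j, l] ![a, b, c]
      = H1 f₁ (H3 l₃ a b c) - H2 f₂ a (H2 l₂ b c) + H2 f₂ (H2 l₂ a b) c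
        + H2 f₂ b (H2 l₂ a c) - H3 b₃ (H1 f₁ a) (H1 f₁ b) (H1 f₁ c)
        - sgn i • H2 b₂ (H1 f₁ a) (H2 f₂ b c) + H2 b₂ (H2 f₂ a b) (H1 f₁ c)
        + sgn j • H2 b₂ (H1 f₁ b) (H2 f₂ a c) := by
  simp only [ev_add, ev_sub]
  rw [ev_fc_3 hL hL hf₁ hl₃ ha hb hc, ev_pc_1_0_2 hL hf₂ hl₂ ha hb hc,
    ev_pc_0_1_2 hL hf₂ hl₂ ha hb hc, ev_pa_P12_three (hd := hd),
    ev_pc_1_0_2 hL hf₂ hl₂ hb ha hc, ev_fc_1_1_1 hL hM hb₃ hf₁ hf₁ hf₁ ha hb hc,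
    ev_fc_1_2 hL hM hb₂ hf₁ hf₂ ha hb hc, ev_fc_2_1 hL hM hb₂ hf₂ hf₁ ha hb hc,
    ev_pa_P12_three (hd := hd), ev_fc_1_2 hL hM hb₂ hf₁ hf₂ hb ha hc]
  simp only [zero_mul, one_mul, add_zero, sgn_zero, one_smul]

/-- The quaternary morphism equation in degree zero. -/
theorem ev_morphism_four (hL : Bounded L) (hM : Bounded M) {l₂ : MMap L L 2 0}
    {l₃ : MMap L L 3 1} {b₂ : MMap M M 2 0} {b₃ : MMap M M 3 1} {f₁ : MMap L M 1 0}
    {f₂ : MMap L M 2 1} {f₃ : MMap L M 3 2} (hl₂ : ZeroOn l₂) (hl₃ : ZeroOn l₃)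
    (hb₂ : ZeroOn b₂) (hb₃ : ZeroOn b₃) (hf₁ : ZeroOn f₁) (hf₂ : ZeroOn f₂)
    (hf₃ : ZeroOn f₃) {a b c e : Tot L} (ha : IsH 0 a) (hb : IsH 0 b) (hc : IsH 0 c)
    (he : IsH 0 e) :
    ev (m := 4) (pc 2 0 1 f₂ l₃ + pc 2 1 0 f₂ l₃ - pa (P12 4) (pc 2 1 0 f₂ l₃)
        + pa (P123 4) (pc 2 1 0 f₂ l₃) - pc 2 0 2 f₃ l₂ + pc 2 1 1 f₃ l₂
        - pa (P12 4) (pc 2 1 1 f₃ l₂) - pc 2 2 0 f₃ l₂ + pa (P23 4) (pc 2 2 0 f₃ l₂)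
        - pa (P132 4) (pc 2 2 0 f₃ l₂) + fc2 2 b₂ f₃ f₁ + fc2 2 b₂ f₁ f₃
        - pa (P12 4) (fc2 2 b₂ f₁ f₃) + pa (P123 4) (fc2 2 b₂ f₁ f₃)
        - fc2 2 b₂ f₂ f₂ + pa (P23 4) (fc2 2 b₂ f₂ f₂) - pa (P132 4) (fc2 2 b₂ f₂ f₂)
        + fc3 2 b₃ f₂ f₁ f₁ - fc3 2 b₃ f₁ f₂ f₁ + pa (P12 4) (fc3 2 b₃ f₁ f₂ f₁)
        + fc3 2 b₃ f₁ f₁ f₂ - pa (P23 4) (fc3 2 b₃ f₁ f₁ f₂)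
        + pa (P132 4) (fc3 2 b₃ f₁ f₁ f₂)) ![0, 0, 0, 0] ![a, b, c, e]
      = H2 f₂ (H3 l₃ a b c) e + H2 f₂ a (H3 l₃ b c e) - H2 f₂ b (H3 l₃ a c e)
        + H2 f₂ c (H3 l₃ a b e) - H3 f₃ (H2 l₂ a b) c e + H3 f₃ a (H2 l₂ b c) e
        - H3 f₃ b (H2 l₂ a c) e - H3 f₃ a b (H2 l₂ c e) + H3 f₃ a c (H2 l₂ b e)
        - H3 f₃ b c (H2 l₂ a e) + H2 b₂ (H3 f₃ a b c) (H1 f₁ e)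
        + H2 b₂ (H1 f₁ a) (H3 f₃ b c e) - H2 b₂ (H1 f₁ b) (H3 f₃ a c e)
        + H2 b₂ (H1 f₁ c) (H3 f₃ a b e) - H2 b₂ (H2 f₂ a b) (H2 f₂ c e)
        + H2 b₂ (H2 f₂ a c) (H2 f₂ b e) - H2 b₂ (H2 f₂ b c) (H2 f₂ a e)
        + H3 b₃ (H2 f₂ a b) (H1 f₁ c) (H1 f₁ e) - H3 b₃ (H1 f₁ a) (H2 f₂ b c) (H1 f₁ e)
        + H3 b₃ (H1 f₁ b) (H2 f₂ a c) (H1 f₁ e) + H3 b₃ (H1 f₁ a) (H1 f₁ b) (H2 f₂ c e)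
        - H3 b₃ (H1 f₁ a) (H1 f₁ c) (H2 f₂ b e)
        + H3 b₃ (H1 f₁ b) (H1 f₁ c) (H2 f₂ a e) := by
  simp only [ev_add, ev_sub, ev_pa_P12_four _ thin_zero_four, ev_pa_P23_four _ thin_zero_four,
    ev_pa_P123_four _ thin_zero_four, ev_pa_P132_four _ thin_zero_four]
  simp (disch := assumption) only [ev_pc_0_1_3 hL, ev_pc_1_0_3 hL, ev_pc_0_2_2 hL,
    ev_pc_1_1_2 hL, ev_pc_2_0_2 hL, ev_fc_3_1 hL hM, ev_fc_1_3 hL hM, ev_fc_2_2 hL hM,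
    ev_fc_2_1_1 hL hM, ev_fc_1_2_1 hL hM, ev_fc_1_1_2 hL hM, mul_zero, add_zero, sgn_zero,
    one_smul]

end Evaluation

/-! ### Skew-symmetrized structure maps on homogeneous elements -/

section Scaling

variable (k : Type) [CommRing k] {W : Type} [AddCommGroup W] [Module k W]

theorem zsmul_smul_eq (n m : ℤ) (c : k) (h : (n : k) * c = m) (x : W) : n • c • x = m • x := by
  rw [← Int.cast_smul_eq_zsmul k n, ← Int.cast_smul_eq_zsmul k m, smul_smul, h]

variable [Invertible (2 : k)] [Invertible (3 : k)]

omit [Invertible (3 : k)] in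
theorem two_zsmul_half (x : W) : (2 : ℤ) • (⅟ (2 : k)) • x = x := by
  rw [zsmul_smul_eq k 2 1 _ (by simp), one_smul]

theorem zsmul_sixth (x : W) : (24 : ℤ) • (⅟ (2 : k) * ⅟ (3 : k)) • x = (4 : ℤ) • x := by
  refine zsmul_smul_eq k _ _ _ ?_ x
  have h₂ := mul_invOf_self (2 : k)
  have h₃ := mul_invOf_self (3 : k)
  push_cast
  linear_combination 4 * (3 * ⅟ (3 : k)) * h₂ + 4 * h₃

theorem twentyfour_mul_inv : (24 : k) * (⅟ (2 : k) * ⅟ (2 : k) * ⅟ (2 : k) * ⅟ (3 : k)) = 1 := by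
  have h₂ := mul_invOf_self (2 : k)
  have h₃ := mul_invOf_self (3 : k)
  calc (24 : k) * (⅟ (2 : k) * ⅟ (2 : k) * ⅟ (2 : k) * ⅟ (3 : k))
      = (2 * ⅟ (2 : k)) * (2 * ⅟ (2 : k)) * (2 * ⅟ (2 : k)) * (3 * ⅟ (3 : k)) := by ring
    _ = 1 := by rw [h₂, h₃]; ring

theorem zsmul_twentyfourth (x : W) :
    (24 : ℤ) • (⅟ (2 : k) * ⅟ (2 : k) * ⅟ (2 : k) * ⅟ (3 : k)) • x = x := by
  rw [zsmul_smul_eq k 24 1 _ (by simpa using twentyfour_mul_inv k), one_smul]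

theorem zsmul_fortyeight_twentyfourth (x : W) :
    (48 : ℤ) • (⅟ (2 : k) * ⅟ (2 : k) * ⅟ (2 : k) * ⅟ (3 : k)) • x = (2 : ℤ) • x :=
  zsmul_smul_eq k _ _ _ (by push_cast; linear_combination 2 * twentyfour_mul_inv k) x

theorem zsmul_fortyeighth (x : W) :
    (48 : ℤ) • (⅟ (2 : k) * ⅟ (2 : k) * ⅟ (2 : k) * ⅟ (2 : k) * ⅟ (3 : k)) • x = x := by
  rw [zsmul_smul_eq k 48 1 _ ?_, one_smul]
  push_cast
  linear_combination 2 * ⅟ (2 : k) * twentyfour_mul_inv k + mul_invOf_self (2 : k)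

include k in
theorem zsmul_fortyeight_cancel {x y : W} (h : (48 : ℤ) • x = (48 : ℤ) • y) : x = y := by
  have e : ∀ z : W, (⅟ (2 : k) * ⅟ (2 : k) * ⅟ (2 : k) * ⅟ (2 : k) * ⅟ (3 : k)) •
      (48 : ℤ) • z = z := fun z => by rw [smul_comm, zsmul_fortyeighth]
  rw [← e x, h, e y]

end Scaling

section Bar

variable (k : Type) [CommRing k] {L M : ℤ → Type} [∀ i, AddCommGroup (L i)]
  [∀ i, Module k (L i)] [∀ i, AddCommGroup (M i)] [∀ i, Module k (M i)]

/-- The operator `x ↦ (-1)^|x| x`. -/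
def signOp : Tot L →ₗ[k] Tot L where
  toFun x i := sgn i • x i
  map_add' _ _ := funext fun _ => smul_add _ _ _
  map_smul' _ _ := funext fun _ => smul_comm _ _ _

theorem IsH.signOp {i : ℤ} {x : Tot L} (hx : IsH i x) : signOp k x = sgn i • x := by
  funext j
  by_cases h : j = i
  · subst h; rfl
  · change sgn j • x j = sgn i • x j
    rw [hx j h, smul_zero, smul_zero]

theorem isMultilinear_sum_sign (hL : Bounded L) {m : ℕ} {r : ℤ} {μ : MMap L M m r}
    (hμ : IsMultilinear k μ) :
    IsMultilinear k (∑ σ : Equiv.Perm (Fin m), (Equiv.Perm.sign σ : ℤ) • pa σ μ) :=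
  .sum _ fun σ => (hμ.pa hL σ).zsmul _

variable [Invertible (2 : k)] [Invertible (3 : k)] (A : WeakLie3 k L) (B : WeakLie3 k M)

omit [Invertible (3 : k)] in
theorem isMultilinear_skew2 : IsMultilinear k (skew2 k A) :=
  (isMultilinear_sum_sign k A.bound A.leib.lin2).smul _

theorem isMultilinear_skew3 : IsMultilinear k (skew3 k A) :=
  ((isMultilinear_sum_sign k A.bound A.leib.lin3).smul _).sub
    ((isMultilinear_sum_sign k A.bound ((A.lin21.pc A.bound 1 0 1 _ A.leib.lin2).add
      (A.lin21.pc A.bound 1 1 0 _ A.leib.lin2))).smul _)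

theorem isMultilinear_skew4 : IsMultilinear k (skew4 k A) :=
  ((isMultilinear_sum_sign k A.bound A.leib.lin4).smul _).add
    ((isMultilinear_sum_sign k A.bound
      ((((((A.lin21.pc A.bound 2 0 1 _ A.leib.lin3).sub
        (A.lin31.pc A.bound 2 0 2 _ A.leib.lin2)).add
        (A.lin32.pc A.bound 2 1 1 _ A.leib.lin2)).sub
        (A.lin21.pc A.bound 2 1 0 _ A.leib.lin3)).sub
        (A.lin31.pc A.bound 2 1 1 _ A.leib.lin2)).add
        (A.lin32.pc A.bound 2 2 0 _ A.leib.lin2))).smul _)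

omit [Invertible (3 : k)] in
theorem isMultilinear_skewMor2 (hL : Bounded L) {f2 : MMap L M 2 1} (hf2 : IsMultilinear k f2) :
    IsMultilinear k (skewMor2 k f2) :=
  (isMultilinear_sum_sign k hL hf2).smul _

variable {A B} in
theorem isMultilinear_skewMor3 {f1 : MMap L M 1 0} {f2 : MMap L M 2 1} {f21 : MMap L M 2 2}
    {f3 : MMap L M 3 2} (hf : IsWeakMorphism k A B f1 f2 f21 f3) :
    IsMultilinear k (skewMor3 k A B f1 f2 f21 f3) := by
  have h₁ := hf.lin21.pc A.bound 2 0 1 rfl A.leib.lin2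
  have h₂ := hf.lin21.pc A.bound 2 1 0 rfl A.leib.lin2
  have h₃ := B.lin21.fc2 B.bound 2 rfl hf.lin2 hf.lin1
  have h₄ := B.lin21.fc2 B.bound 2 rfl hf.lin1 hf.lin2
  have h₅ := isMultilinear_sum_sign k A.bound (((h₁.add h₂).sub h₃).sub h₄)
  exact ((isMultilinear_sum_sign k A.bound hf.lin3).smul _).sub (h₅.smul _)

theorem pa_one {m : ℕ} {r : ℤ} (μ : MMap L M m r) : pa 1 μ = μ := by
  refine eq_of_ev fun d v _ => ?_
  rw [ev_pa, show koszulSign d 1 = 1 from ?_, one_smul]; rfl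
  refine Finset.prod_eq_one fun p hp => ?_
  have h := (Finset.mem_filter.1 hp).2
  exact absurd h.1 h.2.asymm

theorem ev_sum_sign_two {r : ℤ} (μ : MMap L M 2 r) (i j : ℤ) (a b : Tot L) :
    ev (∑ σ : Equiv.Perm (Fin 2), (Equiv.Perm.sign σ : ℤ) • pa σ μ) ![i, j] ![a, b]
      = ev μ ![i, j] ![a, b] - sgn (i * j) • ev μ ![j, i] ![b, a] := by
  have h : (Finset.univ : Finset (Equiv.Perm (Fin 2))) = {1, P12 2} := by decide
  have h' : (1 : Equiv.Perm (Fin 2)) ≠ P12 2 := by decide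
  rw [h, Finset.sum_pair h', ev_add, ev_zsmul, ev_zsmul, ev_pa_P12_two, pa_one, P12,
    Equiv.Perm.sign_swap (by decide), Equiv.Perm.sign_one]
  simp [sub_eq_add_neg]

omit [Invertible (3 : k)] in
theorem two_zsmul_skew2 {i j : ℤ} {a b : Tot L} (ha : IsH i a) (hb : IsH j b) :
    (2 : ℤ) • H2 (skew2 k A) a b = H2 A.l2 a b - sgn (i * j) • H2 A.l2 b a := by
  have h₂ := A.leib.lin2.zeroOn
  rw [← ev_two A.bound (isMultilinear_skew2 k A).zeroOn ha hb, skew2, ev_smul, two_zsmul_half,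
    ev_sum_sign_two, ev_two A.bound h₂ ha hb, ev_two A.bound h₂ hb ha]

omit [Invertible (3 : k)] in
theorem two_zsmul_skewMor2 (hL : Bounded L) {f2 : MMap L M 2 1} (hf2 : IsMultilinear k f2)
    {i j : ℤ} {a b : Tot L} (ha : IsH i a) (hb : IsH j b) :
    (2 : ℤ) • H2 (skewMor2 k f2) a b = H2 f2 a b - sgn (i * j) • H2 f2 b a := by
  rw [← ev_two hL (isMultilinear_skewMor2 k hL hf2).zeroOn ha hb, skewMor2, ev_smul,
    two_zsmul_half, ev_sum_sign_two, ev_two hL hf2.zeroOn ha hb, ev_two hL hf2.zeroOn hb ha]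

theorem ev_sum_sign_three {r : ℤ} {μ : MMap L M 3 r} {i j l : ℤ}
    {a b c : Tot L} (hd : Thin ![i, j, l]) (ha : IsH i a) (hb : IsH j b) (hc : IsH l c)
    (g : Tot L → Tot L → Tot L → Tot M)
    (h : ∀ {i j l : ℤ} {a b c : Tot L}, IsH i a → IsH j b → IsH l c →
      ev μ ![i, j, l] ![a, b, c] = g a b c) :
    ev (∑ σ : Equiv.Perm (Fin 3), (Equiv.Perm.sign σ : ℤ) • pa σ μ) ![i, j, l] ![a, b, c]
      = alt3 g a b c := by
  refine (hd.ev_sum_sign (fun v => g (v 0) (v 1) (v 2)) (fun t => by fin_cases t <;> assumption)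
    fun d v _ hv => ?_).trans (sum_sign_three (fun v => g (v 0) (v 1) (v 2)) a b c)
  rw [eta3 d, eta3 v]
  exact h (hv 0) (hv 1) (hv 2)

theorem ev_sum_sign_four {r : ℤ} {μ : MMap L M 4 r} {i j l m : ℤ}
    {a b c e : Tot L} (hd : Thin ![i, j, l, m]) (ha : IsH i a) (hb : IsH j b) (hc : IsH l c)
    (he : IsH m e) (g : Tot L → Tot L → Tot L → Tot L → Tot M)
    (h : ∀ {i j l m : ℤ} {a b c e : Tot L}, IsH i a → IsH j b → IsH l c → IsH m e →
      ev μ ![i, j, l, m] ![a, b, c, e] = g a b c e) :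
    ev (∑ σ : Equiv.Perm (Fin 4), (Equiv.Perm.sign σ : ℤ) • pa σ μ) ![i, j, l, m] ![a, b, c, e]
      = alt4 g a b c e := by
  refine (hd.ev_sum_sign (fun v => g (v 0) (v 1) (v 2) (v 3))
    (fun t => by fin_cases t <;> assumption) fun d v _ hv => ?_).trans
    (sum_sign_four (fun v => g (v 0) (v 1) (v 2) (v 3)) a b c e)
  rw [eta4 d, eta4 v]
  exact h (hv 0) (hv 1) (hv 2) (hv 3)

theorem alt3_lin {X W : Type} [AddCommGroup W] (n : ℤ) (g g' : X → X → X → W) (a b c : X) :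
    n • alt3 g a b c - alt3 g' a b c = alt3 (fun x y z => n • g x y z - g' x y z) a b c := by
  simp only [alt3]; module

theorem zsmul_skew3 {i j l : ℤ} {a b c : Tot L} (hd : Thin ![i, j, l]) (ha : IsH i a)
    (hb : IsH j b) (hc : IsH l c) :
    (24 : ℤ) • H3 (skew3 k A) a b c
      = alt3 (pre3 (H2 A.l2) (H3 A.l3) (H2 A.l21)) a b c := by
  have h₂ := A.leib.lin2.zeroOn
  have h₃ := A.leib.lin3.zeroOn
  have h₂₁ := A.lin21.zeroOn
  rw [← ev_three A.bound (isMultilinear_skew3 k A).zeroOn ha hb hc, skew3, ev_sub, ev_smul,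
    ev_smul, smul_sub, zsmul_sixth, zsmul_twentyfourth,
    ev_sum_sign_three hd ha hb hc (H3 A.l3) fun ha hb hc =>
      ev_three A.bound h₃ ha hb hc,
    ev_sum_sign_three hd ha hb hc
      (fun a b c => H2 A.l21 (H2 A.l2 a b) c + H2 A.l21 a (H2 A.l2 b c)), alt3_lin]
  · congr 1; funext x y z; rw [pre3]; abel
  · intro i j l a b c ha hb hc
    rw [ev_add, ev_pc_0_1_2 A.bound h₂₁ h₂ ha hb hc, ev_pc_1_0_2 A.bound h₂₁ h₂ ha hb hc]
    simp [sgn_zero]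

theorem alt4_lin {X W : Type} [AddCommGroup W] (n : ℤ) (g g' : X → X → X → X → W)
    (a b c e : X) : n • alt4 g a b c e + alt4 g' a b c e
      = alt4 (fun x y z w => n • g x y z w + g' x y z w) a b c e := by
  rw [← alt4_zsmul, ← alt4_add]

theorem zsmul_skew4 {a b c e : Tot L} (ha : IsH 0 a) (hb : IsH 0 b) (hc : IsH 0 c)
    (he : IsH 0 e) :
    (48 : ℤ) • H4 (skew4 k A) a b c e
      = alt4 (pre4 (H2 A.l2) (H3 A.l3) (H4 A.l4) (H2 A.l21) (H3 A.l31) (H3 A.l32)) a b c e := by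
  have h₂ := A.leib.lin2.zeroOn
  have h₃ := A.leib.lin3.zeroOn
  have h₂₁ := A.lin21.zeroOn
  have h₃₁ := A.lin31.zeroOn
  have h₃₂ := A.lin32.zeroOn
  rw [← ev_four A.bound (isMultilinear_skew4 k A).zeroOn ha hb hc he, skew4, ev_add, ev_smul,
    ev_smul, smul_add, zsmul_fortyeight_twentyfourth, zsmul_fortyeighth,
    ev_sum_sign_four thin_zero_four ha hb hc he (H4 A.l4) fun ha hb hc he =>
      ev_four A.bound A.leib.lin4.zeroOn ha hb hc he,
    ev_sum_sign_four thin_zero_four ha hb hc he (fun x y z w => H2 A.l21 (H3 A.l3 x y z) w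
      - H3 A.l31 (H2 A.l2 x y) z w + H3 A.l32 x (H2 A.l2 y z) w
      - H2 A.l21 (signOp k x) (H3 A.l3 y z w) - H3 A.l31 x (H2 A.l2 y z) w
      + H3 A.l32 x y (H2 A.l2 z w)), alt4_lin]
  · refine alt4_congr _ _ a b c e (IsH 0) (fun x y z w hx _ _ _ => ?_) ha hb hc he
    rw [hx.signOp k, sgn_zero, one_smul, pre4]
    abel
  · intro i j l m a b c e ha hb hc he
    have hE : H2 A.l21 (signOp k a) (H3 A.l3 b c e)
        = sgn i • H2 A.l21 a (H3 A.l3 b c e) := by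
      rw [ha.signOp k, ← toLin2_apply A.lin21, map_zsmul]; rfl
    simp only [ev_add, ev_sub, hE]
    rw [ev_pc_0_1_3 A.bound h₂₁ h₃ ha hb hc he, ev_pc_0_2_2 A.bound h₃₁ h₂ ha hb hc he,
      ev_pc_1_1_2 A.bound h₃₂ h₂ ha hb hc he, ev_pc_1_0_3 A.bound h₂₁ h₃ ha hb hc he,
      ev_pc_1_1_2 A.bound h₃₁ h₂ ha hb hc he, ev_pc_2_0_2 A.bound h₃₂ h₂ ha hb hc he]
    simp only [zero_mul, one_mul, sgn_zero, one_smul]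

variable {A B}

theorem zsmul_skewMor3 {f1 : MMap L M 1 0} {f2 : MMap L M 2 1} {f21 : MMap L M 2 2}
    {f3 : MMap L M 3 2} (hf : IsWeakMorphism k A B f1 f2 f21 f3) {i j l : ℤ} {a b c : Tot L}
    (hd : Thin ![i, j, l]) (ha : IsH i a) (hb : IsH j b) (hc : IsH l c) :
    (24 : ℤ) • H3 (skewMor3 k A B f1 f2 f21 f3) a b c
      = alt3 (fun x y z => (4 : ℤ) • H3 f3 x y z - H2 f21 (H2 A.l2 x y) z
        - H2 f21 x (H2 A.l2 y z) + H2 B.l21 (H2 f2 x y) (H1 f1 z)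
        + H2 B.l21 (H1 f1 (signOp k x)) (H2 f2 y z)) a b c := by
  have h₂ := A.leib.lin2.zeroOn
  have h₂₁ := B.lin21.zeroOn
  have g₁ := hf.lin1.zeroOn
  have g₂ := hf.lin2.zeroOn
  have g₂₁ := hf.lin21.zeroOn
  rw [← ev_three A.bound (isMultilinear_skewMor3 k hf).zeroOn ha hb hc, skewMor3, ev_sub,
    ev_smul, ev_smul, smul_sub, zsmul_sixth, zsmul_twentyfourth,
    ev_sum_sign_three hd ha hb hc (H3 f3) fun ha hb hc =>
      ev_three A.bound hf.lin3.zeroOn ha hb hc,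
    ev_sum_sign_three hd ha hb hc
      (fun x y z => H2 f21 (H2 A.l2 x y) z + H2 f21 x (H2 A.l2 y z)
        - H2 B.l21 (H2 f2 x y) (H1 f1 z) - H2 B.l21 (H1 f1 (signOp k x)) (H2 f2 y z)), alt3_lin]
  · congr 1; funext x y z; abel
  · intro i j l a b c ha hb hc
    have hE : H2 B.l21 (H1 f1 (signOp k a)) (H2 f2 b c)
        = sgn i • H2 B.l21 (H1 f1 a) (H2 f2 b c) := by
      rw [ha.signOp k, ← toLin1_apply hf.lin1, ← toLin2_apply B.lin21, map_zsmul, map_zsmul]; rfl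
    simp only [ev_add, ev_sub, hE]
    rw [ev_pc_0_1_2 A.bound g₂₁ h₂ ha hb hc, ev_pc_1_0_2 A.bound g₂₁ h₂ ha hb hc,
      ev_fc_2_1 A.bound B.bound h₂₁ g₂ g₁ ha hb hc, ev_fc_1_2 A.bound B.bound h₂₁ g₁ g₂ ha hb hc]
    simp only [zero_mul, one_mul, sgn_zero, one_smul]

end Bar

/-! ### The structure equations on homogeneous elements -/

section WeakLie

variable {k : Type} [CommRing k] {L : ℤ → Type} [∀ i, AddCommGroup (L i)]
  [∀ i, Module k (L i)] (A : WeakLie3 k L)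

namespace WeakLie3

theorem D_l2 {i j : ℤ} {a b : Tot L} (ha : IsH i a) (hb : IsH j b) :
    H1 A.D (H2 A.l2 a b) = H2 A.l2 (H1 A.D a) b + sgn (-1 * i) • H2 A.l2 a (H1 A.D b) := by
  have hD := A.linD.zeroOn
  have h := congrArg (fun μ => ev μ ![i, j] ![a, b]) A.leib.eqL1
  simp only [ev_zero] at h
  rw [ev_bd_two A.bound A.bound hD hD A.leib.lin2.zeroOn ha hb, sgn_zero, one_smul] at h
  exact sub_eq_zero.1 h

theorem D_l21 {i j : ℤ} {a b : Tot L} (ha : IsH i a) (hb : IsH j b) :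
    H1 A.D (H2 A.l21 a b) + H2 A.l21 (H1 A.D a) b + sgn (-1 * i) • H2 A.l21 a (H1 A.D b)
      = H2 A.l2 a b + sgn (i * j) • H2 A.l2 b a := by
  have hD := A.linD.zeroOn
  have h₂ := A.leib.lin2.zeroOn
  have h := congrArg (fun μ => ev μ ![i, j] ![a, b]) A.w1
  simp only [ev_add] at h
  rw [ev_bd_two A.bound A.bound hD hD A.lin21.zeroOn ha hb, ev_pa_P12_two,
    ev_two A.bound h₂ ha hb, ev_two A.bound h₂ hb ha, sgn_one] at h
  rw [← h]
  module

theorem D_l3 {i j l : ℤ} {a b c : Tot L} (hd : Thin ![i, j, l]) (ha : IsH i a) (hb : IsH j b)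
    (hc : IsH l c) :
    H1 A.D (H3 A.l3 a b c) + H3 A.l3 (H1 A.D a) b c + sgn (-1 * i) • H3 A.l3 a (H1 A.D b) c
        + sgn (-1 * (i + j)) • H3 A.l3 a b (H1 A.D c)
      = H2 A.l2 a (H2 A.l2 b c) - H2 A.l2 (H2 A.l2 a b) c - H2 A.l2 b (H2 A.l2 a c) := by
  have hD := A.linD.zeroOn
  have h₂ := A.leib.lin2.zeroOn
  have h := congrArg (fun μ => ev μ ![i, j, l] ![a, b, c]) A.leib.eqL2
  simp only [ev_sub] at h
  rw [ev_bd_three A.bound A.bound hD hD A.leib.lin3.zeroOn ha hb hc,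
    ev_pc_0_1_2 A.bound h₂ h₂ ha hb hc, ev_pc_1_0_2 A.bound h₂ h₂ ha hb hc,
    ev_pa_P12_three (hd := hd), ev_pc_1_0_2 A.bound h₂ h₂ hb ha hc] at h
  simp only [zero_mul, sgn_zero, sgn_one, one_smul] at h
  rw [← h]
  module

theorem D_l31 {i j l : ℤ} {a b c : Tot L} (hd : Thin ![i, j, l]) (ha : IsH i a) (hb : IsH j b)
    (hc : IsH l c) :
    H1 A.D (H3 A.l31 a b c) - (H3 A.l31 (H1 A.D a) b c + sgn (-1 * i) • H3 A.l31 a (H1 A.D b) c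
        + sgn (-1 * (i + j)) • H3 A.l31 a b (H1 A.D c))
      = H3 A.l3 a b c + H3 A.l3 b a c + H2 A.l2 (H2 A.l21 a b) c := by
  have hD := A.linD.zeroOn
  have h₃ := A.leib.lin3.zeroOn
  have h := congrArg (fun μ => ev μ ![i, j, l] ![a, b, c]) A.w3
  simp only [ev_add] at h
  rw [ev_bd_three A.bound A.bound hD hD A.lin31.zeroOn ha hb hc, ev_pa_P12_three (hd := hd),
    ev_three A.bound h₃ ha hb hc, ev_three A.bound h₃ hb ha hc,
    ev_pc_0_1_2 A.bound A.leib.lin2.zeroOn A.lin21.zeroOn ha hb hc] at h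
  simpa only [sgn_two, one_smul] using h

theorem D_l32 {i j l : ℤ} {a b c : Tot L} (hd : Thin ![i, j, l]) (ha : IsH i a) (hb : IsH j b)
    (hc : IsH l c) :
    H1 A.D (H3 A.l32 a b c) - (H3 A.l32 (H1 A.D a) b c + sgn (-1 * i) • H3 A.l32 a (H1 A.D b) c
        + sgn (-1 * (i + j)) • H3 A.l32 a b (H1 A.D c))
      = H3 A.l3 a b c + H3 A.l3 a c b - sgn i • H2 A.l2 a (H2 A.l21 b c)
        + H2 A.l21 (H2 A.l2 a b) c + H2 A.l21 b (H2 A.l2 a c) := by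
  have hD := A.linD.zeroOn
  have h₂ := A.leib.lin2.zeroOn
  have h₃ := A.leib.lin3.zeroOn
  have h₂₁ := A.lin21.zeroOn
  have h := congrArg (fun μ => ev μ ![i, j, l] ![a, b, c]) A.w4
  simp only [ev_add, ev_sub] at h
  rw [ev_bd_three A.bound A.bound hD hD A.lin32.zeroOn ha hb hc, ev_pa_P23_three (hd := hd),
    ev_pa_P12_three (hd := hd), ev_three A.bound h₃ ha hb hc, ev_three A.bound h₃ ha hc hb,
    ev_pc_1_0_2 A.bound h₂ h₂₁ ha hb hc, ev_pc_0_1_2 A.bound h₂₁ h₂ ha hb hc,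
    ev_pc_1_0_2 A.bound h₂₁ h₂ hb ha hc] at h
  simpa only [sgn_two, one_smul, zero_mul, one_mul, sgn_zero] using h

end WeakLie3

end WeakLie

section WeakMorphism

variable {k : Type} [CommRing k] {L M : ℤ → Type} [∀ i, AddCommGroup (L i)]
  [∀ i, Module k (L i)] [∀ i, AddCommGroup (M i)] [∀ i, Module k (M i)]
  {A : WeakLie3 k L} {B : WeakLie3 k M} {f1 : MMap L M 1 0} {f2 : MMap L M 2 1}
  {f21 : MMap L M 2 2} {f3 : MMap L M 3 2} (hf : IsWeakMorphism k A B f1 f2 f21 f3)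
include hf

namespace IsWeakMorphism

theorem D_f1 {i : ℤ} {a : Tot L} (ha : IsH i a) : H1 B.D (H1 f1 a) = H1 f1 (H1 A.D a) := by
  have h := congrArg (fun μ => ev μ ![i] ![a]) hf.m1
  simp only [ev_zero] at h
  rw [ev_bd_one A.bound B.bound B.linD.zeroOn A.linD.zeroOn hf.lin1.zeroOn ha, sgn_zero,
    one_smul] at h
  exact sub_eq_zero.1 h

theorem D_f2 {i j : ℤ} {a b : Tot L} (ha : IsH i a) (hb : IsH j b) :
    H1 B.D (H2 f2 a b) + H2 f2 (H1 A.D a) b + sgn (-1 * i) • H2 f2 a (H1 A.D b)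
      = H1 f1 (H2 A.l2 a b) - H2 B.l2 (H1 f1 a) (H1 f1 b) := by
  have g₁ := hf.lin1.zeroOn
  have h := congrArg (fun μ => ev μ ![i, j] ![a, b]) hf.m2
  simp only [ev_sub] at h
  rw [ev_bd_two A.bound B.bound B.linD.zeroOn A.linD.zeroOn hf.lin2.zeroOn ha hb,
    ev_fc_2 A.bound A.bound g₁ A.leib.lin2.zeroOn ha hb,
    ev_fc_1_1 A.bound B.bound B.leib.lin2.zeroOn g₁ g₁ ha hb, sgn_one, zero_mul, sgn_zero,
    one_smul] at h
  rw [← h]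
  module

theorem D_f3 {i j l : ℤ} {a b c : Tot L} (hd : Thin ![i, j, l]) (ha : IsH i a) (hb : IsH j b)
    (hc : IsH l c) :
    H1 B.D (H3 f3 a b c) - (H3 f3 (H1 A.D a) b c + sgn (-1 * i) • H3 f3 a (H1 A.D b) c
        + sgn (-1 * (i + j)) • H3 f3 a b (H1 A.D c))
      = H1 f1 (H3 A.l3 a b c) - H2 f2 a (H2 A.l2 b c) + H2 f2 (H2 A.l2 a b) c
        + H2 f2 b (H2 A.l2 a c) - H3 B.l3 (H1 f1 a) (H1 f1 b) (H1 f1 c)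
        - sgn i • H2 B.l2 (H1 f1 a) (H2 f2 b c) + H2 B.l2 (H2 f2 a b) (H1 f1 c)
        + sgn j • H2 B.l2 (H1 f1 b) (H2 f2 a c) := by
  have h := congrArg (fun μ => ev μ ![i, j, l] ![a, b, c]) hf.m3
  rw [ev_bd_three A.bound B.bound B.linD.zeroOn A.linD.zeroOn hf.lin3.zeroOn ha hb hc,
    ev_morphism_three A.bound B.bound A.leib.lin2.zeroOn A.leib.lin3.zeroOn B.leib.lin2.zeroOn
      B.leib.lin3.zeroOn hf.lin1.zeroOn hf.lin2.zeroOn hd ha hb hc] at h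
  simpa only [sgn_two, one_smul] using h

theorem D_f21 {i j : ℤ} {a b : Tot L} (ha : IsH i a) (hb : IsH j b) :
    H1 B.D (H2 f21 a b) - (H2 f21 (H1 A.D a) b + sgn (-1 * i) • H2 f21 a (H1 A.D b))
      = - H2 f2 a b - sgn (i * j) • H2 f2 b a + H1 f1 (H2 A.l21 a b)
        - H2 B.l21 (H1 f1 a) (H1 f1 b) := by
  have g₁ := hf.lin1.zeroOn
  have g₂ := hf.lin2.zeroOn
  have h := congrArg (fun μ => ev μ ![i, j] ![a, b]) hf.m5
  simp only [ev_sub, ev_add, ev_neg] at h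
  rw [ev_bd_two A.bound B.bound B.linD.zeroOn A.linD.zeroOn hf.lin21.zeroOn ha hb,
    ev_pa_P12_two, ev_two A.bound g₂ ha hb, ev_two A.bound g₂ hb ha,
    ev_fc_2 A.bound A.bound g₁ A.lin21.zeroOn ha hb,
    ev_fc_1_1 A.bound B.bound B.lin21.zeroOn g₁ g₁ ha hb] at h
  simpa only [sgn_two, one_smul, zero_mul, sgn_zero] using h

theorem f1_l31 {i j l : ℤ} {a b c : Tot L} (hd : Thin ![i, j, l]) (ha : IsH i a) (hb : IsH j b)
    (hc : IsH l c) :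
    H1 f1 (H3 A.l31 a b c) - H3 B.l31 (H1 f1 a) (H1 f1 b) (H1 f1 c)
      = H3 f3 a b c + H3 f3 b a c + H2 f2 (H2 A.l21 a b) c
        + H2 B.l2 (H2 f21 a b) (H1 f1 c) := by
  have g₁ := hf.lin1.zeroOn
  have g₃ := hf.lin3.zeroOn
  have h := congrArg (fun μ => ev μ ![i, j, l] ![a, b, c]) hf.m7
  simp only [ev_sub, ev_add] at h
  rw [ev_fc_3 A.bound A.bound g₁ A.lin31.zeroOn ha hb hc,
    ev_fc_1_1_1 A.bound B.bound B.lin31.zeroOn g₁ g₁ g₁ ha hb hc, ev_pa_P12_three (hd := hd),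
    ev_three A.bound g₃ ha hb hc, ev_three A.bound g₃ hb ha hc,
    ev_pc_0_1_2 A.bound hf.lin2.zeroOn A.lin21.zeroOn ha hb hc,
    ev_fc_2_1 A.bound B.bound B.leib.lin2.zeroOn hf.lin21.zeroOn g₁ ha hb hc] at h
  simpa only [one_smul, zero_mul, add_zero, sgn_zero] using h

theorem f1_l32 {i j l : ℤ} {a b c : Tot L} (hd : Thin ![i, j, l]) (ha : IsH i a) (hb : IsH j b)
    (hc : IsH l c) :
    H1 f1 (H3 A.l32 a b c) - H3 B.l32 (H1 f1 a) (H1 f1 b) (H1 f1 c)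
      = H3 f3 a b c + H3 f3 a c b - sgn i • H2 f2 a (H2 A.l21 b c)
        + H2 f21 (H2 A.l2 a b) c + H2 f21 b (H2 A.l2 a c)
        - sgn (2 * i) • H2 B.l2 (H1 f1 a) (H2 f21 b c) - H2 B.l21 (H2 f2 a b) (H1 f1 c)
        - sgn j • H2 B.l21 (H1 f1 b) (H2 f2 a c) := by
  have g₁ := hf.lin1.zeroOn
  have g₂ := hf.lin2.zeroOn
  have g₃ := hf.lin3.zeroOn
  have g₂₁ := hf.lin21.zeroOn
  have h := congrArg (fun μ => ev μ ![i, j, l] ![a, b, c]) hf.m8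
  simp only [ev_sub, ev_add] at h
  rw [ev_fc_3 A.bound A.bound g₁ A.lin32.zeroOn ha hb hc,
    ev_fc_1_1_1 A.bound B.bound B.lin32.zeroOn g₁ g₁ g₁ ha hb hc, ev_pa_P23_three (hd := hd),
    ev_three A.bound g₃ ha hb hc, ev_three A.bound g₃ ha hc hb,
    ev_pc_1_0_2 A.bound g₂ A.lin21.zeroOn ha hb hc,
    ev_pc_0_1_2 A.bound g₂₁ A.leib.lin2.zeroOn ha hb hc, ev_pa_P12_three (hd := hd),
    ev_pc_1_0_2 A.bound g₂₁ A.leib.lin2.zeroOn hb ha hc,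
    ev_fc_1_2 A.bound B.bound B.leib.lin2.zeroOn g₁ g₂₁ ha hb hc,
    ev_fc_2_1 A.bound B.bound B.lin21.zeroOn g₂ g₁ ha hb hc, ev_pa_P12_three (hd := hd),
    ev_fc_1_2 A.bound B.bound B.lin21.zeroOn g₁ g₂ hb ha hc] at h
  simpa only [one_smul, zero_mul, add_zero, sgn_zero, one_mul] using h

theorem f1_l4 {a b c e : Tot L} (ha : IsH 0 a) (hb : IsH 0 b) (hc : IsH 0 c) (he : IsH 0 e) :
    H1 f1 (H4 A.l4 a b c e) - H4 B.l4 (H1 f1 a) (H1 f1 b) (H1 f1 c) (H1 f1 e)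
      = H2 f2 (H3 A.l3 a b c) e + H2 f2 a (H3 A.l3 b c e) - H2 f2 b (H3 A.l3 a c e)
        + H2 f2 c (H3 A.l3 a b e) - H3 f3 (H2 A.l2 a b) c e + H3 f3 a (H2 A.l2 b c) e
        - H3 f3 b (H2 A.l2 a c) e - H3 f3 a b (H2 A.l2 c e) + H3 f3 a c (H2 A.l2 b e)
        - H3 f3 b c (H2 A.l2 a e) + H2 B.l2 (H3 f3 a b c) (H1 f1 e)
        + H2 B.l2 (H1 f1 a) (H3 f3 b c e) - H2 B.l2 (H1 f1 b) (H3 f3 a c e)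
        + H2 B.l2 (H1 f1 c) (H3 f3 a b e) - H2 B.l2 (H2 f2 a b) (H2 f2 c e)
        + H2 B.l2 (H2 f2 a c) (H2 f2 b e) - H2 B.l2 (H2 f2 b c) (H2 f2 a e)
        + H3 B.l3 (H2 f2 a b) (H1 f1 c) (H1 f1 e) - H3 B.l3 (H1 f1 a) (H2 f2 b c) (H1 f1 e)
        + H3 B.l3 (H1 f1 b) (H2 f2 a c) (H1 f1 e) + H3 B.l3 (H1 f1 a) (H1 f1 b) (H2 f2 c e)
        - H3 B.l3 (H1 f1 a) (H1 f1 c) (H2 f2 b e)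
        + H3 B.l3 (H1 f1 b) (H1 f1 c) (H2 f2 a e) := by
  have g₁ := hf.lin1.zeroOn
  have h := congrArg (fun μ => ev μ ![0, 0, 0, 0] ![a, b, c, e]) hf.m4
  rw [ev_sub, ev_fc_4 A.bound A.bound g₁ A.leib.lin4.zeroOn ha hb hc he,
    ev_fc_1_1_1_1 A.bound B.bound B.leib.lin4.zeroOn g₁ g₁ g₁ g₁ ha hb hc he,
    ev_morphism_four A.bound B.bound A.leib.lin2.zeroOn A.leib.lin3.zeroOn B.leib.lin2.zeroOn
      B.leib.lin3.zeroOn g₁ hf.lin2.zeroOn hf.lin3.zeroOn ha hb hc he] at h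
  simpa only [one_smul, mul_zero, add_zero, sgn_zero] using h

end IsWeakMorphism

end WeakMorphism

/-! ### The quaternary equation in degree zero -/

section Quaternary

variable {k : Type} [CommRing k] {L M : ℤ → Type} [∀ i, AddCommGroup (L i)]
  [∀ i, Module k (L i)] [∀ i, AddCommGroup (M i)] [∀ i, Module k (M i)]
  {A : WeakLie3 k L} {B : WeakLie3 k M} {f1 : MMap L M 1 0} {f2 : MMap L M 2 1}
  {f21 : MMap L M 2 2} {f3 : MMap L M 3 2}

theorem IsH.zsmul {i : ℤ} {x : Tot L} (n : ℤ) (hx : IsH i x) : IsH i (n • x) :=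
  fun j hj => by rw [Pi.smul_apply, hx j hj, smul_zero]

namespace WeakLie3

variable (A)

theorem D_eq_zero {a : Tot L} (ha : IsH 0 a) : toLin1 A.linD a = 0 :=
  (isH_one A.bound A.linD.zeroOn ha).eq_zero A.bound (by norm_num)

theorem D_l3_zero {a b c : Tot L} (ha : IsH 0 a) (hb : IsH 0 b) (hc : IsH 0 c) :
    toLin1 A.linD (toLin3 A.leib.lin3 a b c)
      = toLin2 A.leib.lin2 a (toLin2 A.leib.lin2 b c)
        - toLin2 A.leib.lin2 (toLin2 A.leib.lin2 a b) c
        - toLin2 A.leib.lin2 b (toLin2 A.leib.lin2 a c) := by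
  have h := A.D_l3 (thin_three rfl rfl rfl) ha hb hc
  simp only [← toLin1_apply A.linD, ← toLin2_apply A.leib.lin2, ← toLin3_apply A.leib.lin3,
    A.D_eq_zero ha, A.D_eq_zero hb, A.D_eq_zero hc, map_zero, LinearMap.zero_apply, smul_zero,
    add_zero] at h
  exact h

theorem l21_D_left {y a : Tot L} (hy : IsH 2 y) (ha : IsH 0 a) :
    toLin2 A.lin21 (toLin1 A.linD y) a
      = toLin2 A.leib.lin2 y a + toLin2 A.leib.lin2 a y := by
  have h := A.D_l21 hy ha
  have h₀ := (isH_two A.bound A.lin21.zeroOn hy ha).eq_zero A.bound (by norm_num)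
  simp only [h₀, ← toLin1_apply A.linD, ← toLin2_apply A.leib.lin2, ← toLin2_apply A.lin21,
    A.D_eq_zero ha, map_zero, smul_zero, add_zero, zero_add, mul_zero, sgn_zero, one_smul] at h
  exact h

theorem l21_D_right {a y : Tot L} (ha : IsH 0 a) (hy : IsH 2 y) :
    toLin2 A.lin21 a (toLin1 A.linD y)
      = toLin2 A.leib.lin2 a y + toLin2 A.leib.lin2 y a := by
  have h := A.D_l21 ha hy
  have h₀ := (isH_two A.bound A.lin21.zeroOn ha hy).eq_zero A.bound (by norm_num)
  simp only [h₀, ← toLin1_apply A.linD, ← toLin2_apply A.leib.lin2, ← toLin2_apply A.lin21,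
    A.D_eq_zero ha, map_zero, LinearMap.zero_apply, zero_add, mul_zero, zero_mul, sgn_zero,
    one_smul] at h
  exact h

theorem l31_D_left {y a b : Tot L} (hy : IsH 1 y) (ha : IsH 0 a) (hb : IsH 0 b) :
    - toLin3 A.lin31 (toLin1 A.linD y) a b
      = toLin3 A.leib.lin3 y a b + toLin3 A.leib.lin3 a y b
        + toLin2 A.leib.lin2 (toLin2 A.lin21 y a) b := by
  have h := A.D_l31 (thin_three rfl rfl rfl) hy ha hb
  have h₀ := (isH_three A.bound A.lin31.zeroOn hy ha hb).eq_zero A.bound (by norm_num)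
  simp only [h₀, ← toLin1_apply A.linD, ← toLin2_apply A.leib.lin2, ← toLin2_apply A.lin21,
    ← toLin3_apply A.leib.lin3, ← toLin3_apply A.lin31, A.D_eq_zero ha, A.D_eq_zero hb, map_zero,
    LinearMap.zero_apply, smul_zero, add_zero, zero_sub] at h
  exact h

theorem l31_D_right {a y b : Tot L} (ha : IsH 0 a) (hy : IsH 1 y) (hb : IsH 0 b) :
    - toLin3 A.lin31 a (toLin1 A.linD y) b
      = toLin3 A.leib.lin3 a y b + toLin3 A.leib.lin3 y a b
        + toLin2 A.leib.lin2 (toLin2 A.lin21 a y) b := by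
  have h := A.D_l31 (thin_three rfl rfl rfl) ha hy hb
  have h₀ := (isH_three A.bound A.lin31.zeroOn ha hy hb).eq_zero A.bound (by norm_num)
  simp only [h₀, ← toLin1_apply A.linD, ← toLin2_apply A.leib.lin2, ← toLin2_apply A.lin21,
    ← toLin3_apply A.leib.lin3, ← toLin3_apply A.lin31, A.D_eq_zero ha, A.D_eq_zero hb, map_zero,
    LinearMap.zero_apply, smul_zero, add_zero, zero_add, zero_sub, mul_zero, sgn_zero,
    one_smul] at h
  exact h

theorem l32_D_left {a y b : Tot L} (ha : IsH 0 a) (hy : IsH 1 y) (hb : IsH 0 b) :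
    - toLin3 A.lin32 a (toLin1 A.linD y) b
      = toLin3 A.leib.lin3 a y b + toLin3 A.leib.lin3 a b y
        - toLin2 A.leib.lin2 a (toLin2 A.lin21 y b) + toLin2 A.lin21 (toLin2 A.leib.lin2 a y) b
        + toLin2 A.lin21 y (toLin2 A.leib.lin2 a b) := by
  have h := A.D_l32 (thin_three rfl rfl rfl) ha hy hb
  have h₀ := (isH_three A.bound A.lin32.zeroOn ha hy hb).eq_zero A.bound (by norm_num)
  simp only [h₀, ← toLin1_apply A.linD, ← toLin2_apply A.leib.lin2, ← toLin2_apply A.lin21,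
    ← toLin3_apply A.leib.lin3, ← toLin3_apply A.lin32, A.D_eq_zero ha, A.D_eq_zero hb, map_zero,
    LinearMap.zero_apply, smul_zero, add_zero, zero_add, zero_sub, mul_zero, sgn_zero,
    one_smul] at h
  exact h

theorem l32_D_right {a b y : Tot L} (ha : IsH 0 a) (hb : IsH 0 b) (hy : IsH 1 y) :
    - toLin3 A.lin32 a b (toLin1 A.linD y)
      = toLin3 A.leib.lin3 a b y + toLin3 A.leib.lin3 a y b
        - toLin2 A.leib.lin2 a (toLin2 A.lin21 b y) + toLin2 A.lin21 (toLin2 A.leib.lin2 a b) y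
        + toLin2 A.lin21 b (toLin2 A.leib.lin2 a y) := by
  have h := A.D_l32 (thin_three rfl rfl rfl) ha hb hy
  have h₀ := (isH_three A.bound A.lin32.zeroOn ha hb hy).eq_zero A.bound (by norm_num)
  simp only [h₀, ← toLin1_apply A.linD, ← toLin2_apply A.leib.lin2, ← toLin2_apply A.lin21,
    ← toLin3_apply A.leib.lin3, ← toLin3_apply A.lin32, A.D_eq_zero ha, A.D_eq_zero hb, map_zero,
    LinearMap.zero_apply, smul_zero, add_zero, zero_add, zero_sub, mul_zero, sgn_zero,
    one_smul] at h
  exact h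

end WeakLie3

variable (hf : IsWeakMorphism k A B f1 f2 f21 f3)
include hf

namespace IsWeakMorphism

theorem D_f2_zero {a b : Tot L} (ha : IsH 0 a) (hb : IsH 0 b) :
    toLin1 B.linD (toLin2 hf.lin2 a b) = toLin1 hf.lin1 (toLin2 A.leib.lin2 a b)
      - toLin2 B.leib.lin2 (toLin1 hf.lin1 a) (toLin1 hf.lin1 b) := by
  have h := hf.D_f2 ha hb
  simp only [← toLin1_apply A.linD, ← toLin1_apply B.linD, ← toLin2_apply A.leib.lin2,
    ← toLin2_apply B.leib.lin2, ← toLin1_apply hf.lin1, ← toLin2_apply hf.lin2,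
    A.D_eq_zero ha, A.D_eq_zero hb, map_zero, LinearMap.zero_apply, smul_zero, add_zero] at h
  exact h

theorem D_f3_zero {a b c : Tot L} (ha : IsH 0 a) (hb : IsH 0 b) (hc : IsH 0 c) :
    toLin1 B.linD (toLin3 hf.lin3 a b c)
      = toLin1 hf.lin1 (toLin3 A.leib.lin3 a b c) - toLin2 hf.lin2 a (toLin2 A.leib.lin2 b c)
        + toLin2 hf.lin2 (toLin2 A.leib.lin2 a b) c + toLin2 hf.lin2 b (toLin2 A.leib.lin2 a c)
        - toLin3 B.leib.lin3 (toLin1 hf.lin1 a) (toLin1 hf.lin1 b) (toLin1 hf.lin1 c)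
        - toLin2 B.leib.lin2 (toLin1 hf.lin1 a) (toLin2 hf.lin2 b c)
        + toLin2 B.leib.lin2 (toLin2 hf.lin2 a b) (toLin1 hf.lin1 c)
        + toLin2 B.leib.lin2 (toLin1 hf.lin1 b) (toLin2 hf.lin2 a c) := by
  have h := hf.D_f3 (thin_three rfl rfl rfl) ha hb hc
  simp only [← toLin1_apply A.linD, ← toLin1_apply B.linD, ← toLin2_apply A.leib.lin2,
    ← toLin2_apply B.leib.lin2, ← toLin3_apply A.leib.lin3, ← toLin3_apply B.leib.lin3,
    ← toLin1_apply hf.lin1, ← toLin2_apply hf.lin2, ← toLin3_apply hf.lin3, A.D_eq_zero ha,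
    A.D_eq_zero hb, A.D_eq_zero hc, map_zero, LinearMap.zero_apply, smul_zero, add_zero, sub_zero,
    sgn_zero, one_smul] at h
  exact h

theorem f21_D_left {x a : Tot L} (hx : IsH 1 x) (ha : IsH 0 a) :
    - toLin2 hf.lin21 (toLin1 A.linD x) a
      = - toLin2 hf.lin2 x a - toLin2 hf.lin2 a x + toLin1 hf.lin1 (toLin2 A.lin21 x a)
        - toLin2 B.lin21 (toLin1 hf.lin1 x) (toLin1 hf.lin1 a) := by
  have h := hf.D_f21 hx ha
  have h₀ := (isH_two A.bound hf.lin21.zeroOn hx ha).eq_zero B.bound (by norm_num)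
  simp only [h₀, ← toLin1_apply A.linD, ← toLin1_apply B.linD, ← toLin1_apply hf.lin1,
    ← toLin2_apply hf.lin2, ← toLin2_apply hf.lin21, ← toLin2_apply A.lin21,
    ← toLin2_apply B.lin21, A.D_eq_zero ha, map_zero, smul_zero, add_zero, zero_sub, mul_zero,
    sgn_zero, one_smul] at h
  exact h

theorem f21_D_right {a x : Tot L} (ha : IsH 0 a) (hx : IsH 1 x) :
    - toLin2 hf.lin21 a (toLin1 A.linD x)
      = - toLin2 hf.lin2 a x - toLin2 hf.lin2 x a + toLin1 hf.lin1 (toLin2 A.lin21 a x)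
        - toLin2 B.lin21 (toLin1 hf.lin1 a) (toLin1 hf.lin1 x) := by
  have h := hf.D_f21 ha hx
  have h₀ := (isH_two A.bound hf.lin21.zeroOn ha hx).eq_zero B.bound (by norm_num)
  simp only [h₀, ← toLin1_apply A.linD, ← toLin1_apply B.linD, ← toLin1_apply hf.lin1,
    ← toLin2_apply hf.lin2, ← toLin2_apply hf.lin21, ← toLin2_apply A.lin21,
    ← toLin2_apply B.lin21, A.D_eq_zero ha, map_zero, LinearMap.zero_apply, zero_add, zero_sub,
    mul_zero, zero_mul, sgn_zero, one_smul] at h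
  exact h

theorem f1_l31_zero {a b c : Tot L} (ha : IsH 0 a) (hb : IsH 0 b) (hc : IsH 0 c) :
    toLin1 hf.lin1 (toLin3 A.lin31 a b c)
        - toLin3 B.lin31 (toLin1 hf.lin1 a) (toLin1 hf.lin1 b) (toLin1 hf.lin1 c)
      = toLin3 hf.lin3 a b c + toLin3 hf.lin3 b a c + toLin2 hf.lin2 (toLin2 A.lin21 a b) c
        + toLin2 B.leib.lin2 (toLin2 hf.lin21 a b) (toLin1 hf.lin1 c) :=
  hf.f1_l31 (thin_three rfl rfl rfl) ha hb hc

theorem f1_l32_zero {a b c : Tot L} (ha : IsH 0 a) (hb : IsH 0 b) (hc : IsH 0 c) :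
    toLin1 hf.lin1 (toLin3 A.lin32 a b c)
        - toLin3 B.lin32 (toLin1 hf.lin1 a) (toLin1 hf.lin1 b) (toLin1 hf.lin1 c)
      = toLin3 hf.lin3 a b c + toLin3 hf.lin3 a c b - toLin2 hf.lin2 a (toLin2 A.lin21 b c)
        + toLin2 hf.lin21 (toLin2 A.leib.lin2 a b) c + toLin2 hf.lin21 b (toLin2 A.leib.lin2 a c)
        - toLin2 B.leib.lin2 (toLin1 hf.lin1 a) (toLin2 hf.lin21 b c)
        - toLin2 B.lin21 (toLin2 hf.lin2 a b) (toLin1 hf.lin1 c)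
        - toLin2 B.lin21 (toLin1 hf.lin1 b) (toLin2 hf.lin2 a c) := by
  have h := hf.f1_l32 (thin_three rfl rfl rfl) ha hb hc
  simp only [mul_zero, sgn_zero, one_smul] at h
  exact h

/-- The quaternary morphism equation for the alternating sums of the structure maps. -/
theorem alternating_four (l2 : Tot L → Tot L → Tot L) (hl2 : l2 = alt2 (H2 A.l2))
    (l3 : Tot L → Tot L → Tot L → Tot L)
    (hl3 : l3 = alt3 (pre3 (H2 A.l2) (H3 A.l3) (H2 A.l21)))
    (l4 : Tot L → Tot L → Tot L → Tot L → Tot L)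
    (hl4 : l4 = alt4 (pre4 (H2 A.l2) (H3 A.l3) (H4 A.l4) (H2 A.l21) (H3 A.l31) (H3 A.l32)))
    (b2 : Tot M → Tot M → Tot M) (hb2 : b2 = alt2 (H2 B.l2))
    (b3 : Tot M → Tot M → Tot M → Tot M)
    (hb3 : b3 = alt3 (pre3 (H2 B.l2) (H3 B.l3) (H2 B.l21)))
    (b4 : Tot M → Tot M → Tot M → Tot M → Tot M)
    (hb4 : b4 = alt4 (pre4 (H2 B.l2) (H3 B.l3) (H4 B.l4) (H2 B.l21) (H3 B.l31) (H3 B.l32)))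
    (g2 : Tot L → Tot L → Tot M) (hg2 : g2 = alt2 (H2 f2))
    (g3 : Tot L → Tot L → Tot L → Tot M)
    (hg3 : g3 = alt3 (preMor3 (H2 A.l2) (H1 f1) (H2 f2) (H2 f21) (H3 f3) (H2 B.l21)))
    {a b c e : Tot L} (ha : IsH 0 a) (hb : IsH 0 b) (hc : IsH 0 c) (he : IsH 0 e) :
    H1 f1 (l4 a b c e) - b4 (H1 f1 a) (H1 f1 b) (H1 f1 c) (H1 f1 e)
      = (g2 (l3 a b c) e + g2 a (l3 b c e) - g2 b (l3 a c e) + g2 c (l3 a b e))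
        - (g3 (l2 a b) c e - g3 a (l2 b c) e + g3 b (l2 a c) e + g3 a b (l2 c e)
          - g3 a c (l2 b e) + g3 b c (l2 a e))
        + (b2 (g3 a b c) (H1 f1 e) + b2 (H1 f1 a) (g3 b c e) - b2 (H1 f1 b) (g3 a c e)
          + b2 (H1 f1 c) (g3 a b e))
        - (6 : ℤ) • ((H2 B.l2 (g2 a b) (g2 c e) + H2 B.l2 (g2 c e) (g2 a b))
          - (H2 B.l2 (g2 a c) (g2 b e) + H2 B.l2 (g2 b e) (g2 a c))
          + (H2 B.l2 (g2 b c) (g2 a e) + H2 B.l2 (g2 a e) (g2 b c)))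
        + (b3 (g2 a b) (H1 f1 c) (H1 f1 e) - b3 (H1 f1 a) (g2 b c) (H1 f1 e)
          + b3 (H1 f1 b) (g2 a c) (H1 f1 e) + b3 (H1 f1 a) (H1 f1 b) (g2 c e)
          - b3 (H1 f1 a) (H1 f1 c) (g2 b e) + b3 (H1 f1 b) (H1 f1 c) (g2 a e)) := by
  exact quaternary_relation (IsH 0) (toLin1 hf.lin1) (toLin2 hf.lin2) (toLin2 hf.lin21)
    (toLin3 hf.lin3) (toLin2 A.leib.lin2) (toLin2 A.lin21) (toLin3 A.leib.lin3)
    (toLin3 A.lin31) (toLin3 A.lin32) (H4 A.l4) (toLin2 B.leib.lin2) (toLin2 B.lin21)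
    (toLin3 B.leib.lin3) (toLin3 B.lin31) (toLin3 B.lin32) (H4 B.l4) l2 hl2 l3 hl3 l4 hl4
    b2 hb2 b3 hb3 b4 hb4 g2 hg2 g3 hg3
    (fun a b c e ha hb hc he => by
      have h := hf.f1_l4 ha hb hc he
      simp only [← toLin1_apply hf.lin1, ← toLin2_apply hf.lin2, ← toLin3_apply hf.lin3, 
        ← toLin2_apply A.leib.lin2, ← toLin2_apply B.leib.lin2, ← toLin3_apply A.leib.lin3,
        ← toLin3_apply B.leib.lin3] at h
      linear_combination (norm := module) h)
    (fun a b c e ha hb hc he => by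
      have h := hf.f21_D_left (isH_three A.bound A.leib.lin3.zeroOn ha hb hc) he
      rw [← toLin3_apply A.leib.lin3, A.D_l3_zero ha hb hc] at h
      simp only [map_sub, LinearMap.sub_apply] at h
      linear_combination (norm := module) -h)
    (fun a b c e ha hb hc he => by
      have h := hf.f21_D_right ha (isH_three A.bound A.leib.lin3.zeroOn hb hc he)
      rw [← toLin3_apply A.leib.lin3, A.D_l3_zero hb hc he] at h
      simp only [map_sub] at h
      linear_combination (norm := module) -h)
    (fun a b c e ha hb hc he => by
      have h := hf.f1_l31_zero (isH_two A.bound A.leib.lin2.zeroOn ha hb) hc he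
      rw [← toLin2_apply A.leib.lin2] at h
      linear_combination (norm := module) h)
    (fun a b c e ha hb hc he => by
      have h := hf.f1_l31_zero ha (isH_two A.bound A.leib.lin2.zeroOn hb hc) he
      rw [← toLin2_apply A.leib.lin2] at h
      linear_combination (norm := module) h)
    (fun a b c e ha hb hc he => by
      have h := hf.f1_l32_zero ha (isH_two A.bound A.leib.lin2.zeroOn hb hc) he
      rw [← toLin2_apply A.leib.lin2] at h
      linear_combination (norm := module) h)
    (fun a b c e ha hb hc he => by
      have h := hf.f1_l32_zero ha hb (isH_two A.bound A.leib.lin2.zeroOn hc he)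
      rw [← toLin2_apply A.leib.lin2] at h
      linear_combination (norm := module) h)
    (fun a b c e ha hb hc he => by
      have h := B.l21_D_left (isH_three A.bound hf.lin3.zeroOn ha hb hc)
        (isH_one A.bound hf.lin1.zeroOn he)
      rw [← toLin3_apply hf.lin3, ← toLin1_apply hf.lin1, hf.D_f3_zero ha hb hc] at h
      simp only [map_sub, map_add, LinearMap.sub_apply, LinearMap.add_apply] at h
      linear_combination (norm := module) h)
    (fun a b c e ha hb hc he => by
      have h := B.l21_D_right (isH_one A.bound hf.lin1.zeroOn ha)
        (isH_three A.bound hf.lin3.zeroOn hb hc he)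
      rw [← toLin3_apply hf.lin3, ← toLin1_apply hf.lin1, hf.D_f3_zero hb hc he] at h
      simp only [map_sub, map_add] at h
      linear_combination (norm := module) h)
    (fun a b c e ha hb hc he => by
      have h := B.l31_D_left (isH_two A.bound hf.lin2.zeroOn ha hb)
        (isH_one A.bound hf.lin1.zeroOn hc) (isH_one A.bound hf.lin1.zeroOn he)
      simp only [← toLin2_apply hf.lin2, ← toLin1_apply hf.lin1, hf.D_f2_zero ha hb, map_sub,
        LinearMap.sub_apply] at h
      linear_combination (norm := module) -h)
    (fun a b c e ha hb hc he => by
      have h := B.l31_D_right (isH_one A.bound hf.lin1.zeroOn ha)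
        (isH_two A.bound hf.lin2.zeroOn hb hc) (isH_one A.bound hf.lin1.zeroOn he)
      simp only [← toLin2_apply hf.lin2, ← toLin1_apply hf.lin1, hf.D_f2_zero hb hc, map_sub,
        LinearMap.sub_apply] at h
      linear_combination (norm := module) -h)
    (fun a b c e ha hb hc he => by
      have h := B.l32_D_left (isH_one A.bound hf.lin1.zeroOn ha)
        (isH_two A.bound hf.lin2.zeroOn hb hc) (isH_one A.bound hf.lin1.zeroOn he)
      simp only [← toLin2_apply hf.lin2, ← toLin1_apply hf.lin1, hf.D_f2_zero hb hc, map_sub,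
        LinearMap.sub_apply] at h
      linear_combination (norm := module) -h)
    (fun a b c e ha hb hc he => by
      have h := B.l32_D_right (isH_one A.bound hf.lin1.zeroOn ha)
        (isH_one A.bound hf.lin1.zeroOn hb) (isH_two A.bound hf.lin2.zeroOn hc he)
      simp only [← toLin2_apply hf.lin2, ← toLin1_apply hf.lin1, hf.D_f2_zero hc he, map_sub]
        at h
      linear_combination (norm := module) -h)
    ha hb hc he

variable [Invertible (2 : k)] [Invertible (3 : k)]

theorem skew_four {l₂ : MMap L L 2 0} (hl₂ : l₂ = skew2 k A) {l₃ : MMap L L 3 1}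
    (hl₃ : l₃ = skew3 k A) {b₂ : MMap M M 2 0} (hb₂ : b₂ = skew2 k B) {b₃ : MMap M M 3 1}
    (hb₃ : b₃ = skew3 k B) {f₂ : MMap L M 2 1} (hf₂ : f₂ = skewMor2 k f2) {f₃ : MMap L M 3 2}
    (hf₃ : f₃ = skewMor3 k A B f1 f2 f21 f3) {a b c e : Tot L} (ha : IsH 0 a) (hb : IsH 0 b)
    (hc : IsH 0 c) (he : IsH 0 e) :
    H1 f1 (H4 (skew4 k A) a b c e)
        - H4 (skew4 k B) (H1 f1 a) (H1 f1 b) (H1 f1 c) (H1 f1 e)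
      = H2 f₂ (H3 l₃ a b c) e + H2 f₂ a (H3 l₃ b c e) - H2 f₂ b (H3 l₃ a c e)
        + H2 f₂ c (H3 l₃ a b e) - H3 f₃ (H2 l₂ a b) c e + H3 f₃ a (H2 l₂ b c) e
        - H3 f₃ b (H2 l₂ a c) e - H3 f₃ a b (H2 l₂ c e) + H3 f₃ a c (H2 l₂ b e)
        - H3 f₃ b c (H2 l₂ a e) + H2 b₂ (H3 f₃ a b c) (H1 f1 e)
        + H2 b₂ (H1 f1 a) (H3 f₃ b c e) - H2 b₂ (H1 f1 b) (H3 f₃ a c e)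
        + H2 b₂ (H1 f1 c) (H3 f₃ a b e) - H2 b₂ (H2 f₂ a b) (H2 f₂ c e)
        + H2 b₂ (H2 f₂ a c) (H2 f₂ b e) - H2 b₂ (H2 f₂ b c) (H2 f₂ a e)
        + H3 b₃ (H2 f₂ a b) (H1 f1 c) (H1 f1 e) - H3 b₃ (H1 f1 a) (H2 f₂ b c) (H1 f1 e)
        + H3 b₃ (H1 f1 b) (H2 f₂ a c) (H1 f1 e) + H3 b₃ (H1 f1 a) (H1 f1 b) (H2 f₂ c e)
        - H3 b₃ (H1 f1 a) (H1 f1 c) (H2 f₂ b e)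
        + H3 b₃ (H1 f1 b) (H1 f1 c) (H2 f₂ a e) := by
  subst hl₂ hl₃ hb₂ hb₃ hf₂ hf₃
  have F1 : ∀ {x}, IsH 0 x → IsH 0 (H1 f1 x) := fun hx => isH_one A.bound hf.lin1.zeroOn hx
  have mA2 := isMultilinear_skew2 k A
  have mA3 := isMultilinear_skew3 k A
  have mB2 := isMultilinear_skew2 k B
  have mB3 := isMultilinear_skew3 k B
  have m2 := isMultilinear_skewMor2 k A.bound hf.lin2
  have m3 := isMultilinear_skewMor3 k hf
  obtain ⟨l2, hl2⟩ : ∃ l2, l2 = alt2 (H2 A.l2) := ⟨_, rfl⟩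
  obtain ⟨l3, hl3⟩ : ∃ l3, l3 = alt3 (pre3 (H2 A.l2) (H3 A.l3) (H2 A.l21)) := ⟨_, rfl⟩
  obtain ⟨l4, hl4⟩ : ∃ l4, l4 = alt4 (pre4 (H2 A.l2) (H3 A.l3) (H4 A.l4) (H2 A.l21) (H3 A.l31)
    (H3 A.l32)) := ⟨_, rfl⟩
  obtain ⟨b2, hb2⟩ : ∃ b2, b2 = alt2 (H2 B.l2) := ⟨_, rfl⟩
  obtain ⟨b3, hb3⟩ : ∃ b3, b3 = alt3 (pre3 (H2 B.l2) (H3 B.l3) (H2 B.l21)) := ⟨_, rfl⟩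
  obtain ⟨b4, hb4⟩ : ∃ b4, b4 = alt4 (pre4 (H2 B.l2) (H3 B.l3) (H4 B.l4) (H2 B.l21) (H3 B.l31)
    (H3 B.l32)) := ⟨_, rfl⟩
  obtain ⟨g2, hg2⟩ : ∃ g2, g2 = alt2 (H2 f2) := ⟨_, rfl⟩
  obtain ⟨g3, hg3⟩ : ∃ g3, g3 = alt3 (preMor3 (H2 A.l2) (H1 f1) (H2 f2) (H2 f21) (H3 f3)
    (H2 B.l21)) := ⟨_, rfl⟩
  have key := hf.alternating_four l2 hl2 l3 hl3 l4 hl4 b2 hb2 b3 hb3 b4 hb4 g2 hg2 g3 hg3 ha hb hc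
    he
  have el2 : ∀ {x y}, IsH 0 x → IsH 0 y → l2 x y = (2 : ℤ) • toLin2 mA2 x y := by
    intro x y hx hy
    rw [toLin2_apply, two_zsmul_skew2 k A hx hy, hl2, alt2, mul_zero, sgn_zero, one_smul]
  have el3 : ∀ {x y z}, IsH 0 x → IsH 0 y → IsH 0 z → l3 x y z = (24 : ℤ) • toLin3 mA3 x y z :=
    fun hx hy hz => hl3 ▸ (zsmul_skew3 k A (thin_three rfl rfl rfl) hx hy hz).symm
  have eb2 : ∀ {x y i j}, i * j = 0 → IsH i x → IsH j y → b2 x y = (2 : ℤ) • toLin2 mB2 x y := by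
    intro x y i j h hx hy
    rw [toLin2_apply, two_zsmul_skew2 k B hx hy, hb2, alt2, h, sgn_zero, one_smul]
  have eb3 : ∀ {x y z i j l}, Thin ![i, j, l] → IsH i x → IsH j y → IsH l z →
      b3 x y z = (24 : ℤ) • toLin3 mB3 x y z :=
    fun h hx hy hz => hb3 ▸ (zsmul_skew3 k B h hx hy hz).symm
  have eg2 : ∀ {x y i j}, i * j = 0 → IsH i x → IsH j y → g2 x y = (2 : ℤ) • toLin2 m2 x y := by
    intro x y i j h hx hy
    rw [toLin2_apply, two_zsmul_skewMor2 k A.bound hf.lin2 hx hy, hg2, alt2, h, sgn_zero, one_smul]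
  have eg3 : ∀ {x y z}, IsH 0 x → IsH 0 y → IsH 0 z → g3 x y z = (24 : ℤ) • toLin3 m3 x y z := by
    intro x y z hx hy hz
    rw [toLin3_apply, zsmul_skewMor3 k hf (thin_three rfl rfl rfl) hx hy hz, hg3]
    exact alt3_congr _ _ _ _ _ (fun x y z => IsH 0 x ∧ IsH 0 y ∧ IsH 0 z)
      (fun x y z h => by rw [preMor3, h.1.signOp k, sgn_zero, one_smul])
      (fun _ _ _ h => ⟨h.2.1, h.1, h.2.2⟩) (fun _ _ _ h => ⟨h.1, h.2.2, h.2.1⟩) ⟨hx, hy, hz⟩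
  have esymm : ∀ {x y}, IsH 1 x → IsH 1 y →
      H2 B.l2 x y + H2 B.l2 y x = (2 : ℤ) • toLin2 mB2 x y := by
    intro x y hx hy
    rw [toLin2_apply, two_zsmul_skew2 k B hx hy, mul_one, sgn_one]
    module
  have D2 : ∀ {x y}, IsH 0 x → IsH 0 y → IsH 0 (toLin2 mA2 x y) :=
    fun hx hy => isH_two A.bound mA2.zeroOn hx hy
  have D3 : ∀ {x y z}, IsH 0 x → IsH 0 y → IsH 0 z → IsH 1 (toLin3 mA3 x y z) :=
    fun hx hy hz => isH_three A.bound mA3.zeroOn hx hy hz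
  have G2 : ∀ {x y}, IsH 0 x → IsH 0 y → IsH 1 (toLin2 m2 x y) :=
    fun hx hy => isH_two A.bound m2.zeroOn hx hy
  have G3 : ∀ {x y z}, IsH 0 x → IsH 0 y → IsH 0 z → IsH 2 (toLin3 m3 x y z) :=
    fun hx hy hz => isH_three A.bound m3.zeroOn hx hy hz
  apply zsmul_fortyeight_cancel k
  have e4 : (48 : ℤ) • (H1 f1 (H4 (skew4 k A) a b c e)
        - H4 (skew4 k B) (H1 f1 a) (H1 f1 b) (H1 f1 c) (H1 f1 e))
      = H1 f1 (l4 a b c e) - b4 (H1 f1 a) (H1 f1 b) (H1 f1 c) (H1 f1 e) := by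
    rw [smul_sub, zsmul_skew4 k B (F1 ha) (F1 hb) (F1 hc) (F1 he), hb4, hl4,
      ← zsmul_skew4 k A ha hb hc he]
    exact congrArg (· - _) (map_zsmul (toLin1 hf.lin1) 48 _).symm
  rw [e4, key]
  rw [el2 ha hb, el2 ha hc, el2 ha he, el2 hb hc, el2 hb he, el2 hc he, el3 ha hb hc, el3 ha hb he,
    el3 ha hc he, el3 hb hc he, eg3 ha hb hc, eg3 ha hb he, eg3 ha hc he, eg3 hb hc he,
    eg3 ((D2 ha hb).zsmul _) hc he, eg3 ha ((D2 hb hc).zsmul _) he,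
    eg3 hb ((D2 ha hc).zsmul _) he, eg3 ha hb ((D2 hc he).zsmul _),
    eg3 ha hc ((D2 hb he).zsmul _), eg3 hb hc ((D2 ha he).zsmul _),
    eg2 (zero_mul 0) ha hb, eg2 (zero_mul 0) ha hc, eg2 (zero_mul 0) ha he, eg2 (zero_mul 0) hb hc,
    eg2 (zero_mul 0) hb he, eg2 (zero_mul 0) hc he,
    eg2 (mul_zero 1) ((D3 ha hb hc).zsmul _) he, eg2 (zero_mul 1) ha ((D3 hb hc he).zsmul _),
    eg2 (zero_mul 1) hb ((D3 ha hc he).zsmul _), eg2 (zero_mul 1) hc ((D3 ha hb he).zsmul _),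
    eb2 (mul_zero 2) ((G3 ha hb hc).zsmul _) (F1 he),
    eb2 (zero_mul 2) (F1 ha) ((G3 hb hc he).zsmul _),
    eb2 (zero_mul 2) (F1 hb) ((G3 ha hc he).zsmul _),
    eb2 (zero_mul 2) (F1 hc) ((G3 ha hb he).zsmul _),
    esymm ((G2 ha hb).zsmul _) ((G2 hc he).zsmul _),
    esymm ((G2 ha hc).zsmul _) ((G2 hb he).zsmul _),
    esymm ((G2 hb hc).zsmul _) ((G2 ha he).zsmul _),
    eb3 (thin_three rfl rfl rfl) ((G2 ha hb).zsmul _) (F1 hc) (F1 he),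
    eb3 (thin_three rfl rfl rfl) (F1 ha) ((G2 hb hc).zsmul _) (F1 he),
    eb3 (thin_three rfl rfl rfl) (F1 hb) ((G2 ha hc).zsmul _) (F1 he),
    eb3 (thin_three rfl rfl rfl) (F1 ha) (F1 hb) ((G2 hc he).zsmul _),
    eb3 (thin_three rfl rfl rfl) (F1 ha) (F1 hc) ((G2 hb he).zsmul _),
    eb3 (thin_three rfl rfl rfl) (F1 hb) (F1 hc) ((G2 ha he).zsmul _)]
  simp only [← toLin2_apply mA2, ← toLin3_apply mA3, ← toLin2_apply mB2, ← toLin3_apply mB3,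
    ← toLin2_apply m2, ← toLin3_apply m3, map_zsmul, LinearMap.smul_apply]
  module

end IsWeakMorphism

end Quaternary

/-! ### The ternary equation in total degree at most one -/

section Ternary

variable {k : Type} [CommRing k] {L M : ℤ → Type} [∀ i, AddCommGroup (L i)]
  [∀ i, Module k (L i)] [∀ i, AddCommGroup (M i)] [∀ i, Module k (M i)]
  {A : WeakLie3 k L} {B : WeakLie3 k M} {f1 : MMap L M 1 0} {f2 : MMap L M 2 1}
  {f21 : MMap L M 2 2} {f3 : MMap L M 3 2}

/-- Homogeneous triples of elements of nonnegative degrees, of total degree at most one. -/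
inductive IsLow : Tot L → Tot L → Tot L → Prop
  | zero {a b c : Tot L} : IsH 0 a → IsH 0 b → IsH 0 c → IsLow a b c
  | left {a b c : Tot L} : IsH 1 a → IsH 0 b → IsH 0 c → IsLow a b c
  | mid {a b c : Tot L} : IsH 0 a → IsH 1 b → IsH 0 c → IsLow a b c
  | right {a b c : Tot L} : IsH 0 a → IsH 0 b → IsH 1 c → IsLow a b c

theorem IsLow.swap_left {a b c : Tot L} : IsLow a b c → IsLow b a c
  | .zero ha hb hc => .zero hb ha hc
  | .left ha hb hc => .mid hb ha hc
  | .mid ha hb hc => .left hb ha hc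
  | .right ha hb hc => .right hb ha hc

theorem IsLow.swap_right {a b c : Tot L} : IsLow a b c → IsLow a c b
  | .zero ha hb hc => .zero ha hc hb
  | .left ha hb hc => .left ha hc hb
  | .mid ha hb hc => .right ha hc hb
  | .right ha hb hc => .mid ha hc hb

theorem signOp_of_zero {a : Tot L} (ha : IsH 0 a) : signOp k a = a := by
  rw [ha.signOp k, sgn_zero, one_smul]

theorem signOp_of_one {a : Tot L} (ha : IsH 1 a) : signOp k a = -a := by
  rw [ha.signOp k, sgn_one, neg_one_smul]

theorem sgn_neg_two : sgn (-2) = 1 := rfl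

namespace IsWeakMorphism

variable (hf : IsWeakMorphism k A B f1 f2 f21 f3)
include hf

theorem f21_l2_left {a b c : Tot L} {i j l : ℤ} (ha : IsH i a) (hb : IsH j b) (hc : IsH l c) :
    toLin1 B.linD (toLin2 hf.lin21 (toLin2 A.leib.lin2 a b) c)
      - toLin2 hf.lin21 (toLin2 A.leib.lin2 (toLin1 A.linD a) b
        + sgn (-1 * i) • toLin2 A.leib.lin2 a (toLin1 A.linD b)) c
      - sgn (-1 * (0 + (i + j))) • toLin2 hf.lin21 (toLin2 A.leib.lin2 a b) (toLin1 A.linD c)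
      = toLin1 hf.lin1 (toLin2 A.lin21 (toLin2 A.leib.lin2 a b) c)
        - toLin2 hf.lin2 (toLin2 A.leib.lin2 a b) c
        - sgn ((0 + (i + j)) * l) • toLin2 hf.lin2 c (toLin2 A.leib.lin2 a b)
        - toLin2 B.lin21 (toLin1 hf.lin1 (toLin2 A.leib.lin2 a b)) (toLin1 hf.lin1 c) := by
  have h := hf.D_f21 (isH_two A.bound A.leib.lin2.zeroOn ha hb) hc
  rw [A.D_l2 ha hb] at h
  simp only [toLin1_apply, toLin2_apply]
  linear_combination (norm := module) h

theorem f21_l2_right {a b c : Tot L} {i j l : ℤ} (ha : IsH i a) (hb : IsH j b) (hc : IsH l c) :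
    toLin1 B.linD (toLin2 hf.lin21 a (toLin2 A.leib.lin2 b c))
      - toLin2 hf.lin21 (toLin1 A.linD a) (toLin2 A.leib.lin2 b c)
      - sgn (-1 * i) • toLin2 hf.lin21 a (toLin2 A.leib.lin2 (toLin1 A.linD b) c
        + sgn (-1 * j) • toLin2 A.leib.lin2 b (toLin1 A.linD c))
      = toLin1 hf.lin1 (toLin2 A.lin21 a (toLin2 A.leib.lin2 b c))
        - toLin2 hf.lin2 a (toLin2 A.leib.lin2 b c)
        - sgn (i * (0 + (j + l))) • toLin2 hf.lin2 (toLin2 A.leib.lin2 b c) a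
        - toLin2 B.lin21 (toLin1 hf.lin1 a) (toLin1 hf.lin1 (toLin2 A.leib.lin2 b c)) := by
  have h := hf.D_f21 ha (isH_two A.bound A.leib.lin2.zeroOn hb hc)
  rw [A.D_l2 hb hc] at h
  simp only [toLin1_apply, toLin2_apply]
  linear_combination (norm := module) h

theorem l21_f2_left {a b c : Tot L} {i j l : ℤ} (ha : IsH i a) (hb : IsH j b) (hc : IsH l c) :
    toLin1 B.linD (toLin2 B.lin21 (toLin2 hf.lin2 a b) (toLin1 hf.lin1 c))
      + toLin2 B.lin21 (toLin1 hf.lin1 (toLin2 A.leib.lin2 a b)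
        - toLin2 B.leib.lin2 (toLin1 hf.lin1 a) (toLin1 hf.lin1 b)
        - toLin2 hf.lin2 (toLin1 A.linD a) b
        - sgn (-1 * i) • toLin2 hf.lin2 a (toLin1 A.linD b)) (toLin1 hf.lin1 c)
      + sgn (-1 * (1 + (i + j))) • toLin2 B.lin21 (toLin2 hf.lin2 a b)
        (toLin1 hf.lin1 (toLin1 A.linD c))
      = toLin2 B.leib.lin2 (toLin2 hf.lin2 a b) (toLin1 hf.lin1 c)
        + sgn ((1 + (i + j)) * (0 + l)) •
          toLin2 B.leib.lin2 (toLin1 hf.lin1 c) (toLin2 hf.lin2 a b) := by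
  have h := B.D_l21 (isH_two A.bound hf.lin2.zeroOn ha hb) (isH_one A.bound hf.lin1.zeroOn hc)
  rw [hf.D_f1 hc, show H1 B.D (H2 f2 a b) = H1 f1 (H2 A.l2 a b) - H2 B.l2 (H1 f1 a) (H1 f1 b)
    - H2 f2 (H1 A.D a) b - sgn (-1 * i) • H2 f2 a (H1 A.D b) by
      rw [← hf.D_f2 ha hb]; abel] at h
  exact h

theorem l21_f2_right {a b c : Tot L} {i j l : ℤ} (ha : IsH i a) (hb : IsH j b) (hc : IsH l c) :
    toLin1 B.linD (toLin2 B.lin21 (toLin1 hf.lin1 a) (toLin2 hf.lin2 b c))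
      + toLin2 B.lin21 (toLin1 hf.lin1 (toLin1 A.linD a)) (toLin2 hf.lin2 b c)
      + sgn (-1 * (0 + i)) • toLin2 B.lin21 (toLin1 hf.lin1 a)
        (toLin1 hf.lin1 (toLin2 A.leib.lin2 b c)
        - toLin2 B.leib.lin2 (toLin1 hf.lin1 b) (toLin1 hf.lin1 c)
        - toLin2 hf.lin2 (toLin1 A.linD b) c
        - sgn (-1 * j) • toLin2 hf.lin2 b (toLin1 A.linD c))
      = toLin2 B.leib.lin2 (toLin1 hf.lin1 a) (toLin2 hf.lin2 b c)
        + sgn ((0 + i) * (1 + (j + l))) •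
          toLin2 B.leib.lin2 (toLin2 hf.lin2 b c) (toLin1 hf.lin1 a) := by
  have h := B.D_l21 (isH_one A.bound hf.lin1.zeroOn ha) (isH_two A.bound hf.lin2.zeroOn hb hc)
  rw [hf.D_f1 ha, show H1 B.D (H2 f2 b c) = H1 f1 (H2 A.l2 b c) - H2 B.l2 (H1 f1 b) (H1 f1 c)
    - H2 f2 (H1 A.D b) c - sgn (-1 * j) • H2 f2 b (H1 A.D c) by
      rw [← hf.D_f2 hb hc]; abel] at h
  exact h

/-- The ternary morphism equation for the alternating sums of the structure maps. -/
theorem alternating_three (l2 : Tot L → Tot L → Tot L) (hl2 : l2 = alt2 (H2 A.l2))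
    (l3 : Tot L → Tot L → Tot L → Tot L)
    (hl3 : l3 = alt3 (pre3 (H2 A.l2) (H3 A.l3) (H2 A.l21)))
    (b3 : Tot M → Tot M → Tot M → Tot M)
    (hb3 : b3 = alt3 (pre3 (H2 B.l2) (H3 B.l3) (H2 B.l21)))
    (g2 : Tot L → Tot L → Tot M) (hg2 : g2 = alt2 (H2 f2))
    (g3 : Tot L → Tot L → Tot L → Tot M)
    (hg3 : g3 = alt3 (preMor3 (H2 A.l2) (H1 f1) (H2 f2) (H2 f21) (H3 f3) (H2 B.l21)))
    (g3' : Tot L → Tot L → Tot L → Tot M)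
    (hg3' : g3' = alt3 fun x y z => (4 : ℤ) • H3 f3 x y z - H2 f21 (H2 A.l2 x y) z
        - H2 f21 x (H2 A.l2 y z) + H2 B.l21 (H2 f2 x y) (H1 f1 z)
        + H2 B.l21 (H1 f1 (signOp k x)) (H2 f2 y z))
    {a b c : Tot L} (h : IsLow a b c) :
    H1 B.D (g3' a b c) - (g3 (H1 A.D a) b c + g3 a (H1 A.D b) c + g3 a b (H1 A.D c))
      = H1 f1 (l3 a b c) - (6 : ℤ) • (g2 a (l2 b c) - g2 (l2 a b) c - g2 b (l2 a c))
        - b3 (H1 f1 a) (H1 f1 b) (H1 f1 c)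
        - (6 : ℤ) • ((H2 B.l2 (H1 f1 (signOp k a)) (g2 b c) - H2 B.l2 (g2 b c) (H1 f1 a))
          - (H2 B.l2 (g2 a b) (H1 f1 c) - H2 B.l2 (H1 f1 (signOp k c)) (g2 a b))
          - (H2 B.l2 (H1 f1 (signOp k b)) (g2 a c) - H2 B.l2 (g2 a c) (H1 f1 b))) := by
  refine ternary_relation IsLow (toLin1 A.linD) (signOp k) (toLin1 B.linD) (toLin1 hf.lin1)
    (toLin2 hf.lin2) (toLin2 hf.lin21) (toLin3 hf.lin3) (toLin2 A.leib.lin2) (toLin2 A.lin21)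
    (toLin3 A.leib.lin3) (toLin2 B.leib.lin2) (toLin2 B.lin21) (toLin3 B.leib.lin3)
    l2 hl2 l3 hl3 b3 hb3 g2 hg2 g3 hg3 g3' hg3' (fun _ _ _ h => h.swap_left)
    (fun _ _ _ h => h.swap_right) ?_ ?_ ?_ ?_ ?_ h
  · rintro a b c (⟨ha, hb, hc⟩ | ⟨ha, hb, hc⟩ | ⟨ha, hb, hc⟩ | ⟨ha, hb, hc⟩)
    all_goals
      have h := hf.D_f3 (thin_three rfl rfl rfl) ha hb hc
      simp only [← toLin1_apply A.linD, ← toLin1_apply B.linD, ← toLin1_apply hf.lin1,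
        ← toLin2_apply hf.lin2, ← toLin3_apply hf.lin3, ← toLin2_apply A.leib.lin2,
        ← toLin2_apply B.leib.lin2, ← toLin3_apply A.leib.lin3, ← toLin3_apply B.leib.lin3,
        Int.reduceMul, Int.reduceAdd, Int.reduceNeg, sgn_zero, sgn_one, sgn_neg_one] at h
      simp (disch := assumption) only [A.D_eq_zero, map_zero, LinearMap.zero_apply, smul_zero,
        sub_zero, add_zero, zero_add, one_smul, signOp_of_zero, signOp_of_one, map_neg,
        LinearMap.neg_apply] at h ⊢
      linear_combination (norm := module) h
  · rintro a b c (⟨ha, hb, hc⟩ | ⟨ha, hb, hc⟩ | ⟨ha, hb, hc⟩ | ⟨ha, hb, hc⟩)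
    all_goals
      have h := hf.f21_l2_left ha hb hc
      simp only [Int.reduceMul, Int.reduceAdd, Int.reduceNeg, sgn_zero, sgn_neg_one] at h
      simp (disch := assumption) only [A.D_eq_zero, map_zero, LinearMap.zero_apply, smul_zero,
        sub_zero, add_zero, zero_add, one_smul] at h ⊢
      linear_combination (norm := module) h
  · rintro a b c (⟨ha, hb, hc⟩ | ⟨ha, hb, hc⟩ | ⟨ha, hb, hc⟩ | ⟨ha, hb, hc⟩)
    all_goals
      have h := hf.f21_l2_right ha hb hc
      simp only [Int.reduceMul, Int.reduceAdd, Int.reduceNeg, sgn_zero, sgn_neg_one] at h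
      simp (disch := assumption) only [A.D_eq_zero, map_zero, LinearMap.zero_apply, smul_zero,
        sub_zero, add_zero, zero_add, one_smul] at h ⊢
      linear_combination (norm := module) h
  · rintro a b c (⟨ha, hb, hc⟩ | ⟨ha, hb, hc⟩ | ⟨ha, hb, hc⟩ | ⟨ha, hb, hc⟩)
    all_goals
      have h := hf.l21_f2_left ha hb hc
      simp only [Int.reduceMul, Int.reduceAdd, Int.reduceNeg, sgn_zero, sgn_one, sgn_neg_one,
        sgn_neg_two] at h
      simp (disch := assumption) only [A.D_eq_zero, map_zero, LinearMap.zero_apply, smul_zero,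
        sub_zero, add_zero, one_smul, signOp_of_zero, signOp_of_one, map_neg, map_sub,
        LinearMap.neg_apply, LinearMap.sub_apply] at h ⊢
      linear_combination (norm := module) h
  · rintro a b c (⟨ha, hb, hc⟩ | ⟨ha, hb, hc⟩ | ⟨ha, hb, hc⟩ | ⟨ha, hb, hc⟩)
    all_goals
      have h := hf.l21_f2_right ha hb hc
      simp only [Int.reduceMul, Int.reduceAdd, Int.reduceNeg, sgn_zero, sgn_one, sgn_neg_one] at h
      simp (disch := assumption) only [A.D_eq_zero, map_zero, LinearMap.zero_apply, smul_zero,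
        sub_zero, add_zero, one_smul, signOp_of_zero, signOp_of_one, map_neg, map_sub,
        LinearMap.neg_apply] at h ⊢
      first
        | linear_combination (norm := module) h
        | linear_combination (norm := module) -h

variable [Invertible (2 : k)] [Invertible (3 : k)]

theorem skew_three {l₂ : MMap L L 2 0} (hl₂ : l₂ = skew2 k A) {l₃ : MMap L L 3 1}
    (hl₃ : l₃ = skew3 k A) {b₂ : MMap M M 2 0} (hb₂ : b₂ = skew2 k B) {b₃ : MMap M M 3 1}
    (hb₃ : b₃ = skew3 k B) {f₂ : MMap L M 2 1} (hf₂ : f₂ = skewMor2 k f2) {f₃ : MMap L M 3 2}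
    (hf₃ : f₃ = skewMor3 k A B f1 f2 f21 f3) {a b c : Tot L} {i j l : ℤ} (hi : 0 ≤ i)
    (hj : 0 ≤ j) (hl : 0 ≤ l) (hd : i + j + l ≤ 1) (ha : IsH i a) (hb : IsH j b)
    (hc : IsH l c) :
    H1 B.D (H3 f₃ a b c) - (H3 f₃ (H1 A.D a) b c + sgn (-1 * i) • H3 f₃ a (H1 A.D b) c
        + sgn (-1 * (i + j)) • H3 f₃ a b (H1 A.D c))
      = H1 f1 (H3 l₃ a b c) - H2 f₂ a (H2 l₂ b c) + H2 f₂ (H2 l₂ a b) c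
        + H2 f₂ b (H2 l₂ a c) - H3 b₃ (H1 f1 a) (H1 f1 b) (H1 f1 c)
        - sgn i • H2 b₂ (H1 f1 a) (H2 f₂ b c) + H2 b₂ (H2 f₂ a b) (H1 f1 c)
        + sgn j • H2 b₂ (H1 f1 b) (H2 f₂ a c) := by
  subst hl₂ hl₃ hb₂ hb₃ hf₂ hf₃
  have F1 : ∀ {x i}, IsH i x → IsH (0 + i) (H1 f1 x) :=
    fun hx => isH_one A.bound hf.lin1.zeroOn hx
  have mA2 := isMultilinear_skew2 k A
  have mA3 := isMultilinear_skew3 k A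
  have mB2 := isMultilinear_skew2 k B
  have mB3 := isMultilinear_skew3 k B
  have m2 := isMultilinear_skewMor2 k A.bound hf.lin2
  have m3 := isMultilinear_skewMor3 k hf
  have hcases : (i = 0 ∧ j = 0 ∧ l = 0) ∨ (i = 1 ∧ j = 0 ∧ l = 0) ∨ (i = 0 ∧ j = 1 ∧ l = 0)
      ∨ (i = 0 ∧ j = 0 ∧ l = 1) := by omega
  have hlow : IsLow a b c := by
    rcases hcases with ⟨rfl, rfl, rfl⟩ | ⟨rfl, rfl, rfl⟩ | ⟨rfl, rfl, rfl⟩ | ⟨rfl, rfl, rfl⟩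
    exacts [.zero ha hb hc, .left ha hb hc, .mid ha hb hc, .right ha hb hc]
  have hij : i * j = 0 := by rcases hcases with h | h | h | h <;> simp [h]
  have hil : i * l = 0 := by rcases hcases with h | h | h | h <;> simp [h]
  have hjl : j * l = 0 := by rcases hcases with h | h | h | h <;> simp [h]
  obtain ⟨l2, hl2⟩ : ∃ l2, l2 = alt2 (H2 A.l2) := ⟨_, rfl⟩
  obtain ⟨l3, hl3⟩ : ∃ l3, l3 = alt3 (pre3 (H2 A.l2) (H3 A.l3) (H2 A.l21)) := ⟨_, rfl⟩
  obtain ⟨b3, hb3⟩ : ∃ b3, b3 = alt3 (pre3 (H2 B.l2) (H3 B.l3) (H2 B.l21)) := ⟨_, rfl⟩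
  obtain ⟨g2, hg2⟩ : ∃ g2, g2 = alt2 (H2 f2) := ⟨_, rfl⟩
  obtain ⟨g3, hg3⟩ : ∃ g3, g3 = alt3 (preMor3 (H2 A.l2) (H1 f1) (H2 f2) (H2 f21) (H3 f3)
    (H2 B.l21)) := ⟨_, rfl⟩
  obtain ⟨g3', hg3'⟩ : ∃ g3', g3' = alt3 fun x y z => (4 : ℤ) • H3 f3 x y z
    - H2 f21 (H2 A.l2 x y) z - H2 f21 x (H2 A.l2 y z) + H2 B.l21 (H2 f2 x y) (H1 f1 z)
    + H2 B.l21 (H1 f1 (signOp k x)) (H2 f2 y z) := ⟨_, rfl⟩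
  have key := hf.alternating_three l2 hl2 l3 hl3 b3 hb3 g2 hg2 g3 hg3 g3' hg3' hlow
  have el2 : ∀ {x y i j}, i * j = 0 → IsH i x → IsH j y → l2 x y = (2 : ℤ) • toLin2 mA2 x y := by
    intro x y i j h hx hy
    rw [toLin2_apply, two_zsmul_skew2 k A hx hy, hl2, alt2, h, sgn_zero, one_smul]
  have eg2 : ∀ {x y i j}, i * j = 0 → IsH i x → IsH j y → g2 x y = (2 : ℤ) • toLin2 m2 x y := by
    intro x y i j h hx hy
    rw [toLin2_apply, two_zsmul_skewMor2 k A.bound hf.lin2 hx hy, hg2, alt2, h, sgn_zero, one_smul]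
  have el3 : l3 a b c = (24 : ℤ) • toLin3 mA3 a b c :=
    hl3 ▸ (zsmul_skew3 k A (thin_three hij hil hjl) ha hb hc).symm
  have eb3 : b3 (H1 f1 a) (H1 f1 b) (H1 f1 c)
      = (24 : ℤ) • toLin3 mB3 (H1 f1 a) (H1 f1 b) (H1 f1 c) :=
    hb3 ▸ (zsmul_skew3 k B (thin_three (by simpa only [zero_add] using hij)
      (by simpa only [zero_add] using hil) (by simpa only [zero_add] using hjl)) (F1 ha) (F1 hb)
      (F1 hc)).symm
  have eg3' : g3' a b c = (24 : ℤ) • toLin3 m3 a b c :=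
    hg3' ▸ (zsmul_skewMor3 k hf (thin_three hij hil hjl) ha hb hc).symm
  have eg3 : ∀ {x y z}, IsH 0 x → IsH 0 y → IsH 0 z → g3 x y z = (24 : ℤ) • toLin3 m3 x y z := by
    intro x y z hx hy hz
    rw [toLin3_apply, zsmul_skewMor3 k hf (thin_three rfl rfl rfl) hx hy hz, hg3]
    exact alt3_congr _ _ _ _ _ (fun x y z => IsH 0 x ∧ IsH 0 y ∧ IsH 0 z)
      (fun x y z h => by rw [preMor3, h.1.signOp k, sgn_zero, one_smul])
      (fun _ _ _ h => ⟨h.2.1, h.1, h.2.2⟩) (fun _ _ _ h => ⟨h.1, h.2.2, h.2.1⟩) ⟨hx, hy, hz⟩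
  have g3_zero : (∀ y z, g3 0 y z = 0) ∧ (∀ x z, g3 x 0 z = 0) ∧ ∀ x y, g3 x y 0 = 0 := by
    simp [hg3, alt3, preMor3, ← toLin1_apply hf.lin1, ← toLin2_apply hf.lin2,
      ← toLin2_apply hf.lin21, ← toLin3_apply hf.lin3, ← toLin2_apply A.leib.lin2,
      ← toLin2_apply B.lin21]
  have D0 : ∀ {x : Tot L}, IsH 0 x → H1 A.D x = 0 := fun hx => A.D_eq_zero hx
  have D1 : ∀ {x : Tot L}, IsH 1 x → IsH 0 (H1 A.D x) :=
    fun hx => isH_one A.bound A.linD.zeroOn hx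
  have e₁ : g3 (H1 A.D a) b c = (24 : ℤ) • toLin3 m3 (H1 A.D a) b c := by
    rcases hcases with ⟨rfl, rfl, rfl⟩ | ⟨rfl, rfl, rfl⟩ | ⟨rfl, rfl, rfl⟩ | ⟨rfl, rfl, rfl⟩
    · simp [D0 ha, g3_zero]
    · exact eg3 (D1 ha) hb hc
    · simp [D0 ha, g3_zero]
    · simp [D0 ha, g3_zero]
  have e₂ : g3 a (H1 A.D b) c = (24 : ℤ) • sgn (-1 * i) • toLin3 m3 a (H1 A.D b) c := by
    rcases hcases with ⟨rfl, rfl, rfl⟩ | ⟨rfl, rfl, rfl⟩ | ⟨rfl, rfl, rfl⟩ | ⟨rfl, rfl, rfl⟩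
    · simp [D0 hb, g3_zero]
    · simp [D0 hb, g3_zero]
    · rw [mul_zero, sgn_zero, one_smul]
      exact eg3 ha (D1 hb) hc
    · simp [D0 hb, g3_zero]
  have e₃ : g3 a b (H1 A.D c) = (24 : ℤ) • sgn (-1 * (i + j)) • toLin3 m3 a b (H1 A.D c) := by
    rcases hcases with ⟨rfl, rfl, rfl⟩ | ⟨rfl, rfl, rfl⟩ | ⟨rfl, rfl, rfl⟩ | ⟨rfl, rfl, rfl⟩
    · simp [D0 hc, g3_zero]
    · simp [D0 hc, g3_zero]
    · simp [D0 hc, g3_zero]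
    · rw [add_zero, mul_zero, sgn_zero, one_smul]
      exact eg3 ha hb (D1 hc)
  have s₁ : sgn i * sgn ((0 + i) * (1 + (j + l))) = 1 := by
    rcases hcases with ⟨rfl, rfl, rfl⟩ | ⟨rfl, rfl, rfl⟩ | ⟨rfl, rfl, rfl⟩ | ⟨rfl, rfl, rfl⟩ <;> rfl
  have s₂ : sgn ((1 + (i + j)) * (0 + l)) = sgn l := by
    rcases hcases with ⟨rfl, rfl, rfl⟩ | ⟨rfl, rfl, rfl⟩ | ⟨rfl, rfl, rfl⟩ | ⟨rfl, rfl, rfl⟩ <;> rfl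
  have s₃ : sgn j * sgn ((0 + j) * (1 + (i + l))) = 1 := by
    rcases hcases with ⟨rfl, rfl, rfl⟩ | ⟨rfl, rfl, rfl⟩ | ⟨rfl, rfl, rfl⟩ | ⟨rfl, rfl, rfl⟩ <;> rfl
  have t₁ := congrArg (sgn i • ·)
    (two_zsmul_skew2 k B (F1 ha) (isH_two A.bound m2.zeroOn hb hc))
  have t₂ := two_zsmul_skew2 k B (isH_two A.bound m2.zeroOn ha hb) (F1 hc)
  have t₃ := congrArg (sgn j • ·)
    (two_zsmul_skew2 k B (F1 hb) (isH_two A.bound m2.zeroOn ha hc))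
  simp only [smul_sub, smul_smul, s₁, s₂, s₃, one_smul] at t₁ t₂ t₃
  have D2 : ∀ {x y i j}, IsH i x → IsH j y → IsH (0 + (i + j)) (toLin2 mA2 x y) :=
    fun hx hy => isH_two A.bound mA2.zeroOn hx hy
  rw [el2 hij ha hb, el2 hil ha hc, el2 hjl hb hc, el3, eb3, eg3', e₁, e₂, e₃, eg2 hij ha hb,
    eg2 hil ha hc, eg2 hjl hb hc, eg2 (by linear_combination hij + hil) ha ((D2 hb hc).zsmul _),
    eg2 (by linear_combination hil + hjl) ((D2 ha hb).zsmul _) hc,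
    eg2 (by linear_combination hij + hjl) hb ((D2 ha hc).zsmul _), ha.signOp k, hb.signOp k,
    hc.signOp k] at key
  simp only [← toLin1_apply A.linD, ← toLin1_apply B.linD, ← toLin1_apply hf.lin1,
    ← toLin2_apply mA2, ← toLin3_apply mA3, ← toLin2_apply mB2, ← toLin3_apply mB3,
    ← toLin2_apply m2, ← toLin3_apply m3, ← toLin2_apply B.leib.lin2, map_zsmul,
    LinearMap.smul_apply] at key t₁ t₂ t₃ ⊢
  apply zsmul_fortyeight_cancel k
  linear_combination (norm := module) (2 : ℤ) • key + (24 : ℤ) • t₁ - (24 : ℤ) • t₂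
    - (24 : ℤ) • t₃

end IsWeakMorphism

end Ternary

/-! ### Vanishing of composites and reduction to low degrees -/

section Vanishing

variable {L M N : ℤ → Type} [∀ i, AddCommGroup (L i)] [∀ i, AddCommGroup (M i)]
  [∀ i, AddCommGroup (N i)] {m : ℕ} {r : ℤ}

theorem zeroOn_of_ev {μ : MMap L M m r}
    (h : ∀ d v, (∀ j, IsH (d j) (v j)) → ∀ j, v j = 0 → ev μ d v = 0) : ZeroOn μ := by
  intro d x j hj
  have := h d (fun j => Pi.single (d j) (x j)) (fun j => isH_single _ _) j (by simp [hj])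
  simpa [ev] using this

theorem ZeroOn.hat {μ : MMap L M m r} (hμ : ZeroOn μ) {v : Fin m → Tot L} (j : Fin m)
    (h : v j = 0) : hat μ v = 0 :=
  Finset.sum_eq_zero fun _ _ => hμ.ev _ _ j (by simp [h])

theorem ZeroOn.add {μ ν : MMap L M m r} (hμ : ZeroOn μ) (hν : ZeroOn ν) : ZeroOn (μ + ν) :=
  fun d x j h => by simp [hμ d x j h, hν d x j h]

theorem ZeroOn.sub {μ ν : MMap L M m r} (hμ : ZeroOn μ) (hν : ZeroOn ν) : ZeroOn (μ - ν) :=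
  fun d x j h => by simp [hμ d x j h, hν d x j h]

theorem ZeroOn.zsmul {μ : MMap L M m r} (hμ : ZeroOn μ) (c : ℤ) : ZeroOn (c • μ) :=
  fun d x j h => by simp [hμ d x j h]

theorem ZeroOn.pa {μ : MMap L M m r} (hμ : ZeroOn μ) (σ : Equiv.Perm (Fin m)) :
    ZeroOn (pa σ μ) :=
  zeroOn_of_ev fun d v _ j h => by rw [ev_pa, hμ.ev _ _ (σ j) (by simp [h]), smul_zero]

theorem ZeroOn.fc1 (hM : Bounded M) {R s : ℤ} {μ : MMap M N 1 r} {g : MMap L M m s}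
    {h : r + s = R} (hμ : ZeroOn μ) (hg : ZeroOn g) : ZeroOn (fc1 R μ g h) :=
  zeroOn_of_ev fun d v _ j hj => by
    rw [ev_fc1 hM R h hμ]
    exact hμ.hat 0 (hg.ev _ _ j (by simp [hj]))

theorem ZeroOn.fc2 (hM : Bounded M) {R : ℤ} {a b : ℕ} {s₁ s₂ : ℤ} {μ : MMap M N 2 r}
    {g₁ : MMap L M a s₁} {g₂ : MMap L M b s₂} {h : r + (s₁ + s₂) = R} (hμ : ZeroOn μ)
    (hg₁ : ZeroOn g₁) (hg₂ : ZeroOn g₂) : ZeroOn (fc2 R μ g₁ g₂ h) :=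
  zeroOn_of_ev fun d v _ j hj => by
    rw [ev_fc2 hM R h hμ]
    induction j using Fin.addCases with
    | left j => rw [hμ.hat 0 (hg₁.ev _ _ j (by simp [hj])), smul_zero]
    | right j => rw [hμ.hat 1 (hg₂.ev _ _ j (by simp [hj])), smul_zero]

theorem ZeroOn.fc3 (hM : Bounded M) {R : ℤ} {a b c : ℕ} {s₁ s₂ s₃ : ℤ} {μ : MMap M N 3 r}
    {g₁ : MMap L M a s₁} {g₂ : MMap L M b s₂} {g₃ : MMap L M c s₃}
    {h : r + (s₁ + s₂ + s₃) = R} (hμ : ZeroOn μ) (hg₁ : ZeroOn g₁) (hg₂ : ZeroOn g₂)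
    (hg₃ : ZeroOn g₃) : ZeroOn (fc3 R μ g₁ g₂ g₃ h) :=
  zeroOn_of_ev fun d v _ j hj => by
    rw [ev_fc3 hM R h hμ]
    induction j using Fin.addCases with
    | left j =>
      induction j using Fin.addCases with
      | left j => rw [hμ.hat 0 (hg₁.ev _ _ j (by simp [hj])), smul_zero]
      | right j => rw [hμ.hat 1 (hg₂.ev _ _ j (by simp [hj])), smul_zero]
    | right j => rw [hμ.hat 2 (hg₃.ev _ _ j (by simp [hj])), smul_zero]

theorem ZeroOn.fc4 (hM : Bounded M) {R : ℤ} {a b c e : ℕ} {s₁ s₂ s₃ s₄ : ℤ} {μ : MMap M N 4 r}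
    {g₁ : MMap L M a s₁} {g₂ : MMap L M b s₂} {g₃ : MMap L M c s₃} {g₄ : MMap L M e s₄}
    {h : r + (s₁ + s₂ + s₃ + s₄) = R} (hμ : ZeroOn μ) (hg₁ : ZeroOn g₁) (hg₂ : ZeroOn g₂)
    (hg₃ : ZeroOn g₃) (hg₄ : ZeroOn g₄) : ZeroOn (fc4 R μ g₁ g₂ g₃ g₄ h) :=
  zeroOn_of_ev fun d v _ j hj => by
    rw [ev_fc4 hM R h hμ]
    induction j using Fin.addCases with
    | left j =>
      induction j using Fin.addCases with
      | left j =>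
        induction j using Fin.addCases with
        | left j => rw [hμ.hat 0 (hg₁.ev _ _ j (by simp [hj])), smul_zero]
        | right j => rw [hμ.hat 1 (hg₂.ev _ _ j (by simp [hj])), smul_zero]
      | right j => rw [hμ.hat 2 (hg₃.ev _ _ j (by simp [hj])), smul_zero]
    | right j => rw [hμ.hat 3 (hg₄.ev _ _ j (by simp [hj])), smul_zero]

/-- Multilinear maps agree if they do so in degrees where neither the arguments nor the result
vanish for degree reasons. -/
theorem eq_of_ev_of_low (hL : Bounded L) (hM : Bounded M) {μ ν : MMap L M m r} (hμ : ZeroOn μ)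
    (hν : ZeroOn ν) (h : ∀ d v, (∀ j, 0 ≤ d j) → r + ∑ j, d j ≤ 2 → (∀ j, IsH (d j) (v j)) →
      ev μ d v = ev ν d v) : μ = ν := by
  refine eq_of_ev fun d v hv => ?_
  by_cases hd : ∀ j, 0 ≤ d j
  · by_cases hr : r + ∑ j, d j ≤ 2
    · exact h d v hd hr hv
    · rw [(isH_ev μ d v).eq_zero hM (by omega), (isH_ev ν d v).eq_zero hM (by omega)]
  · push Not at hd
    obtain ⟨j, hj⟩ := hd
    have h0 := (hv j).eq_zero hL (Or.inl hj)
    rw [hμ.ev d v j (by simp [h0]), hν.ev d v j (by simp [h0])]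

theorem zeroOn_morphism_four (hM : Bounded M) {l₂ : MMap L L 2 0}
    {l₃ : MMap L L 3 1} {b₂ : MMap M M 2 0} {b₃ : MMap M M 3 1} {f₁ : MMap L M 1 0}
    {f₂ : MMap L M 2 1} {f₃ : MMap L M 3 2}
    (hb₂ : ZeroOn b₂) (hb₃ : ZeroOn b₃) (hf₁ : ZeroOn f₁) (hf₂ : ZeroOn f₂)
    (hf₃ : ZeroOn f₃) (h₁ : ZeroOn (m := 4) (pc 2 0 1 f₂ l₃))
    (h₂ : ZeroOn (m := 4) (pc 2 1 0 f₂ l₃)) (h₃ : ZeroOn (m := 4) (pc 2 0 2 f₃ l₂))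
    (h₄ : ZeroOn (m := 4) (pc 2 1 1 f₃ l₂)) (h₅ : ZeroOn (m := 4) (pc 2 2 0 f₃ l₂)) :
    ZeroOn (m := 4) (pc 2 0 1 f₂ l₃ + pc 2 1 0 f₂ l₃ - pa (P12 4) (pc 2 1 0 f₂ l₃)
        + pa (P123 4) (pc 2 1 0 f₂ l₃) - pc 2 0 2 f₃ l₂ + pc 2 1 1 f₃ l₂
        - pa (P12 4) (pc 2 1 1 f₃ l₂) - pc 2 2 0 f₃ l₂ + pa (P23 4) (pc 2 2 0 f₃ l₂)
        - pa (P132 4) (pc 2 2 0 f₃ l₂) + fc2 2 b₂ f₃ f₁ + fc2 2 b₂ f₁ f₃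
        - pa (P12 4) (fc2 2 b₂ f₁ f₃) + pa (P123 4) (fc2 2 b₂ f₁ f₃)
        - fc2 2 b₂ f₂ f₂ + pa (P23 4) (fc2 2 b₂ f₂ f₂) - pa (P132 4) (fc2 2 b₂ f₂ f₂)
        + fc3 2 b₃ f₂ f₁ f₁ - fc3 2 b₃ f₁ f₂ f₁ + pa (P12 4) (fc3 2 b₃ f₁ f₂ f₁)
        + fc3 2 b₃ f₁ f₁ f₂ - pa (P23 4) (fc3 2 b₃ f₁ f₁ f₂)
        + pa (P132 4) (fc3 2 b₃ f₁ f₁ f₂)) := by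
  have h₆ : ZeroOn (m := 4) (fc2 2 b₂ f₃ f₁) := hb₂.fc2 hM hf₃ hf₁
  have h₇ : ZeroOn (m := 4) (fc2 2 b₂ f₁ f₃) := hb₂.fc2 hM hf₁ hf₃
  have h₈ : ZeroOn (m := 4) (fc2 2 b₂ f₂ f₂) := hb₂.fc2 hM hf₂ hf₂
  have h₉ : ZeroOn (m := 4) (fc3 2 b₃ f₂ f₁ f₁) := hb₃.fc3 hM hf₂ hf₁ hf₁
  have h₁₀ : ZeroOn (m := 4) (fc3 2 b₃ f₁ f₂ f₁) := hb₃.fc3 hM hf₁ hf₂ hf₁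
  have h₁₁ : ZeroOn (m := 4) (fc3 2 b₃ f₁ f₁ f₂) := hb₃.fc3 hM hf₁ hf₁ hf₂
  repeat' first
    | assumption
    | apply ZeroOn.pa
    | apply ZeroOn.add
    | apply ZeroOn.sub

end Vanishing

theorem sgn_add (m n : ℤ) : sgn (m + n) = sgn m * sgn n := by
  have h : ∀ n, sgn n = (((-1 : ℤˣ) ^ n : ℤˣ) : ℤ) := by rintro (n | n) <;> simp [sgn]
  simp only [h, zpow_add, Units.val_mul]

theorem sgn_mul_self (n : ℤ) : sgn n * sgn n = 1 := by
  rw [sgn, ← mul_pow]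
  simp

section Morphism

variable {k : Type} [CommRing k] [Invertible (2 : k)] [Invertible (3 : k)] {L M : ℤ → Type}
  [∀ i, AddCommGroup (L i)] [∀ i, Module k (L i)] [∀ i, AddCommGroup (M i)]
  [∀ i, Module k (M i)] {A : WeakLie3 k L} {B : WeakLie3 k M} {f1 : MMap L M 1 0}
  {f2 : MMap L M 2 1} {f21 : MMap L M 2 2} {f3 : MMap L M 3 2}
  (hf : IsWeakMorphism k A B f1 f2 f21 f3)
include hf

namespace IsWeakMorphism

theorem bd_skewMor2 : bd 0 B.D A.D (skewMor2 k f2)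
    = fc1 0 f1 (skew2 k A) - fc2 0 (skew2 k B) f1 f1 := by
  have z1 := hf.lin1.zeroOn
  have zA := (isMultilinear_skew2 k A).zeroOn
  have zB := (isMultilinear_skew2 k B).zeroOn
  have m2 := isMultilinear_skewMor2 k A.bound hf.lin2
  refine eq_of_ev fun d v hv => ?_
  rw [eta2 d, eta2 v]
  have ha := hv 0
  have hb := hv 1
  generalize d 0 = i at ha ⊢
  generalize d 1 = j at hb ⊢
  generalize v 0 = a at ha ⊢
  generalize v 1 = b at hb ⊢
  rw [ev_bd_two A.bound B.bound B.linD.zeroOn A.linD.zeroOn m2.zeroOn ha hb, ev_sub,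
    ev_fc_2 A.bound A.bound z1 zA ha hb, ev_fc_1_1 A.bound B.bound zB z1 z1 ha hb, sgn_one,
    zero_mul, sgn_zero, one_smul]
  have Da : IsH (-1 + i) (H1 A.D a) := isH_one A.bound A.linD.zeroOn ha
  have Db : IsH (-1 + j) (H1 A.D b) := isH_one A.bound A.linD.zeroOn hb
  have F1 : ∀ {x i}, IsH i x → IsH (0 + i) (H1 f1 x) := fun hx => isH_one A.bound z1 hx
  have e₁ := two_zsmul_skewMor2 k A.bound hf.lin2 ha hb
  have e₂ := two_zsmul_skewMor2 k A.bound hf.lin2 Da hb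
  have e₃ := two_zsmul_skewMor2 k A.bound hf.lin2 ha Db
  have e₄ := two_zsmul_skew2 k A ha hb
  have e₅ := two_zsmul_skew2 k B (F1 ha) (F1 hb)
  have h₁ := hf.D_f2 ha hb
  have h₂ := congrArg (sgn (i * j) • ·) (hf.D_f2 hb ha)
  have s₁ : sgn ((-1 + i) * j) = sgn (i * j) * sgn (-1 * j) := by
    rw [← sgn_add]; congr 1; ring
  have s₂ : sgn (-1 * i) * sgn (i * (-1 + j)) = sgn (i * j) := by
    rw [show i * (-1 + j) = -1 * i + i * j by ring, sgn_add, ← mul_assoc, sgn_mul_self, one_mul]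
  have e₃' := congrArg (sgn (-1 * i) • ·) e₃
  rw [s₁] at e₂
  simp only [smul_sub, smul_smul, smul_add, s₂, zero_add] at e₃' e₅ h₂
  have e₁' := congrArg (toLin1 B.linD) e₁
  have e₄' := congrArg (toLin1 hf.lin1) e₄
  simp only [map_zsmul, map_sub, toLin1_apply] at e₁' e₄'
  apply zsmul_fortyeight_cancel k
  linear_combination (norm := module) (24 : ℤ) • (e₁' + e₂ + e₃' - e₄' + e₅ + h₁ - h₂)

theorem bd_skewMor3 : bd 1 B.D A.D (skewMor3 k A B f1 f2 f21 f3)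
    = fc1 1 f1 (skew3 k A) - pc 1 1 0 (skewMor2 k f2) (skew2 k A)
      + pc 1 0 1 (skewMor2 k f2) (skew2 k A) + pa (P12 3) (pc 1 1 0 (skewMor2 k f2) (skew2 k A))
      - fc3 1 (skew3 k B) f1 f1 f1 - fc2 1 (skew2 k B) f1 (skewMor2 k f2)
      + fc2 1 (skew2 k B) (skewMor2 k f2) f1
      + pa (P12 3) (fc2 1 (skew2 k B) f1 (skewMor2 k f2)) := by
  have z1 := hf.lin1.zeroOn
  have mA2 := isMultilinear_skew2 k A
  have zA3 := (isMultilinear_skew3 k A).zeroOn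
  have zB2 := (isMultilinear_skew2 k B).zeroOn
  have zB3 := (isMultilinear_skew3 k B).zeroOn
  have m2 := isMultilinear_skewMor2 k A.bound hf.lin2
  have m3 := isMultilinear_skewMor3 k hf
  have c₁ := (m2.pc A.bound 1 1 0 rfl mA2).zeroOn
  have c₂ := zB2.fc2 (R := 1) (h := rfl) B.bound z1 m2.zeroOn
  refine eq_of_ev_of_low A.bound B.bound ?_ ?_ fun d v hd hs hv => ?_
  · rw [bd_three]
    exact (B.linD.zeroOn.fc1 B.bound m3.zeroOn).sub
      ((((m3.pc A.bound 1 0 2 rfl A.linD).zeroOn.add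
        (m3.pc A.bound 1 1 1 rfl A.linD).zeroOn).add
        (m3.pc A.bound 1 2 0 rfl A.linD).zeroOn).zsmul _)
  · exact ((((((z1.fc1 A.bound zA3).sub c₁).add (m2.pc A.bound 1 0 1 rfl mA2).zeroOn).add
      (c₁.pa _)).sub (zB3.fc3 B.bound z1 z1 z1)).sub c₂).add
        (zB2.fc2 B.bound m2.zeroOn z1) |>.add (c₂.pa _)
  · rw [Fin.sum_univ_three] at hs
    have hi := hd 0
    have hj := hd 1
    have hl := hd 2
    have ha := hv 0
    have hb := hv 1
    have hc := hv 2
    rw [eta3 d, eta3 v]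
    generalize d 0 = i at *
    generalize d 1 = j at *
    generalize d 2 = l at *
    generalize v 0 = a at *
    generalize v 1 = b at *
    generalize v 2 = c at *
    have thin : Thin ![i, j, l] := by
      obtain h | h | h : (i = 0 ∧ j = 0) ∨ (i = 0 ∧ l = 0) ∨ (j = 0 ∧ l = 0) := by omega
      all_goals exact thin_three (by simp [h]) (by simp [h]) (by simp [h])
    rw [ev_bd_three A.bound B.bound B.linD.zeroOn A.linD.zeroOn m3.zeroOn ha hb hc,
      ev_morphism_three A.bound B.bound mA2.zeroOn zA3 zB2 zB3 z1 m2.zeroOn thin ha hb hc,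
      sgn_two, one_smul]
    exact hf.skew_three rfl rfl rfl rfl rfl rfl hi hj hl (by omega) ha hb hc

theorem four_skew4 : fc1 2 f1 (skew4 k A) - fc4 2 (skew4 k B) f1 f1 f1 f1
    = pc 2 0 1 (skewMor2 k f2) (skew3 k A) + pc 2 1 0 (skewMor2 k f2) (skew3 k A)
      - pa (P12 4) (pc 2 1 0 (skewMor2 k f2) (skew3 k A))
      + pa (P123 4) (pc 2 1 0 (skewMor2 k f2) (skew3 k A))
      - pc 2 0 2 (skewMor3 k A B f1 f2 f21 f3) (skew2 k A)
      + pc 2 1 1 (skewMor3 k A B f1 f2 f21 f3) (skew2 k A)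
      - pa (P12 4) (pc 2 1 1 (skewMor3 k A B f1 f2 f21 f3) (skew2 k A))
      - pc 2 2 0 (skewMor3 k A B f1 f2 f21 f3) (skew2 k A)
      + pa (P23 4) (pc 2 2 0 (skewMor3 k A B f1 f2 f21 f3) (skew2 k A))
      - pa (P132 4) (pc 2 2 0 (skewMor3 k A B f1 f2 f21 f3) (skew2 k A))
      + fc2 2 (skew2 k B) (skewMor3 k A B f1 f2 f21 f3) f1
      + fc2 2 (skew2 k B) f1 (skewMor3 k A B f1 f2 f21 f3)
      - pa (P12 4) (fc2 2 (skew2 k B) f1 (skewMor3 k A B f1 f2 f21 f3))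
      + pa (P123 4) (fc2 2 (skew2 k B) f1 (skewMor3 k A B f1 f2 f21 f3))
      - fc2 2 (skew2 k B) (skewMor2 k f2) (skewMor2 k f2)
      + pa (P23 4) (fc2 2 (skew2 k B) (skewMor2 k f2) (skewMor2 k f2))
      - pa (P132 4) (fc2 2 (skew2 k B) (skewMor2 k f2) (skewMor2 k f2))
      + fc3 2 (skew3 k B) (skewMor2 k f2) f1 f1 - fc3 2 (skew3 k B) f1 (skewMor2 k f2) f1
      + pa (P12 4) (fc3 2 (skew3 k B) f1 (skewMor2 k f2) f1)
      + fc3 2 (skew3 k B) f1 f1 (skewMor2 k f2)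
      - pa (P23 4) (fc3 2 (skew3 k B) f1 f1 (skewMor2 k f2))
      + pa (P132 4) (fc3 2 (skew3 k B) f1 f1 (skewMor2 k f2)) := by
  have z1 := hf.lin1.zeroOn
  have mA2 := isMultilinear_skew2 k A
  have mA3 := isMultilinear_skew3 k A
  have zA4 := (isMultilinear_skew4 k A).zeroOn
  have zB2 := (isMultilinear_skew2 k B).zeroOn
  have zB3 := (isMultilinear_skew3 k B).zeroOn
  have zB4 := (isMultilinear_skew4 k B).zeroOn
  have m2 := isMultilinear_skewMor2 k A.bound hf.lin2
  have m3 := isMultilinear_skewMor3 k hf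
  have z2 := m2.zeroOn
  have z3 := m3.zeroOn
  refine eq_of_ev_of_low A.bound B.bound ?_ ?_ fun d v hd hs hv => ?_
  · exact (z1.fc1 A.bound zA4).sub (zB4.fc4 B.bound z1 z1 z1 z1)
  · exact zeroOn_morphism_four B.bound zB2 zB3 z1 z2 z3 (m2.pc A.bound 2 0 1 rfl mA3).zeroOn
      (m2.pc A.bound 2 1 0 rfl mA3).zeroOn (m3.pc A.bound 2 0 2 rfl mA2).zeroOn
      (m3.pc A.bound 2 1 1 rfl mA2).zeroOn (m3.pc A.bound 2 2 0 rfl mA2).zeroOn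
  · have h0 : ∀ j, d j = 0 := fun j =>
      (Finset.sum_eq_zero_iff_of_nonneg fun j _ => hd j).1
        (le_antisymm (by omega) (Finset.sum_nonneg fun j _ => hd j)) j (Finset.mem_univ j)
    obtain rfl : d = ![0, 0, 0, 0] := by funext j; rw [h0]; fin_cases j <;> rfl
    have ha : IsH 0 (v 0) := hv 0
    have hb : IsH 0 (v 1) := hv 1
    have hc : IsH 0 (v 2) := hv 2
    have he : IsH 0 (v 3) := hv 3
    rw [eta4 v, ev_sub, ev_fc_4 A.bound A.bound z1 zA4 ha hb hc he,
      ev_fc_1_1_1_1 A.bound B.bound zB4 z1 z1 z1 z1 ha hb hc he,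
      ev_morphism_four A.bound B.bound mA2.zeroOn mA3.zeroOn zB2 zB3 z1 z2 z3 ha hb hc he]
    have h := hf.skew_four rfl rfl rfl rfl rfl rfl ha hb hc he
    rw [← h]
    simp [sgn_zero]

theorem pa_skewMor2 (σ : Equiv.Perm (Fin 2)) :
    pa σ (skewMor2 k f2) = (Equiv.Perm.sign σ : ℤ) • skewMor2 k f2 := by
  have z2 := (isMultilinear_skewMor2 k A.bound hf.lin2).zeroOn
  refine eq_of_ev fun d v hv => ?_
  have hσ : σ = 1 ∨ σ = P12 2 := by
    have h := Finset.mem_univ σ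
    rw [show (Finset.univ : Finset (Equiv.Perm (Fin 2))) = {1, P12 2} by decide] at h
    simpa using h
  obtain rfl | rfl := hσ
  · rw [pa_one, Equiv.Perm.sign_one, Units.val_one, one_smul]
  · have e₁ := two_zsmul_skewMor2 k A.bound hf.lin2 (hv 0) (hv 1)
    have e₂ := congrArg (sgn (d 0 * d 1) • ·) (two_zsmul_skewMor2 k A.bound hf.lin2 (hv 1) (hv 0))
    simp only [smul_sub, smul_smul, mul_comm (d 1) (d 0), sgn_mul_self, one_smul] at e₂
    rw [ev_zsmul, eta2 d, eta2 v, ev_pa_P12_two, ev_two A.bound z2 (hv 1) (hv 0),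
      ev_two A.bound z2 (hv 0) (hv 1), show Equiv.Perm.sign (P12 2) = -1 by decide]
    apply zsmul_fortyeight_cancel k
    push_cast
    linear_combination (norm := module) (24 : ℤ) • (e₁ + e₂)

theorem pa_skewMor3 (σ : Equiv.Perm (Fin 3)) :
    pa σ (skewMor3 k A B f1 f2 f21 f3)
      = (Equiv.Perm.sign σ : ℤ) • skewMor3 k A B f1 f2 f21 f3 := by
  have z3 := (isMultilinear_skewMor3 k hf).zeroOn
  refine eq_of_ev_of_low A.bound B.bound (z3.pa σ) (z3.zsmul _) fun d v hd hs hv => ?_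
  rw [Fin.sum_univ_three] at hs
  have hi := hd 0
  have hj := hd 1
  have hl := hd 2
  have thin : Thin d := by
    have : Thin ![d 0, d 1, d 2] := thin_three (by nlinarith) (by nlinarith) (by nlinarith)
    rwa [← eta3 d] at this
  rw [ev_pa_of_thin _ thin, ev_zsmul]
  obtain ⟨G, hG⟩ : ∃ G : (Fin 3 → Tot L) → Tot M, G = fun w =>
      (4 : ℤ) • H3 f3 (w 0) (w 1) (w 2) - H2 f21 (H2 A.l2 (w 0) (w 1)) (w 2)
        - H2 f21 (w 0) (H2 A.l2 (w 1) (w 2)) + H2 B.l21 (H2 f2 (w 0) (w 1)) (H1 f1 (w 2))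
        + H2 B.l21 (H1 f1 (signOp k (w 0))) (H2 f2 (w 1) (w 2)) := ⟨_, rfl⟩
  have key : ∀ {d v}, Thin d → (∀ j, IsH (d j) (v j)) →
      (24 : ℤ) • ev (skewMor3 k A B f1 f2 f21 f3) d v
        = ∑ σ : Equiv.Perm (Fin 3), (Equiv.Perm.sign σ : ℤ) • G (v ∘ σ) := by
    intro d v hd hv
    have hd' : Thin ![d 0, d 1, d 2] := by rwa [← eta3 d]
    have h := zsmul_skewMor3 k hf hd' (hv 0) (hv 1) (hv 2)
    rw [← ev_three A.bound z3 (hv 0) (hv 1) (hv 2), ← eta3 d, ← eta3 v] at h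
    rw [h, congrArg (fun w => ∑ σ : Equiv.Perm (Fin 3), (Equiv.Perm.sign σ : ℤ) • G (w ∘ σ))
      (eta3 v), sum_sign_three G, hG]
    rfl
  apply zsmul_fortyeight_cancel k
  have h := key (thin.comp σ.symm) fun j => hv (σ.symm j)
  rw [sum_sign_comp G v σ.symm, ← key thin hv, Equiv.Perm.sign_symm] at h
  linear_combination (norm := module) (2 : ℤ) • h

end IsWeakMorphism
end Morphism

/-- **Skew-symmetrization of a weak morphism is a morphism of (semi-strict) Lie
3-algebras**: if `f = (f1,f2,f21,f3) : (L,d,λ) → (L',d',λ')` is a weak morphism of weak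
Lie 3-algebras over `k` with `2, 3` invertible, then `(f̄1, f̄2, f̄3)` is a morphism of
Lie 3-algebras `(L,d,λ̄) → (L',d',λ̄')`, with `f̄2, f̄3` skew-symmetric. -/
theorem skew_symmetrization_of_weak_morphism
    (k : Type) [CommRing k] [Invertible (2 : k)] [Invertible (3 : k)]
    {L M : ℤ → Type} [∀ i, AddCommGroup (L i)] [∀ i, Module k (L i)]
    [∀ i, AddCommGroup (M i)] [∀ i, Module k (M i)]
    (A : WeakLie3 k L) (B : WeakLie3 k M)
    (f1 : MMap L M 1 0) (f2 : MMap L M 2 1) (f21 : MMap L M 2 2) (f3 : MMap L M 3 2)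
    (hf : IsWeakMorphism k A B f1 f2 f21 f3) :
    IsLeibMorphism k A.D B.D (skew2 k A) (skew3 k A) (skew4 k A)
      (skew2 k B) (skew3 k B) (skew4 k B)
      f1 (skewMor2 k f2) (skewMor3 k A B f1 f2 f21 f3) ∧
    (∀ σ : Equiv.Perm (Fin 2),
      pa σ (skewMor2 k f2) = (Equiv.Perm.sign σ : ℤ) • skewMor2 k f2) ∧
    (∀ σ : Equiv.Perm (Fin 3),
      pa σ (skewMor3 k A B f1 f2 f21 f3)
        = (Equiv.Perm.sign σ : ℤ) • skewMor3 k A B f1 f2 f21 f3) := by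
  exact ⟨⟨hf.lin1, isMultilinear_skewMor2 k A.bound hf.lin2, isMultilinear_skewMor3 k hf, hf.m1,
    hf.bd_skewMor2, hf.bd_skewMor3, hf.four_skew4⟩, hf.pa_skewMor2, hf.pa_skewMor3⟩

end WL3
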